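/- Let (X, μ) be a standard Borel probability space endowed with a free probability-measure-preserving action of a finitely generated abelian group G = ℤ^d × Δ (Δ a finite abelian group), and let A, B ⊆ X be two measurable G-uniform sets. Then the following are equivalent: (a) A and B satisfy Hall's condition a.e. with respect to G; (b) A and B are G-equidecomposable up to measure zero (with possibly non-measurable pieces); (c) A and B are G-equidecomposable up to measure zero with measurable pieces. -/

import Mathlib

open Pointwise MeasureTheory

/-- `P` is a partition of `A` into finitely many (possibly empty) pieces. -/
def IsPartitionOf {X : Type*} {n : ℕ} (P : Fin n → Set X) (A : Set X) : Prop :=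
  (⋃ i, P i) = A ∧ Pairwise (Function.onFun Disjoint P)

/-- `A` and `B` are `G`-equidecomposable up to measure zero (with possibly
non-measurable pieces), for an additively written group action. -/
def EquidecompUpToNull {X G : Type*} [AddGroup G] [AddAction G X] [MeasurableSpace X]
    (μ : Measure X) (A B : Set X) : Prop :=
  ∃ (n : ℕ) (P : Fin n → Set X) (g : Fin n → G) (X' : Set X),
    μ X'ᶜ = 0 ∧
    IsPartitionOf (fun i => P i ∩ X') (A ∩ X') ∧
    IsPartitionOf (fun i => (g i +ᵥ P i) ∩ X') (B ∩ X')

/-- `A` and `B` are `G`-equidecomposable up to measure zero with measurable pieces. -/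
def EquidecompUpToNullMeasurable {X G : Type*} [AddGroup G] [AddAction G X] [MeasurableSpace X]
    (μ : Measure X) (A B : Set X) : Prop :=
  ∃ (n : ℕ) (P : Fin n → Set X) (g : Fin n → G) (X' : Set X),
    (∀ i, MeasurableSet (P i)) ∧
    μ X'ᶜ = 0 ∧
    IsPartitionOf (fun i => P i ∩ X') (A ∩ X') ∧
    IsPartitionOf (fun i => (g i +ᵥ P i) ∩ X') (B ∩ X')

/-- `A` and `B` satisfy Hall's condition a.e. with respect to `G`. -/
def HallConditionAE {X G : Type*} [AddGroup G] [AddAction G X] [MeasurableSpace X]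
    (μ : Measure X) (A B : Set X) : Prop :=
  ∃ (F : Finset G) (X' : Set X), μ X'ᶜ = 0 ∧ ∀ x ∈ X',
    (∀ S : Finset X, ↑S ⊆ A ∩ AddAction.orbit G x →
      S.card ≤ (((F : Set G) +ᵥ (S : Set X)) ∩ B).ncard) ∧
    (∀ T : Finset X, ↑T ⊆ B ∩ AddAction.orbit G x →
      T.card ≤ (((-(F : Set G)) +ᵥ (T : Set X)) ∩ A).ncard)

/-- The box `F_n = {0, 1, …, n-1}^d × Δ` in the group `ℤ^d × Δ`. -/
def Fbox (d : ℕ) (Δ : Type*) (n : ℕ) : Set ((Fin d → ℤ) × Δ) :=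
  {g | ∀ i, g.1 i ∈ Set.Ico (0 : ℤ) n}

/-- `A` is `G`-uniform for `G = ℤ^d × Δ`: there are `c > 0` and `n₀` such that for a.e.
`x ∈ X` and every `n > n₀` one has `|A ∩ (F_n · x)| ≥ c n^d`. -/
def GUniform {X : Type*} {d : ℕ} {Δ : Type*} [AddGroup Δ]
    [AddAction ((Fin d → ℤ) × Δ) X] [MeasurableSpace X]
    (μ : Measure X) (A : Set X) : Prop :=
  ∃ (c : ℝ) (n₀ : ℕ), 0 < c ∧ ∀ᵐ x ∂μ, ∀ n : ℕ, n₀ < n →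
    c * (n : ℝ) ^ d ≤
      ((A ∩ ((fun g : (Fin d → ℤ) × Δ => g +ᵥ x) '' Fbox d Δ n)).ncard : ℝ)

/-! ### Countable measurable choice -/

theorem mh_exists_choice {Y ι : Type*} [MeasurableSpace Y] [Countable ι] (P : ι → Set Y)
    (hP : ∀ i, MeasurableSet (P i)) (h : ∀ y, ∃ i, y ∈ P i) :
    ∃ c : Y → ι, (∀ i, MeasurableSet {y | c y = i}) ∧ ∀ y, y ∈ P (c y) := by
  classical
  obtain ⟨e, he⟩ := exists_injective_nat ι
  have h' : ∀ y, ∃ n, ∃ i, e i = n ∧ y ∈ P i := fun y => by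
    obtain ⟨i, hi⟩ := h y
    exact ⟨_, i, rfl, hi⟩
  choose c hc1 hc2 using fun y => Nat.find_spec (h' y)
  refine ⟨c, fun i => ?_, hc2⟩
  have : {y | c y = i} = P i ∩ ⋂ j ∈ {j | e j < e i}, (P j)ᶜ := by
    ext y
    simp only [Set.mem_ofPred_eq, Set.mem_inter_iff, Set.mem_iInter, Set.mem_compl_iff]
    constructor
    · rintro rfl
      refine ⟨hc2 y, fun j hj hy => ?_⟩
      rw [hc1 y] at hj
      exact Nat.find_min (h' y) hj ⟨j, rfl, hy⟩
    · rintro ⟨hi, hj⟩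
      apply he
      rw [hc1 y]
      apply le_antisymm
      · exact Nat.find_min' (h' y) ⟨i, rfl, hi⟩
      · by_contra hlt
        push Not at hlt
        rw [← hc1 y] at hlt
        exact hj _ hlt (hc2 y)
  rw [this]
  exact (hP i).inter (MeasurableSet.biInter (Set.to_countable _) fun j _ => (hP j).compl)

theorem mh_measurable_glue {Y ι β : Type*} [MeasurableSpace Y] [MeasurableSpace β] [Countable ι]
    (c : Y → ι) (hc : ∀ i, MeasurableSet {y | c y = i}) (F : ι → Y → β)
    (hF : ∀ i, Measurable (F i)) : Measurable (fun y => F (c y) y) := by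
  intro S hS
  have : (fun y => F (c y) y) ⁻¹' S = ⋃ i, ({y | c y = i} ∩ F i ⁻¹' S) := by
    ext y; simp
  rw [this]
  exact MeasurableSet.iUnion fun i => (hc i).inter (hF i hS)

/-- Standard generator. -/
def mhE {d : ℕ} (i : Fin d) : Fin d → ℤ := Pi.single i 1

/-- Divergence. -/
def mhDiv {d : ℕ} {Y R : Type*} [AddAction (Fin d → ℤ) Y] [AddCommGroup R]
    (φ : Fin d → Y → R) (y : Y) : R := ∑ i, (φ i y - φ i (-(mhE i) +ᵥ y))

/-- Maximal markers. -/
theorem mh_marker {d : ℕ} {Y : Type*} [MeasurableSpace Y] [AddAction (Fin d → ℤ) Y]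
    (hm : ∀ v : Fin d → ℤ, Measurable (fun y : Y => v +ᵥ y))
    (hfree : ∀ v : Fin d → ℤ, v ≠ 0 → ∀ y : Y, v +ᵥ y ≠ y)
    (s : Y → ℝ) (hs : Measurable s) (hinj : Function.Injective s)
    (V : Finset (Fin d → ℤ)) (hV : ∀ v ∈ V, v ≠ 0) (hV' : ∀ v ∈ V, -v ∈ V) :
    ∃ M : Set Y, MeasurableSet M ∧ (∀ y ∈ M, ∀ v ∈ V, v +ᵥ y ∉ M) ∧
      ∀ y, y ∈ M ∨ ∃ v ∈ V, v +ᵥ y ∈ M := by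
  classical
  -- countable cover by V-independent sets
  let U0 : ℚ × ℚ → Set Y := fun q => {y | s y ∈ Set.Ioo (q.1 : ℝ) q.2 ∧
    ∀ v ∈ V, s (v +ᵥ y) ∉ Set.Ioo (q.1 : ℝ) q.2}
  have hU0m : ∀ q, MeasurableSet (U0 q) := by
    intro q
    have : U0 q = (s ⁻¹' Set.Ioo (q.1 : ℝ) q.2) ∩
        ⋂ v ∈ V, ((fun y => s (v +ᵥ y)) ⁻¹' Set.Ioo (q.1 : ℝ) q.2)ᶜ := by
      ext y; simp [U0]
    rw [this]
    exact (hs measurableSet_Ioo).inter (Finset.measurableSet_biInter _ fun v _ =>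
      ((hs.comp (hm v)) measurableSet_Ioo).compl)
  have hU0c : ∀ y, ∃ q, y ∈ U0 q := by
    intro y
    obtain ⟨ε, hε, hεV⟩ : ∃ ε > 0, ∀ v ∈ V, ε ≤ |s (v +ᵥ y) - s y| := by
      by_cases hne : V.Nonempty
      · obtain ⟨v0, hv0, hmin⟩ := V.exists_min_image (fun v => |s (v +ᵥ y) - s y|) hne
        refine ⟨_, ?_, hmin⟩
        rw [gt_iff_lt, abs_pos, sub_ne_zero]
        exact fun h => hfree v0 (hV v0 hv0) y (hinj h)
      · rw [Finset.not_nonempty_iff_eq_empty] at hne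
        exact ⟨1, one_pos, by simp [hne]⟩
    obtain ⟨q1, h1, h1'⟩ := exists_rat_btwn (show s y - ε < s y by linarith)
    obtain ⟨q2, h2, h2'⟩ := exists_rat_btwn (show s y < s y + ε by linarith)
    refine ⟨(q1, q2), ⟨h1', h2⟩, fun v hv hmem => ?_⟩
    have := hεV v hv
    have h3 : |s (v +ᵥ y) - s y| < ε := by
      rw [abs_lt]; constructor <;> linarith [hmem.1, hmem.2]
    linarith
  obtain ⟨r, hr⟩ := exists_surjective_nat (ℚ × ℚ)
  let U : ℕ → Set Y := fun n => U0 (r n)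
  let N : Set Y → Set Y := fun M => ⋃ v ∈ V, (fun y => v +ᵥ y) ⁻¹' M
  let Ms : ℕ → Set Y := fun n => Nat.rec ∅ (fun n M => M ∪ (U n \ N M)) n
  have hMs : ∀ n, Ms (n + 1) = Ms n ∪ (U n \ N (Ms n)) := fun n => rfl
  have hMm : ∀ n, MeasurableSet (Ms n) := by
    intro n
    induction n with
    | zero => exact MeasurableSet.empty
    | succ n ih =>
      rw [hMs]
      exact ih.union ((hU0m _).diff (Finset.measurableSet_biUnion _ fun v _ => hm v ih))
  have hmono : Monotone Ms := monotone_nat_of_le_succ fun n => by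
    rw [hMs]; exact Set.subset_union_left
  have hind : ∀ n, ∀ y ∈ Ms n, ∀ v ∈ V, v +ᵥ y ∉ Ms n := by
    intro n
    induction n with
    | zero => intro y hy; exact hy.elim
    | succ n ih =>
      intro y hy v hv hvy
      rw [hMs] at hy hvy
      rcases hy with hy | ⟨hyU, hyN⟩
      · rcases hvy with hvy | ⟨_, hvN⟩
        · exact ih y hy v hv hvy
        · apply hvN
          simp only [N, Set.mem_iUnion, Set.mem_preimage]
          exact ⟨-v, hV' v hv, by simpa using hy⟩
      · rcases hvy with hvy | ⟨hvU, _⟩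
        · apply hyN
          simp only [N, Set.mem_iUnion, Set.mem_preimage]
          exact ⟨v, hv, hvy⟩
        · exact hyU.2 v hv hvU.1
  refine ⟨⋃ n, Ms n, MeasurableSet.iUnion hMm, ?_, ?_⟩
  · intro y hy v hv hvy
    obtain ⟨n, hn⟩ := Set.mem_iUnion.1 hy
    obtain ⟨m, hm⟩ := Set.mem_iUnion.1 hvy
    exact hind (max n m) y (hmono (le_max_left _ _) hn) v hv (hmono (le_max_right _ _) hm)
  · intro y
    obtain ⟨q, hq⟩ := hU0c y
    obtain ⟨n, rfl⟩ := hr q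
    by_cases hN : y ∈ N (Ms n)
    · right
      simp only [N, Set.mem_iUnion, Set.mem_preimage] at hN
      obtain ⟨v, hv, hvy⟩ := hN
      exact ⟨v, hv, Set.mem_iUnion.2 ⟨n, hvy⟩⟩
    · left
      exact Set.mem_iUnion.2 ⟨n + 1, by rw [hMs]; exact Or.inr ⟨hq, hN⟩⟩

/-- Greedy choice of shifts so that almost every point is covered infinitely often. -/
theorem mh_cover {Y T : Type*} [MeasurableSpace Y] (ν : Measure Y) [IsProbabilityMeasure ν]
    [Fintype T] (C : ℕ → T → Set Y) (hC : ∀ k t, MeasurableSet (C k t))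
    (hcov : ∀ k y, ∃ t, y ∈ C k t) :
    ∃ t : ℕ → T, ∀ᵐ y ∂ν, ∀ n, ∃ k, n ≤ k ∧ y ∈ C k (t k) := by
  classical
  obtain ⟨y0⟩ : Nonempty Y := ν.nonempty_of_neZero
  have : Nonempty T := ⟨(hcov 0 y0).choose⟩
  set c : ℝ := ((Fintype.card T : ℕ) : ℝ) with hc
  have hcpos : 0 < c := by rw [hc]; exact_mod_cast Fintype.card_pos
  -- a good shift exists for every weight
  have key : ∀ (k : ℕ) (w : Y → ℝ), ∃ t, (Measurable w → (∀ y, 0 ≤ w y ∧ w y ≤ 1) →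
      (∫ y, w y ∂ν) / c ≤ ∫ y, (C k t).indicator w y ∂ν) := by
    intro k w
    by_contra hcon
    push Not at hcon
    obtain ⟨hw, hb, -⟩ := hcon (Classical.arbitrary T)
    have hintg : ∀ t, Integrable ((C k t).indicator w) ν := fun t =>
      (Integrable.of_bound hw.aestronglyMeasurable 1 (Filter.Eventually.of_forall fun y => by
        rw [Real.norm_of_nonneg (hb y).1]; exact (hb y).2)).indicator (hC k t)
    have h1 : ∫ y, w y ∂ν ≤ ∫ y, ∑ t, (C k t).indicator w y ∂ν := by
      apply integral_mono
      · exact Integrable.of_bound hw.aestronglyMeasurable 1 (Filter.Eventually.of_forall fun y => by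
          rw [Real.norm_of_nonneg (hb y).1]; exact (hb y).2)
      · exact integrable_finset_sum _ fun t _ => hintg t
      · intro y
        obtain ⟨t, ht⟩ := hcov k y
        calc w y = (C k t).indicator w y := by rw [Set.indicator_of_mem ht]
          _ ≤ _ := Finset.single_le_sum (f := fun t => (C k t).indicator w y)
            (fun t _ => Set.indicator_nonneg (fun y _ => (hb y).1) y) (Finset.mem_univ t)
    rw [integral_finset_sum _ fun t _ => hintg t] at h1
    have h2 : ∑ t, ∫ y, (C k t).indicator w y ∂ν < ∑ _t : T, (∫ y, w y ∂ν) / c :=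
      Finset.sum_lt_sum_of_nonempty Finset.univ_nonempty fun t _ => (hcon t).2.2
    rw [Finset.sum_const, Finset.card_univ, nsmul_eq_mul, ← hc, mul_div_cancel₀ _ hcpos.ne'] at h2
    linarith
  choose τ hτ using key
  let w : ℕ → Y → ℝ := fun n => Nat.rec (fun _ => 1)
    (fun k w y => w y - (C k (τ k w)).indicator w y / 2) n
  have hw0 : w 0 = fun _ => 1 := rfl
  have hws : ∀ k, w (k + 1) = fun y => w k y - (C k (τ k (w k))).indicator (w k) y / 2 :=
    fun k => rfl
  have hwm : ∀ k, Measurable (w k) := by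
    intro k
    induction k with
    | zero => rw [hw0]; exact measurable_const
    | succ k ih => rw [hws]; exact ih.sub ((ih.indicator (hC _ _)).div_const _)
  have hwb : ∀ k y, 0 < w k y ∧ w k y ≤ 1 := by
    intro k y
    induction k with
    | zero => rw [hw0]; norm_num
    | succ k ih =>
      rw [hws]
      by_cases hy : y ∈ C k (τ k (w k))
      · simp only [Set.indicator_of_mem hy]; constructor <;> linarith [ih.1, ih.2]
      · simp only [Set.indicator_of_notMem hy]; constructor <;> linarith [ih.1, ih.2]
  have hwi : ∀ k, Integrable (w k) ν := fun k =>
    Integrable.of_bound (hwm k).aestronglyMeasurable 1 (Filter.Eventually.of_forall fun y => by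
        rw [Real.norm_of_nonneg (hwb k y).1.le]; exact (hwb k y).2)
  have hI : ∀ k, ∫ y, w (k + 1) y ∂ν ≤ (1 - 1 / (2 * c)) * ∫ y, w k y ∂ν := by
    intro k
    have h1 := hτ k (w k) (hwm k) (fun y => ⟨(hwb k y).1.le, (hwb k y).2⟩)
    rw [hws, integral_sub (hwi k) (((hwi k).indicator (hC _ _)).div_const 2), integral_div]
    have : (1 - 1 / (2 * c)) * ∫ y, w k y ∂ν = (∫ y, w k y ∂ν) - (∫ y, w k y ∂ν) / c / 2 := by
      field_simp
    rw [this]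
    linarith
  have hc1 : 1 ≤ c := by rw [hc]; exact_mod_cast Nat.succ_le_of_lt Fintype.card_pos
  have hq0 : 0 ≤ 1 - 1 / (2 * c) := by
    have : 1 / (2 * c) ≤ 1 := by rw [div_le_one (by positivity)]; linarith
    linarith
  have hq1 : 1 - 1 / (2 * c) < 1 := by
    have : 0 < 1 / (2 * c) := by positivity
    linarith
  have hIk : ∀ k, ∫ y, w k y ∂ν ≤ (1 - 1 / (2 * c)) ^ k := by
    intro k
    induction k with
    | zero => rw [hw0]; simp
    | succ k ih =>
      calc _ ≤ _ := hI k
        _ ≤ (1 - 1 / (2 * c)) * (1 - 1 / (2 * c)) ^ k := by gcongr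
        _ = _ := by ring
  refine ⟨fun k => τ k (w k), ?_⟩
  rw [ae_all_iff]
  intro n
  set bad : Set Y := ⋂ k ∈ {k | n ≤ k}, (C k (τ k (w k)))ᶜ with hbad
  have hbm : MeasurableSet bad := MeasurableSet.biInter (Set.to_countable _)
    fun k _ => (hC _ _).compl
  have hconst : ∀ y ∈ bad, ∀ j, w (n + j) y = w n y := by
    intro y hy j
    induction j with
    | zero => rfl
    | succ j ih =>
      rw [← ih, ← add_assoc, hws]
      have : y ∉ C (n + j) (τ (n + j) (w (n + j))) := by
        simp only [hbad, Set.mem_iInter] at hy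
        exact hy (n + j) (Nat.le_add_right n j)
      simp [Set.indicator_of_notMem this]
  have hz : ∫ y, bad.indicator (w n) y ∂ν = 0 := by
    apply le_antisymm
    · refine ge_of_tendsto (tendsto_pow_atTop_nhds_zero_of_lt_one hq0 hq1) ?_
      filter_upwards [Filter.eventually_ge_atTop n] with k hk
      obtain ⟨j, rfl⟩ := Nat.exists_eq_add_of_le hk
      refine le_trans ?_ (hIk _)
      apply integral_mono ((hwi n).indicator hbm) (hwi _)
      intro y
      by_cases hy : y ∈ bad
      · simp only [Set.indicator_of_mem hy, hconst y hy j]; exact le_rfl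
      · simp only [Set.indicator_of_notMem hy]; exact (hwb _ y).1.le
    · exact integral_nonneg fun y => Set.indicator_nonneg (fun y _ => (hwb n y).1.le) y
  rw [integral_eq_zero_iff_of_nonneg (fun y => Set.indicator_nonneg (fun y _ => (hwb n y).1.le) y)
    ((hwi n).indicator hbm)] at hz
  filter_upwards [hz] with y hy
  by_contra hcon
  push Not at hcon
  have hyb : y ∈ bad := by
    simp only [hbad, Set.mem_iInter]
    exact fun k hk => hcon k hk
  simp only [Set.indicator_of_mem hyb, Pi.zero_apply] at hy
  linarith [(hwb n y).1]

/-- The box `[0,n)^d`. -/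
noncomputable def mhBox (d n : ℕ) : Finset (Fin d → ℤ) := Fintype.piFinset fun _ => Finset.Ico (0 : ℤ) n

theorem mem_mhBox {d n : ℕ} {x : Fin d → ℤ} : x ∈ mhBox d n ↔ ∀ i, 0 ≤ x i ∧ x i < n := by
  simp [mhBox]

theorem card_mhBox (d n : ℕ) : (mhBox d n).card = n ^ d := by
  simp [mhBox]

theorem mhE_same {d : ℕ} (i : Fin d) : mhE i i = 1 := by simp [mhE]
theorem mhE_ne {d : ℕ} {i j : Fin d} (h : j ≠ i) : mhE i j = 0 := by simp [mhE, h]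

theorem mh_slab {d n : ℕ} (i : Fin d) :
    ((mhBox d n).filter (fun g => g - mhE i ∉ mhBox d n)).card * n ≤ n ^ d := by
  classical
  rcases Nat.eq_zero_or_pos n with rfl | hn
  · simp
  have hsub : (mhBox d n).filter (fun g => g - mhE i ∉ mhBox d n) ⊆
      Fintype.piFinset (fun j => if j = i then {(0 : ℤ)} else Finset.Ico (0 : ℤ) n) := by
    intro g hg
    rw [Finset.mem_filter, mem_mhBox, mem_mhBox] at hg
    rw [Fintype.mem_piFinset]
    obtain ⟨h1, h2⟩ := hg
    push Not at h2
    obtain ⟨j, hj⟩ := h2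
    have hji : j = i := by
      by_contra hne
      simp only [Pi.sub_apply, mhE_ne hne, sub_zero] at hj
      have := hj (h1 j).1
      linarith [(h1 j).2]
    subst hji
    simp only [Pi.sub_apply, mhE_same] at hj
    intro k
    by_cases hk : k = j
    · subst hk
      simp only [if_true, Finset.mem_singleton]
      have := h1 k
      by_contra hne
      have := hj (by omega)
      omega
    · simp [hk, h1 k]
  calc _ ≤ (Fintype.piFinset (fun j => if j = i then {(0 : ℤ)} else Finset.Ico (0 : ℤ) n)).card * n :=
        Nat.mul_le_mul_right _ (Finset.card_le_card hsub)
    _ = n ^ d := by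
      rw [Fintype.card_piFinset, ← Finset.mul_prod_erase Finset.univ _ (Finset.mem_univ i)]
      have : ∏ x ∈ Finset.univ.erase i, (if x = i then {(0 : ℤ)} else Finset.Ico (0 : ℤ) n).card
          = ∏ x ∈ Finset.univ.erase i, n := by
        apply Finset.prod_congr rfl
        intro x hx
        simp [Finset.ne_of_mem_erase hx]
      rw [this]
      simp only [if_true, Finset.card_singleton, one_mul, Finset.prod_const, Finset.card_erase_of_mem (Finset.mem_univ i), Finset.card_univ, Fintype.card_fin]
      rw [← pow_succ]
      congr 1
      have := i.pos
      omega

theorem mh_real_approx {d : ℕ} {Y : Type*} [MeasurableSpace Y] [AddAction (Fin d → ℤ) Y]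
    (hm : ∀ v : Fin d → ℤ, Measurable (fun y : Y => v +ᵥ y))
    (f : Y → ℤ) (hf : Measurable f) (ψ : Fin d → Y → ℤ) (K : ℕ) (hK : ∀ i y, |ψ i y| ≤ K)
    (hdiv : ∀ y, mhDiv ψ y = f y) (n : ℕ) (hn : 0 < n) :
    ∃ φ : Fin d → Y → ℝ, (∀ i, Measurable (φ i)) ∧ (∀ i y, |φ i y| ≤ K) ∧
      ∀ y, |mhDiv φ y - f y| ≤ 2 * d * K / n := by
  classical
  let P : (((Fin d → ℤ) × Fin d) →₀ ℤ) → Set Y := fun m =>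
    {z | (∀ p, |m p| ≤ K) ∧ ∀ g ∈ mhBox d n, ∑ i, (m (g, i) - m (g - mhE i, i)) = f (g +ᵥ z)}
  have hPm : ∀ m, MeasurableSet (P m) := by
    intro m
    have : P m = {_z | ∀ p, |m p| ≤ K} ∩ ⋂ g ∈ mhBox d n,
        (fun z => f (g +ᵥ z)) ⁻¹' {∑ i, (m (g, i) - m (g - mhE i, i))} := by
      ext z; simp [P, eq_comm]
    rw [this]
    exact (MeasurableSet.const _).inter (Finset.measurableSet_biInter _ fun g _ =>
      (hf.comp (hm g)) (measurableSet_singleton _))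
  have hPe : ∀ z, ∃ m, z ∈ P m := by
    intro z
    let S : Finset ((Fin d → ℤ) × Fin d) :=
      (mhBox d n ∪ Finset.univ.biUnion fun i => (mhBox d n).image (fun g => g - mhE i)) ×ˢ Finset.univ
    let m : ((Fin d → ℤ) × Fin d) →₀ ℤ := Finsupp.indicator S (fun p _ => ψ p.2 (p.1 +ᵥ z))
    refine ⟨m, fun p => ?_, fun g hg => ?_⟩
    · by_cases hp : p ∈ S
      · rw [Finsupp.indicator_of_mem hp]; exact hK _ _
      · rw [Finsupp.indicator_of_notMem hp]; simp
    · rw [← hdiv, mhDiv]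
      apply Finset.sum_congr rfl
      intro i _
      have h1 : (g, i) ∈ S := by simp [S, hg]
      have h2 : (g - mhE i, i) ∈ S := by
        simp only [S, Finset.mem_product, Finset.mem_union, Finset.mem_biUnion, Finset.mem_univ,
          true_and, and_true, Finset.mem_image]
        exact Or.inr ⟨i, g, hg, rfl⟩
      rw [Finsupp.indicator_of_mem h1, Finsupp.indicator_of_mem h2]
      simp only [vadd_vadd]
      rw [neg_add_eq_sub]
  obtain ⟨c, hc, hcP⟩ := mh_exists_choice P hPm hPe
  have hnd : (0 : ℝ) < (n : ℝ) ^ d := by positivity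
  refine ⟨fun i y => (∑ g ∈ mhBox d n, ((c (-g +ᵥ y) (g, i) : ℤ) : ℝ)) / (n : ℝ) ^ d, ?_, ?_, ?_⟩
  · intro i
    refine Measurable.div_const (Finset.measurable_sum _ fun g _ => ?_) _
    have h1 : Measurable (fun y => ((c y (g, i) : ℤ) : ℝ)) :=
      mh_measurable_glue c hc (fun m _ => ((m (g, i) : ℤ) : ℝ)) fun _ => measurable_const
    exact h1.comp (hm (-g))
  · intro i y
    rw [abs_div, abs_of_pos hnd, div_le_iff₀ hnd]
    calc _ ≤ ∑ g ∈ mhBox d n, |((c (-g +ᵥ y) (g, i) : ℤ) : ℝ)| := Finset.abs_sum_le_sum_abs _ _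
      _ ≤ ∑ g ∈ mhBox d n, (K : ℝ) := Finset.sum_le_sum fun g _ => by
          exact_mod_cast (hcP (-g +ᵥ y)).1 (g, i)
      _ = K * (n : ℝ) ^ d := by
          rw [Finset.sum_const, card_mhBox, nsmul_eq_mul]; push_cast; ring
  · intro y
    let h : Fin d → (Fin d → ℤ) → ℝ := fun i g => ((c (-g +ᵥ y) (g - mhE i, i) : ℤ) : ℝ)
    have hh : ∀ i g, |h i g| ≤ K := fun i g => by
      simp only [h]; exact_mod_cast (hcP (-g +ᵥ y)).1 (g - mhE i, i)
    have hshift : ∀ i, ∑ g ∈ mhBox d n, ((c (-g +ᵥ (-mhE i +ᵥ y)) (g, i) : ℤ) : ℝ) =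
        ∑ g ∈ (mhBox d n).image (fun g => g + mhE i), h i g := by
      intro i
      rw [Finset.sum_image (fun a _ b _ hab => by simpa using hab)]
      apply Finset.sum_congr rfl
      intro g _
      simp only [h, vadd_vadd, add_sub_cancel_right]
      rw [neg_add, add_comm (-g)]
    have herr : ∀ i, |(∑ g ∈ mhBox d n, h i g) -
        ∑ g ∈ (mhBox d n).image (fun g => g + mhE i), h i g| * n ≤ 2 * K * (n : ℝ) ^ d := by
      intro i
      set B := mhBox d n
      set Bsh := (mhBox d n).image (fun g => g + mhE i) with hB'
      have hcard : Bsh.card = B.card := Finset.card_image_of_injective _ (add_left_injective _)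
      have h1 : (B \ Bsh).card * n ≤ n ^ d := by
        refine le_trans (Nat.mul_le_mul_right _ (Finset.card_le_card ?_)) (mh_slab i)
        intro g hg
        rw [Finset.mem_sdiff] at hg
        rw [Finset.mem_filter]
        refine ⟨hg.1, fun hg' => hg.2 ?_⟩
        rw [hB', Finset.mem_image]
        exact ⟨_, hg', by simp⟩
      have h2 : (Bsh \ B).card = (B \ Bsh).card := Finset.card_sdiff_comm hcard
      have h3 : (∑ g ∈ B, h i g) - ∑ g ∈ Bsh, h i g = ∑ g ∈ B \ Bsh, h i g - ∑ g ∈ Bsh \ B, h i g := by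
        rw [← Finset.sum_sdiff_sub_sum_sdiff]
      rw [h3]
      have hb : ∀ S : Finset (Fin d → ℤ), |∑ g ∈ S, h i g| ≤ S.card * K := by
        intro S
        calc _ ≤ ∑ g ∈ S, |h i g| := Finset.abs_sum_le_sum_abs _ _
          _ ≤ ∑ g ∈ S, (K : ℝ) := Finset.sum_le_sum fun g _ => hh i g
          _ = _ := by rw [Finset.sum_const, nsmul_eq_mul]
      have h4 := hb (B \ Bsh)
      have h5 := hb (Bsh \ B)
      rw [h2] at h5
      have h1' : ((B \ Bsh).card : ℝ) * n ≤ (n : ℝ) ^ d := by exact_mod_cast h1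
      have h6 := abs_sub (∑ g ∈ B \ Bsh, h i g) (∑ g ∈ Bsh \ B, h i g)
      calc _ ≤ (2 * (((B \ Bsh).card : ℝ) * K)) * n := by gcongr; linarith
        _ = 2 * K * (((B \ Bsh).card : ℝ) * n) := by ring
        _ ≤ _ := by gcongr
    have hmain : mhDiv (fun i y => (∑ g ∈ mhBox d n, ((c (-g +ᵥ y) (g, i) : ℤ) : ℝ)) / (n : ℝ) ^ d) y
        - f y = (∑ i, ((∑ g ∈ mhBox d n, h i g) -
        ∑ g ∈ (mhBox d n).image (fun g => g + mhE i), h i g)) / (n : ℝ) ^ d := by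
      have hfy : (f y : ℝ) * (n : ℝ) ^ d = ∑ g ∈ mhBox d n, ∑ i,
          (((c (-g +ᵥ y) (g, i) : ℤ) : ℝ) - h i g) := by
        have : ∀ g ∈ mhBox d n, ∑ i, (((c (-g +ᵥ y) (g, i) : ℤ) : ℝ) - h i g) = f y := by
          intro g hg
          have := (hcP (-g +ᵥ y)).2 g hg
          rw [vadd_vadd, add_neg_cancel, zero_vadd] at this
          rw [← this]
          push_cast
          rfl
        rw [Finset.sum_congr rfl this, Finset.sum_const, card_mhBox, nsmul_eq_mul]
        push_cast; ring
      rw [Finset.sum_comm] at hfy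
      rw [eq_div_iff hnd.ne', sub_mul, hfy, mhDiv, Finset.sum_mul, ← Finset.sum_sub_distrib]
      apply Finset.sum_congr rfl
      intro i _
      rw [hshift, Finset.sum_sub_distrib, sub_mul, div_mul_cancel₀ _ hnd.ne', div_mul_cancel₀ _ hnd.ne']
      ring
    rw [hmain, abs_div, abs_of_pos hnd, div_le_div_iff₀ hnd (by exact_mod_cast hn)]
    calc _ ≤ (∑ i, |(∑ g ∈ mhBox d n, h i g) -
        ∑ g ∈ (mhBox d n).image (fun g => g + mhE i), h i g|) * n := by
          gcongr; exact Finset.abs_sum_le_sum_abs _ _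
      _ = ∑ i, |(∑ g ∈ mhBox d n, h i g) -
        ∑ g ∈ (mhBox d n).image (fun g => g + mhE i), h i g| * n := Finset.sum_mul _ _ _
      _ ≤ ∑ _i : Fin d, 2 * K * (n : ℝ) ^ d := Finset.sum_le_sum fun i _ => herr i
      _ = _ := by rw [Finset.sum_const, Finset.card_univ, Fintype.card_fin, nsmul_eq_mul]; ring

theorem mh_l1_of_l2 {Y : Type*} [MeasurableSpace Y] (ν : Measure Y) [IsProbabilityMeasure ν]
    (g : Y → ℝ) (hg : Measurable g) (C : ℝ) (hC : ∀ y, |g y| ≤ C) (t : ℝ) (ht : 0 < t)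
    (h : ∫ y, g y ^ 2 ∂ν ≤ t ^ 2) : eLpNorm g 1 ν ≤ ENNReal.ofReal t := by
  have hgi : Integrable g ν := Integrable.of_bound hg.aestronglyMeasurable C
    (Filter.Eventually.of_forall fun y => by rw [Real.norm_eq_abs]; exact hC y)
  have hg2 : Integrable (fun y => g y ^ 2) ν :=
    Integrable.of_bound (hg.pow_const 2).aestronglyMeasurable (C ^ 2)
    (Filter.Eventually.of_forall fun y => by
      rw [norm_pow, Real.norm_eq_abs]; exact pow_le_pow_left₀ (abs_nonneg _) (hC y) 2)
  rw [eLpNorm_one_eq_lintegral_enorm, ← ofReal_integral_norm_eq_lintegral_enorm hgi]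
  apply ENNReal.ofReal_le_ofReal
  calc ∫ y, ‖g y‖ ∂ν ≤ ∫ y, (g y ^ 2 / (2 * t) + t / 2) ∂ν := by
        apply integral_mono hgi.norm ((hg2.div_const _).add (integrable_const _))
        intro y
        simp only [Real.norm_eq_abs, Pi.add_apply]
        have : |g y| - t / 2 ≤ g y ^ 2 / (2 * t) := by
          rw [le_div_iff₀ (by positivity), ← sq_abs (g y)]
          nlinarith [sq_nonneg (|g y| - t)]
        linarith
    _ = (∫ y, g y ^ 2 ∂ν) / (2 * t) + t / 2 := by
        rw [integral_add (hg2.div_const _) (integrable_const _), integral_div]; simp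
    _ ≤ t ^ 2 / (2 * t) + t / 2 := by gcongr
    _ = t := by field_simp; ring

theorem mh_real_flow {d : ℕ} {Y : Type*} [MeasurableSpace Y] [AddAction (Fin d → ℤ) Y]
    (ν : Measure Y) [IsProbabilityMeasure ν]
    (hmp : ∀ v : Fin d → ℤ, MeasurePreserving (fun y : Y => v +ᵥ y) ν ν)
    (f : Y → ℝ) (K : ℝ) 
    (h : ∀ ε > 0, ∃ φ : Fin d → Y → ℝ, (∀ i, Measurable (φ i)) ∧ (∀ i y, |φ i y| ≤ K) ∧
      ∀ y, |mhDiv φ y - f y| ≤ ε) :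
    ∃ φ : Fin d → Y → ℝ, (∀ i, Measurable (φ i)) ∧ (∀ i y, |φ i y| ≤ K) ∧
      ∀ᵐ y ∂ν, mhDiv φ y = f y := by
  classical
  let C : ℕ → Set (Fin d → Y → ℝ) := fun n => {φ | (∀ i, Measurable (φ i)) ∧
    (∀ i y, |φ i y| ≤ K) ∧ ∀ y, |mhDiv φ y - f y| ≤ 1 / ((n : ℝ) + 1)}
  have hCne : ∀ n, (C n).Nonempty := fun n => h _ (by positivity)
  have hCanti : ∀ n m, n ≤ m → C m ⊆ C n := by
    intro n m hnm φ hφ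
    refine ⟨hφ.1, hφ.2.1, fun y => (hφ.2.2 y).trans ?_⟩
    gcongr
  have hCmid : ∀ n, ∀ φ ∈ C n, ∀ φ' ∈ C n, (fun i y => (φ i y + φ' i y) / 2) ∈ C n := by
    rintro n φ ⟨h1, h2, h3⟩ φ' ⟨h1', h2', h3'⟩
    refine ⟨fun i => ((h1 i).add (h1' i)).div_const 2, fun i y => ?_, fun y => ?_⟩
    · have a1 := abs_le.1 (h2 i y)
      have a2 := abs_le.1 (h2' i y)
      rw [abs_le]; constructor <;> linarith
    · have a1 := abs_le.1 (h3 y)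
      have a2 := abs_le.1 (h3' y)
      have : mhDiv (fun i y => (φ i y + φ' i y) / 2) y = (mhDiv φ y + mhDiv φ' y) / 2 := by
        simp only [mhDiv]
        rw [← Finset.sum_add_distrib, Finset.sum_div]
        apply Finset.sum_congr rfl; intro i _; ring
      rw [this, abs_le]; constructor <;> linarith
  let J : (Fin d → Y → ℝ) → ℝ := fun φ => ∫ y, ∑ i, φ i y ^ 2 ∂ν
  have hJnn : ∀ φ, 0 ≤ J φ := fun φ => integral_nonneg fun y => Finset.sum_nonneg fun i _ => sq_nonneg _
  have hK2 : ∀ n, ∀ φ ∈ C n, ∀ i y, φ i y ^ 2 ≤ K ^ 2 := fun n φ hφ i y => by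
    rw [← sq_abs]; exact pow_le_pow_left₀ (abs_nonneg _) (hφ.2.1 i y) 2
  have hint1 : ∀ n, ∀ φ ∈ C n, ∀ i, Integrable (fun y => φ i y ^ 2) ν := by
    intro n φ hφ i
    refine Integrable.of_bound ((hφ.1 i).pow_const 2).aestronglyMeasurable (K ^ 2)
      (Filter.Eventually.of_forall fun y => ?_)
    rw [Real.norm_of_nonneg (sq_nonneg _)]; exact hK2 n φ hφ i y
  have hintg : ∀ n, ∀ φ ∈ C n, Integrable (fun y => ∑ i, φ i y ^ 2) ν :=
    fun n φ hφ => integrable_finsetSum _ fun i _ => hint1 n φ hφ i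
  have hJb : ∀ n, ∀ φ ∈ C n, J φ ≤ d * K ^ 2 := by
    intro n φ hφ
    calc J φ ≤ ∫ y, (d * K ^ 2 : ℝ) ∂ν := by
          apply integral_mono (hintg n φ hφ) (integrable_const _)
          intro y
          calc ∑ i, φ i y ^ 2 ≤ ∑ _i : Fin d, K ^ 2 := Finset.sum_le_sum fun i _ => hK2 n φ hφ i y
            _ = _ := by simp
      _ = _ := by simp
  let m : ℕ → ℝ := fun n => sInf (J '' C n)
  have hbdd : ∀ n, BddBelow (J '' C n) := fun n => ⟨0, by rintro _ ⟨φ, _, rfl⟩; exact hJnn φ⟩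
  have hmle : ∀ n, ∀ φ ∈ C n, m n ≤ J φ := fun n φ hφ => csInf_le (hbdd n) ⟨φ, hφ, rfl⟩
  have hmmono : Monotone m := fun a b hab =>
    csInf_le_csInf (hbdd a) ((hCne b).image _) (Set.image_mono (hCanti a b hab))
  have hmb : BddAbove (Set.range m) := by
    refine ⟨d * K ^ 2, ?_⟩
    rintro _ ⟨n, rfl⟩
    obtain ⟨φ, hφ⟩ := hCne n
    exact (hmle n φ hφ).trans (hJb n φ hφ)
  have hmt := tendsto_atTop_ciSup hmmono hmb
  have hmin : ∀ n : ℕ, ∃ φ ∈ C n, J φ ≤ m n + 1 / ((n : ℝ) + 1) := by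
    intro n
    obtain ⟨_, ⟨φ, hφ, rfl⟩, hlt⟩ := exists_lt_of_csInf_lt ((hCne n).image J)
      (show sInf (J '' C n) < m n + 1 / ((n : ℝ) + 1) by
        have : (0 : ℝ) < 1 / ((n : ℝ) + 1) := by positivity
        simp only [m]; linarith)
    exact ⟨φ, hφ, hlt.le⟩
  choose Φ hΦ hΦJ using hmin
  have hpar : ∀ n k, n ≤ k → ∫ y, ∑ i, (Φ n i y - Φ k i y) ^ 2 ∂ν ≤
      2 * (m k - m n) + 4 / ((n : ℝ) + 1) := by
    intro n k hnk
    have hk := hCanti n k hnk (hΦ k)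
    have hmid := hCmid n _ (hΦ n) _ hk
    have h1 := hmle n _ hmid
    have h2 : ∫ y, ∑ i, (Φ n i y - Φ k i y) ^ 2 ∂ν = 2 * J (Φ n) + 2 * J (Φ k) -
        4 * J (fun i y => (Φ n i y + Φ k i y) / 2) := by
      simp only [J]
      rw [← integral_const_mul, ← integral_const_mul, ← integral_const_mul, ← integral_add,
        ← integral_sub]
      · congr 1; ext y
        rw [Finset.mul_sum, Finset.mul_sum, Finset.mul_sum, ← Finset.sum_add_distrib,
          ← Finset.sum_sub_distrib]
        apply Finset.sum_congr rfl; intro i _; ring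
      · exact ((hintg _ _ (hΦ n)).const_mul 2).add ((hintg _ _ (hΦ k)).const_mul 2)
      · exact (hintg _ _ hmid).const_mul 4
      · exact (hintg _ _ (hΦ n)).const_mul 2
      · exact (hintg _ _ (hΦ k)).const_mul 2
    rw [h2]
    have h3 := hΦJ n
    have h4 := hΦJ k
    have h5 : 1 / ((k : ℝ) + 1) ≤ 1 / ((n : ℝ) + 1) := by gcongr
    have h6 : 4 / ((n : ℝ) + 1) = 4 * (1 / ((n : ℝ) + 1)) := by ring
    linarith
  have hsub : ∀ j : ℕ, ∃ N : ℕ, j ≤ N ∧ ∀ n k, N ≤ n → n ≤ k →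
      ∫ y, ∑ i, (Φ n i y - Φ k i y) ^ 2 ∂ν ≤ ((1 / 2 : ℝ) ^ j) ^ 2 := by
    intro j
    set ε := ((1 / 2 : ℝ) ^ j) ^ 2 with hε
    have hεp : 0 < ε := by positivity
    have e1 := hmt.eventually (lt_mem_nhds (show (⨆ n, m n) - ε / 4 < ⨆ n, m n by linarith))
    have e2 := tendsto_one_div_add_atTop_nhds_zero_nat (𝕜 := ℝ) |>.eventually
      (gt_mem_nhds (show 0 < ε / 8 by linarith))
    obtain ⟨N, hN⟩ := (e1.and e2).exists_forall_of_atTop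
    refine ⟨max j N, le_max_left _ _, fun n k hn hk => (hpar n k hk).trans ?_⟩
    have h1 := hN n ((le_max_right _ _).trans hn)
    have h2 := le_ciSup hmb k
    have h6 : 4 / ((n : ℝ) + 1) = 4 * (1 / ((n : ℝ) + 1)) := by ring
    linarith [h1.1, h1.2]
  choose N hNj hN using hsub
  let q : ℕ → ℕ := fun j => Nat.rec (N 0) (fun j p => max p (N (j + 1))) j
  have hqs : ∀ j, q (j + 1) = max (q j) (N (j + 1)) := fun j => rfl
  have hqm : Monotone q := monotone_nat_of_le_succ fun j => by rw [hqs]; exact le_max_left _ _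
  have hqN : ∀ j, N j ≤ q j := by
    intro j
    cases j with
    | zero => exact le_rfl
    | succ j => rw [hqs]; exact le_max_right _ _
  have hL1' : ∀ i j k, j ≤ k → eLpNorm (Φ (q j) i - Φ (q k) i) 1 ν ≤ ENNReal.ofReal ((1 / 2 : ℝ) ^ j) := by
    intro i j k hjk
    apply mh_l1_of_l2 ν _ ((((hΦ _).1 i).sub ((hΦ _).1 i))) (2 * K) _ _ (by positivity)
    · refine le_trans ?_ (hN j (q j) (q k) (hqN j) (hqm hjk))
      apply integral_mono_of_nonneg (Filter.Eventually.of_forall fun y => sq_nonneg _)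
      · refine integrable_finsetSum _ fun i _ => ?_
        refine Integrable.of_bound ((((hΦ _).1 i).sub ((hΦ _).1 i)).pow_const 2).aestronglyMeasurable
          ((2 * K) ^ 2) (Filter.Eventually.of_forall fun y => ?_)
        rw [norm_pow, Real.norm_eq_abs]
        refine pow_le_pow_left₀ (abs_nonneg _) ?_ 2
        have a1 := abs_le.1 ((hΦ (q j)).2.1 i y)
        have a2 := abs_le.1 ((hΦ (q k)).2.1 i y)
        rw [abs_le]; constructor <;> linarith
      · exact Filter.Eventually.of_forall fun y =>
          Finset.single_le_sum (f := fun i => (Φ (q j) i y - Φ (q k) i y) ^ 2)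
            (fun i _ => sq_nonneg _) (Finset.mem_univ i)
    · intro y
      have a1 := abs_le.1 ((hΦ (q j)).2.1 i y)
      have a2 := abs_le.1 ((hΦ (q k)).2.1 i y)
      rw [Pi.sub_apply, abs_le]; constructor <;> linarith
  have hae : ∀ i, ∀ᵐ y ∂ν, ∃ l : ℝ, Filter.Tendsto (fun j => Φ (q j) i y) Filter.atTop (nhds l) := by
    intro i
    refine Lp.ae_tendsto_of_cauchy_eLpNorm (p := 1) (B := fun j => ENNReal.ofReal (2 * (1 / 2 : ℝ) ^ j))
      (fun j => ((hΦ _).1 i).aestronglyMeasurable) le_rfl ?_ ?_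
    · rw [← ENNReal.ofReal_tsum_of_nonneg (fun j => by positivity)
        ((summable_geometric_of_lt_one (by norm_num) (by norm_num)).mul_left 2)]
      exact ENNReal.ofReal_ne_top
    · intro M j k hj hk
      have hlt : ENNReal.ofReal ((1 / 2 : ℝ) ^ M) < ENNReal.ofReal (2 * (1 / 2 : ℝ) ^ M) := by
        rw [ENNReal.ofReal_lt_ofReal_iff (by positivity)]
        have : (0 : ℝ) < (1 / 2 : ℝ) ^ M := by positivity
        linarith
      have hpow : ∀ j, M ≤ j → ENNReal.ofReal ((1 / 2 : ℝ) ^ j) ≤ ENNReal.ofReal ((1 / 2 : ℝ) ^ M) :=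
        fun j hj => ENNReal.ofReal_le_ofReal (pow_le_pow_of_le_one (by norm_num) (by norm_num) hj)
      refine lt_of_le_of_lt ?_ hlt
      rcases le_total j k with hjk | hjk
      · exact (hL1' i j k hjk).trans (hpow j hj)
      · rw [eLpNorm_sub_comm]
        exact (hL1' i k j hjk).trans (hpow k hk)
  choose L hLm hLt using fun i => measurable_limit_of_tendsto_metrizable_ae
    (fun j => ((hΦ (q j)).1 i).aemeasurable) (hae i)
  have hK0 : ∀ i : Fin d, ∀ y : Y, 0 ≤ K := fun i y => (abs_nonneg _).trans ((hΦ 0).2.1 i y)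
  refine ⟨fun i y => max (-K) (min K (L i y)), fun i => measurable_const.max
    (measurable_const.min (hLm i)), fun i y => ?_, ?_⟩
  · have := hK0 i y
    rw [abs_le]
    exact ⟨le_max_left _ _, max_le (by linarith) (min_le_left _ _)⟩
  · have h1 : ∀ᵐ y ∂ν, ∀ i, Filter.Tendsto (fun j => Φ (q j) i y) Filter.atTop (nhds (L i y)) :=
      ae_all_iff.2 hLt
    have h2 : ∀ᵐ y ∂ν, ∀ k, ∀ i, Filter.Tendsto (fun j => Φ (q j) i (-mhE k +ᵥ y)) Filter.atTop
        (nhds (L i (-mhE k +ᵥ y))) :=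
      ae_all_iff.2 fun k => (hmp (-mhE k)).quasiMeasurePreserving.ae h1
    have hclamp : ∀ y i, Filter.Tendsto (fun j => Φ (q j) i y) Filter.atTop (nhds (L i y)) →
        max (-K) (min K (L i y)) = L i y := by
      intro y i ht
      have a1 : L i y ≤ K := le_of_tendsto' ht fun j => (abs_le.1 ((hΦ (q j)).2.1 i y)).2
      have a2 : -K ≤ L i y := ge_of_tendsto' ht fun j => (abs_le.1 ((hΦ (q j)).2.1 i y)).1
      rw [min_eq_right a1, max_eq_right a2]
    filter_upwards [h1, h2] with y hy1 hy2
    have h3 : mhDiv (fun i y => max (-K) (min K (L i y))) y = mhDiv L y := by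
      simp only [mhDiv]
      apply Finset.sum_congr rfl; intro i _
      rw [hclamp y i (hy1 i), hclamp _ i (hy2 i i)]
    rw [h3]
    have h4 : Filter.Tendsto (fun j => mhDiv (Φ (q j)) y) Filter.atTop (nhds (mhDiv L y)) :=
      tendsto_finsetSum _ fun i _ => (hy1 i).sub (hy2 i i)
    have hqj : ∀ j, j ≤ q j := fun j => (hNj j).trans (hqN j)
    have h5 : Filter.Tendsto (fun j => mhDiv (Φ (q j)) y) Filter.atTop (nhds (f y)) := by
      rw [tendsto_iff_dist_tendsto_zero]
      refine squeeze_zero (fun _ => dist_nonneg) (fun j => ?_)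
        (tendsto_one_div_add_atTop_nhds_zero_nat (𝕜 := ℝ))
      rw [Real.dist_eq]
      exact (hCanti j _ (hqj j) (hΦ (q j))).2.2 y
    exact tendsto_nhds_unique h4 h5

/-- Net outflow at a vertex. -/
def mhNet {V E : Type*} [Fintype E] [DecidableEq V] (src tgt : E → V) {R : Type*} [AddCommGroup R]
    (θ : E → R) (v : V) : R :=
  ∑ e, ((if src e = v then θ e else 0) - (if tgt e = v then θ e else 0))

theorem mhNet_sum {V E : Type*} [Fintype E] [Fintype V] [DecidableEq V] (src tgt : E → V)
    {R : Type*} [AddCommGroup R] (θ : E → R) : ∑ v, mhNet src tgt θ v = 0 := by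
  simp only [mhNet]
  rw [Finset.sum_comm]
  simp

theorem mh_kernel {V E : Type*} [Fintype E] [Fintype V] [DecidableEq V] [DecidableEq E]
    (src tgt : E → V)
    (θ : E → ℝ) (hintg : ∀ v, mhNet src tgt θ v ∈ (Int.castAddHom ℝ).range)
    (E' : Finset E) (hE' : ∀ e, e ∈ E' ↔ θ e ∉ (Int.castAddHom ℝ).range) (hne : E'.Nonempty) :
    ∃ u : E → ℝ, u ≠ 0 ∧ (∀ e, e ∉ E' → u e = 0) ∧ ∀ v, mhNet src tgt u v = 0 := by
  set H := (Int.castAddHom ℝ).range with hH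
  set V' := E'.image src ∪ E'.image tgt with hV'
  have hdeg : ∀ v ∈ V', 2 ≤ (E'.filter (fun e => src e = v)).card +
      (E'.filter (fun e => tgt e = v)).card := by
    intro v hv
    by_contra hlt
    have key : ∀ e0 ∈ E', (∀ e ∈ E', e ≠ e0 → src e ≠ v ∧ tgt e ≠ v) →
        ((src e0 = v ∧ tgt e0 ≠ v) ∨ (src e0 ≠ v ∧ tgt e0 = v)) → False := by
      intro e0 he0 hoth hor
      have h1 := hintg v
      rw [mhNet, ← Finset.add_sum_erase _ _ (Finset.mem_univ e0)] at h1
      have h2 : ∑ e ∈ Finset.univ.erase e0,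
          ((if src e = v then θ e else 0) - (if tgt e = v then θ e else 0)) ∈ H := by
        apply sum_mem
        intro e he
        by_cases heE : e ∈ E'
        · have := hoth e heE (Finset.ne_of_mem_erase he)
          rw [if_neg this.1, if_neg this.2]; simp [H.zero_mem]
        · have heH : θ e ∈ H := by
            by_contra hc; exact heE ((hE' e).2 hc)
          apply H.sub_mem <;> split_ifs <;> first | exact heH | exact H.zero_mem
      have h3 := (H.add_mem_cancel_right h2).1 h1
      apply (hE' e0).1 he0
      rcases hor with ⟨ha, hb⟩ | ⟨ha, hb⟩
      · rw [if_pos ha, if_neg hb, sub_zero] at h3; exact h3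
      · rw [if_neg ha, if_pos hb, zero_sub] at h3; exact H.neg_mem_iff.1 h3
    rw [hV', Finset.mem_union, Finset.mem_image, Finset.mem_image] at hv
    rcases hv with ⟨e0, he0, hs⟩ | ⟨e0, he0, hs⟩
    · have hp : 0 < (E'.filter (fun e => src e = v)).card :=
        Finset.card_pos.2 ⟨e0, Finset.mem_filter.2 ⟨he0, hs⟩⟩
      have h1 : (E'.filter (fun e => src e = v)).card ≤ 1 := by omega
      have h2 : (E'.filter (fun e => tgt e = v)).card = 0 := by omega
      rw [Finset.card_eq_zero, Finset.filter_eq_empty_iff] at h2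
      refine key e0 he0 (fun e he hne => ⟨fun h => hne ?_, h2 he⟩) (Or.inl ⟨hs, h2 he0⟩)
      exact Finset.card_le_one.1 h1 e (Finset.mem_filter.2 ⟨he, h⟩) e0 (Finset.mem_filter.2 ⟨he0, hs⟩)
    · have hp : 0 < (E'.filter (fun e => tgt e = v)).card :=
        Finset.card_pos.2 ⟨e0, Finset.mem_filter.2 ⟨he0, hs⟩⟩
      have h1 : (E'.filter (fun e => tgt e = v)).card ≤ 1 := by omega
      have h2 : (E'.filter (fun e => src e = v)).card = 0 := by omega
      rw [Finset.card_eq_zero, Finset.filter_eq_empty_iff] at h2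
      refine key e0 he0 (fun e he hne => ⟨h2 he, fun h => hne ?_⟩) (Or.inr ⟨h2 he0, hs⟩)
      exact Finset.card_le_one.1 h1 e (Finset.mem_filter.2 ⟨he, h⟩) e0 (Finset.mem_filter.2 ⟨he0, hs⟩)
  have hcard : V'.card ≤ E'.card := by
    have h1 : E'.card = ∑ v ∈ V', (E'.filter (fun e => src e = v)).card :=
      Finset.card_eq_sum_card_fiberwise fun e he => Finset.mem_coe.2
        (Finset.mem_union_left _ (Finset.mem_image_of_mem _ he))
    have h2 : E'.card = ∑ v ∈ V', (E'.filter (fun e => tgt e = v)).card :=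
      Finset.card_eq_sum_card_fiberwise fun e he => Finset.mem_coe.2
        (Finset.mem_union_right _ (Finset.mem_image_of_mem _ he))
    have h3 : ∑ v ∈ V', 2 ≤ _ := Finset.sum_le_sum hdeg
    rw [Finset.sum_add_distrib, ← h1, ← h2, Finset.sum_const, smul_eq_mul] at h3
    omega
  obtain ⟨e0, he0⟩ := hne
  have hv0 : src e0 ∈ V' := Finset.mem_union_left _ (Finset.mem_image_of_mem _ he0)
  let ext : (E' → ℝ) → E → ℝ := fun u e => if h : e ∈ E' then u ⟨e, h⟩ else 0
  let L : (E' → ℝ) →ₗ[ℝ] ((V'.erase (src e0) : Finset V) → ℝ) :=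
    { toFun := fun u v => mhNet src tgt (ext u) v
      map_add' := by
        intro u w; ext v
        simp only [mhNet, Pi.add_apply, ← Finset.sum_add_distrib]
        apply Finset.sum_congr rfl; intro e _
        by_cases h : e ∈ E'
        · simp only [ext, dif_pos h, Pi.add_apply]; split_ifs <;> ring
        · simp only [ext, dif_neg h]; simp
      map_smul' := by
        intro c u; ext v
        simp only [mhNet, Pi.smul_apply, Finset.smul_sum, RingHom.id_apply]
        apply Finset.sum_congr rfl; intro e _
        by_cases h : e ∈ E'
        · simp only [ext, dif_pos h, Pi.smul_apply, smul_eq_mul]; split_ifs <;> ring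
        · simp only [ext, dif_neg h]; simp }
  have hker : LinearMap.ker L ≠ ⊥ := by
    apply LinearMap.ker_ne_bot_of_finrank_lt
    simp only [Module.finrank_fintype_fun_eq_card, Fintype.card_coe]
    rw [Finset.card_erase_of_mem hv0]
    have := Finset.card_pos.2 ⟨_, hv0⟩
    omega
  obtain ⟨u, hu, hu0⟩ := Submodule.exists_mem_ne_zero_of_ne_bot hker
  have hnet : ∀ v, v ≠ src e0 → mhNet src tgt (ext u) v = 0 := by
    intro v hv
    by_cases hvV : v ∈ V'
    · exact congrFun (LinearMap.mem_ker.1 hu) ⟨v, Finset.mem_erase.2 ⟨hv, hvV⟩⟩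
    · apply Finset.sum_eq_zero
      intro e _
      by_cases h : e ∈ E'
      · have h1 : src e ≠ v := fun h' => hvV (h' ▸ Finset.mem_union_left _ (Finset.mem_image_of_mem _ h))
        have h2 : tgt e ≠ v := fun h' => hvV (h' ▸ Finset.mem_union_right _ (Finset.mem_image_of_mem _ h))
        rw [if_neg h1, if_neg h2, sub_zero]
      · simp only [ext, dif_neg h]; simp
  refine ⟨ext u, ?_, fun e he => dif_neg he, fun v => ?_⟩
  · intro h
    apply hu0
    ext ⟨e, he⟩
    have := congrFun h e
    simpa [ext, he] using this
  · by_cases hv : v = src e0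
    · have := mhNet_sum src tgt (ext u)
      rw [← Finset.add_sum_erase _ _ (Finset.mem_univ v), Finset.sum_eq_zero, add_zero] at this
      · exact this
      · intro w hw
        exact hnet w (hv ▸ Finset.ne_of_mem_erase hw)
    · exact hnet v hv

theorem mh_round_graph {V E : Type*} [Fintype E] [Fintype V] [DecidableEq V]
    (src tgt : E → V) (θ : E → ℝ) (hintg : ∀ v, mhNet src tgt θ v ∈ (Int.castAddHom ℝ).range) :
    ∃ m : E → ℤ, (∀ e, ⌊θ e⌋ ≤ m e ∧ m e ≤ ⌈θ e⌉) ∧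
      ∀ v, ((mhNet src tgt m v : ℤ) : ℝ) = mhNet src tgt θ v := by
  classical
  obtain ⟨n, hn⟩ : ∃ n, (Finset.univ.filter (fun e => θ e ∉ (Int.castAddHom ℝ).range)).card = n :=
    ⟨_, rfl⟩
  induction n using Nat.strong_induction_on generalizing θ with
  | _ n ih =>
    set E' := Finset.univ.filter (fun e => θ e ∉ (Int.castAddHom ℝ).range) with hE'
    have hmem : ∀ e, e ∈ E' ↔ θ e ∉ (Int.castAddHom ℝ).range := fun e => by simp [hE']
    rcases E'.eq_empty_or_nonempty with h0 | hne
    · have hall : ∀ e, ((⌊θ e⌋ : ℤ) : ℝ) = θ e := by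
        intro e
        have : θ e ∈ (Int.castAddHom ℝ).range := by
          by_contra hc
          have := (hmem e).2 hc
          rw [h0] at this; simp at this
        obtain ⟨k, hk⟩ := this
        rw [← hk]; simp
      refine ⟨fun e => ⌊θ e⌋, fun e => ⟨le_rfl, Int.floor_le_ceil _⟩, fun v => ?_⟩
      simp only [mhNet]
      push_cast
      simp only [hall]
    · obtain ⟨u, hu0, husupp, hunet⟩ := mh_kernel src tgt θ hintg E' hmem hne
      set S := E'.filter (fun e => u e ≠ 0) with hS
      have hSne : S.Nonempty := by
        obtain ⟨e, he⟩ := Function.ne_iff.1 hu0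
        refine ⟨e, Finset.mem_filter.2 ⟨?_, he⟩⟩
        by_contra hc; exact he (husupp e hc)
      let t : E → ℝ := fun e => if 0 < u e then (⌈θ e⌉ - θ e) / u e else (θ e - ⌊θ e⌋) / (-u e)
      obtain ⟨e1, he1, hmin⟩ := S.exists_min_image t hSne
      have htpos : 0 ≤ t e1 := by
        simp only [t]
        split_ifs with h
        · exact div_nonneg (by linarith [Int.le_ceil (θ e1)]) h.le
        · exact div_nonneg (by linarith [Int.floor_le (θ e1)]) (by linarith [not_lt.1 h])
      set θ' : E → ℝ := fun e => θ e + t e1 * u e with hθ'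
      have hbd : ∀ e, (⌊θ e⌋ : ℝ) ≤ θ' e ∧ θ' e ≤ ⌈θ e⌉ := by
        intro e
        have hf := Int.floor_le (θ e)
        have hc := Int.le_ceil (θ e)
        by_cases heS : e ∈ S
        · have hme := hmin e heS
          rcases lt_trichotomy (u e) 0 with hneg | hz | hpos
          · have : t e = (θ e - ⌊θ e⌋) / (-u e) := by simp only [t]; rw [if_neg (by linarith)]
            rw [this, le_div_iff₀ (by linarith)] at hme
            simp only [hθ']
            constructor
            · linarith
            · nlinarith
          · exact absurd hz (Finset.mem_filter.1 heS).2
          · have : t e = (⌈θ e⌉ - θ e) / (u e) := by simp only [t]; rw [if_pos hpos]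
            rw [this, le_div_iff₀ hpos] at hme
            simp only [hθ']
            constructor
            · nlinarith
            · linarith
        · have : u e = 0 := by
            by_contra hc
            apply heS
            refine Finset.mem_filter.2 ⟨?_, hc⟩
            by_contra hc'; exact hc (husupp e hc')
          simp only [hθ', this, mul_zero, add_zero]; exact ⟨hf, hc⟩
      have hnet' : ∀ v, mhNet src tgt θ' v = mhNet src tgt θ v := by
        intro v
        have : mhNet src tgt θ' v = mhNet src tgt θ v + t e1 * mhNet src tgt u v := by
          simp only [mhNet, hθ', Finset.mul_sum, ← Finset.sum_add_distrib]
          apply Finset.sum_congr rfl; intro e _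
          split_ifs <;> ring
        rw [this, hunet, mul_zero, add_zero]
      have hlt : (Finset.univ.filter (fun e => θ' e ∉ (Int.castAddHom ℝ).range)).card < n := by
        rw [← hn]
        apply Finset.card_lt_card
        rw [Finset.ssubset_iff_of_subset]
        · refine ⟨e1, (Finset.mem_filter.1 he1).1, ?_⟩
          simp only [Finset.mem_filter, Finset.mem_univ, true_and, not_not]
          have hue := (Finset.mem_filter.1 he1).2
          simp only [hθ', t]
          split_ifs with h
          · exact ⟨⌈θ e1⌉, by simp only [Int.coe_castAddHom]; field_simp; ring⟩
          · exact ⟨⌊θ e1⌋, by simp only [Int.coe_castAddHom]; field_simp; ring⟩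
        · intro e he
          rw [hmem]
          intro hc
          have : u e = 0 := husupp e (fun h => (hmem e).1 h hc)
          simp only [Finset.mem_filter, Finset.mem_univ, true_and, hθ', this, mul_zero, add_zero] at he
          exact he hc
      obtain ⟨m, hm1, hm2⟩ := ih _ hlt θ' (fun v => by rw [hnet']; exact hintg v) rfl
      refine ⟨m, fun e => ⟨?_, ?_⟩, fun v => by rw [hm2, hnet']⟩
      · exact (Int.le_floor.2 (hbd e).1).trans (hm1 e).1
      · exact (hm1 e).2.trans (Int.ceil_le.2 (hbd e).2)

theorem mh_round_box {d : ℕ} (W : Finset (Fin d → ℤ)) (θ : Fin d → (Fin d → ℤ) → ℝ)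
    (hintg : ∀ x ∈ W, ∑ i, (θ i x - θ i (x - mhE i)) ∈ (Int.castAddHom ℝ).range) :
    ∃ m : ((Fin d → ℤ) × Fin d) →₀ ℤ,
      (∀ x i, (x ∈ W ∨ x + mhE i ∈ W) → ⌊θ i x⌋ ≤ m (x, i) ∧ m (x, i) ≤ ⌈θ i x⌉) ∧
      ∀ x ∈ W, ((∑ i, (m (x, i) - m (x - mhE i, i)) : ℤ) : ℝ) = ∑ i, (θ i x - θ i (x - mhE i)) := by
  classical
  let ES : Finset ((Fin d → ℤ) × Fin d) :=
    (W ∪ Finset.univ.biUnion fun i => W.image (fun g => g - mhE i)) ×ˢ Finset.univ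
  have hES1 : ∀ x i, x ∈ W → (x, i) ∈ ES := fun x i hx => by simp [ES, hx]
  have hES2 : ∀ x i, x ∈ W → (x - mhE i, i) ∈ ES := fun x i hx => by
    simp only [ES, Finset.mem_product, Finset.mem_union, Finset.mem_biUnion, Finset.mem_univ,
          true_and, and_true, Finset.mem_image]
    exact Or.inr ⟨i, x, hx, rfl⟩
  let pt : (Fin d → ℤ) → Option W := fun x => if h : x ∈ W then some ⟨x, h⟩ else none
  have hpt : ∀ x (z : W), pt x = some z ↔ x = z := by
    intro x z
    simp only [pt]
    split_ifs with h
    · rw [Option.some_inj, Subtype.ext_iff]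
    · simp only [false_iff]
      rintro rfl; exact h z.2
  let src : ES → Option W := fun e => pt e.1.1
  let tgt : ES → Option W := fun e => pt (e.1.1 + mhE e.1.2)
  have hnet : ∀ {R : Type} [AddCommGroup R] (η : (Fin d → ℤ) × Fin d → R) (z : W),
      mhNet src tgt (fun e => η e.1) (some z) = ∑ i, (η (z, i) - η (z - mhE i, i)) := by
    intro R _ η z
    simp only [mhNet, src, tgt, hpt]
    rw [Finset.sum_sub_distrib, Finset.sum_sub_distrib]
    congr 1
    · rw [Finset.sum_coe_sort ES (fun e => if e.1 = (z : Fin d → ℤ) then η e else 0),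
        ← Finset.sum_filter]
      symm
      apply Finset.sum_bij (fun i _ => ((z : Fin d → ℤ), i))
      · intro i _; exact Finset.mem_filter.2 ⟨hES1 _ _ z.2, rfl⟩
      · intro i _ j _ h; simpa using h
      · rintro ⟨x, i⟩ h
        obtain ⟨_, h2⟩ := Finset.mem_filter.1 h
        exact ⟨i, Finset.mem_univ _, by simp only at h2; rw [h2]⟩
      · intro i _; rfl
    · rw [Finset.sum_coe_sort ES (fun e => if e.1 + mhE e.2 = (z : Fin d → ℤ) then η e else 0),
        ← Finset.sum_filter]
      symm
      apply Finset.sum_bij (fun i _ => ((z : Fin d → ℤ) - mhE i, i))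
      · intro i _; exact Finset.mem_filter.2 ⟨hES2 _ _ z.2, by simp⟩
      · intro i _ j _ h; exact (Prod.ext_iff.1 h).2
      · rintro ⟨x, i⟩ h
        obtain ⟨_, h2⟩ := Finset.mem_filter.1 h
        exact ⟨i, Finset.mem_univ _, by simp only at h2; rw [← h2, add_sub_cancel_right]⟩
      · intro i _; rfl
  have hsome : ∀ z : W, mhNet src tgt (fun e : ES => θ e.1.2 e.1.1) (some z) ∈ (Int.castAddHom ℝ).range := by
    intro z
    rw [hnet (fun p => θ p.2 p.1) z]
    exact hintg z z.2
  have hall : ∀ v, mhNet src tgt (fun e : ES => θ e.1.2 e.1.1) v ∈ (Int.castAddHom ℝ).range := by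
    intro v
    cases v with
    | some z => exact hsome z
    | none =>
      have h1 := mhNet_sum src tgt (fun e : ES => θ e.1.2 e.1.1)
      rw [Fintype.sum_option] at h1
      rw [eq_neg_of_add_eq_zero_left h1]
      exact neg_mem (sum_mem fun z _ => hsome z)
  obtain ⟨m, hm1, hm2⟩ := mh_round_graph src tgt _ hall
  let M : ((Fin d → ℤ) × Fin d) →₀ ℤ := Finsupp.indicator ES (fun p hp => m ⟨p, hp⟩)
  have hM : (fun e : ES => M e.1) = m := by
    ext ⟨e, he⟩
    exact Finsupp.indicator_of_mem he _
  refine ⟨M, fun x i hx => ?_, fun x hx => ?_⟩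
  · have hmem : (x, i) ∈ ES := by
      rcases hx with hx | hx
      · exact hES1 x i hx
      · have := hES2 _ i hx
        rwa [add_sub_cancel_right] at this
    rw [show M (x, i) = m ⟨(x, i), hmem⟩ from congrFun hM ⟨(x, i), hmem⟩]
    exact hm1 ⟨(x, i), hmem⟩
  · have h1 := hm2 (some ⟨x, hx⟩)
    rw [← hM, hnet (fun p => M p) ⟨x, hx⟩, hnet (fun p => θ p.2 p.1) ⟨x, hx⟩] at h1
    exact h1

/-- Boundary of a 2-chain. -/
def mhBd {d : ℕ} {Y R : Type*} [AddAction (Fin d → ℤ) Y] [AddCommGroup R]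
    (τ : Fin d → Fin d → Y → R) (i : Fin d) (y : Y) : R :=
  ∑ j, ((τ i j y - τ j i y) - (τ i j (-(mhE j) +ᵥ y) - τ j i (-(mhE j) +ᵥ y)))

theorem mhDiv_mhBd {d : ℕ} {Y R : Type*} [AddAction (Fin d → ℤ) Y] [AddCommGroup R]
    (τ : Fin d → Fin d → Y → R) (y : Y) : mhDiv (mhBd τ) y = 0 := by
  simp only [mhDiv, mhBd, ← Finset.sum_sub_distrib]
  simp only [Finset.sum_sub_distrib, vadd_vadd]
  rw [Finset.sum_comm (f := fun i j => τ i j (-(mhE j) +ᵥ y)),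
    Finset.sum_comm (f := fun i j => τ i j y),
    Finset.sum_comm (f := fun i j => τ i j (-(mhE i) +ᵥ y)),
    Finset.sum_comm (f := fun i j => τ i j ((-(mhE j) + -(mhE i)) +ᵥ y))]
  have h : ∀ a b : Fin d, τ b a ((-(mhE a) + -(mhE b)) +ᵥ y) = τ b a ((-(mhE b) + -(mhE a)) +ᵥ y) :=
    fun a b => by rw [add_comm]
  rw [show (∑ a, ∑ b, τ b a ((-(mhE a) + -(mhE b)) +ᵥ y)) =
    ∑ a, ∑ b, τ b a ((-(mhE b) + -(mhE a)) +ᵥ y) from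
    Finset.sum_congr rfl fun a _ => Finset.sum_congr rfl fun b _ => h a b]
  abel

/-- First partial sums. -/
noncomputable def mhT {d : ℕ} (φ : Fin d → (Fin d → ℤ) → ℝ) (i0 : Fin d) (L : ℤ) (i : Fin d)
    (x : Fin d → ℤ) : ℝ := ∑ s ∈ Finset.Icc L (x i0), φ i (Function.update x i0 s)

/-- Corrected component. -/
noncomputable def mhP {d : ℕ} (φ : Fin d → (Fin d → ℤ) → ℝ) (i0 : Fin d) (L : ℤ) 
    (x : Fin d → ℤ) : ℝ :=
  φ i0 x + ∑ j, if j = i0 then 0 else (mhT φ i0 L j x - mhT φ i0 L j (-(mhE j) + x))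

/-- Second partial sums. -/
noncomputable def mhG {d : ℕ} (φ : Fin d → (Fin d → ℤ) → ℝ) (i0 i1 : Fin d) (L : ℤ) 
    (x : Fin d → ℤ) : ℝ :=
  -∑ s ∈ Finset.Icc L (x i1), mhP φ i0 L (Function.update (Function.update x i0 L) i1 s)

/-- The filling 2-chain. -/
noncomputable def mhFill {d : ℕ} (φ : Fin d → (Fin d → ℤ) → ℝ) (i0 i1 : Fin d) (L : ℤ) (i j : Fin d)
    (x : Fin d → ℤ) : ℝ :=
  if i = i0 ∧ j ≠ i0 then mhT φ i0 L j x + (if j = i1 then mhG φ i0 i1 L x else 0) else 0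

theorem mhFill_measurable {d : ℕ} {Z : Type*} [MeasurableSpace Z]
    (Φ : Z → Fin d → (Fin d → ℤ) → ℝ) (hΦ : ∀ i x, Measurable (fun z => Φ z i x))
    (i0 i1 : Fin d) (L : ℤ) (i j : Fin d) (x : Fin d → ℤ) :
    Measurable (fun z => mhFill (Φ z) i0 i1 L i j x) := by
  have hT : ∀ i x, Measurable (fun z => mhT (Φ z) i0 L i x) := fun i x =>
    Finset.measurable_sum _ fun s _ => hΦ _ _
  have hP : ∀ x, Measurable (fun z => mhP (Φ z) i0 L x) := fun x => by
    refine (hΦ _ _).add (Finset.measurable_sum _ fun j _ => ?_)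
    by_cases h : j = i0
    · simp only [h, if_true]; exact measurable_const
    · simp only [h, if_false]; exact (hT _ _).sub (hT _ _)
  have hG : ∀ x, Measurable (fun z => mhG (Φ z) i0 i1 L x) := fun x =>
    (Finset.measurable_sum _ fun s _ => hP _).neg
  unfold mhFill
  by_cases h : i = i0 ∧ j ≠ i0
  · simp only [if_pos h]
    refine (hT _ _).add ?_
    by_cases h' : j = i1
    · simp only [if_pos h']; exact hG _
    · simp only [if_neg h']; exact measurable_const
  · simp only [if_neg h]; exact measurable_const

theorem mh_sub_update {d : ℕ} (i0 : Fin d) (x : Fin d → ℤ) (s : ℤ) :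
    Function.update (-(mhE i0) + x) i0 s = Function.update x i0 s := by
  ext k
  by_cases h : k = i0
  · subst h; simp
  · simp [h, mhE_ne h]

theorem mh_sum_step (L n : ℤ) (h : L ≤ n) (F : ℤ → ℝ) :
    ∑ s ∈ Finset.Icc L n, F s - ∑ s ∈ Finset.Icc L (-1 + n), F s = F n := by
  have : Finset.Icc L n = insert n (Finset.Icc L (-1 + n)) := by
    ext k; simp only [Finset.mem_Icc, Finset.mem_insert]; omega
  rw [this, Finset.sum_insert (by simp)]
  ring

theorem mhFill_integral {d : ℕ} (φ : Fin d → (Fin d → ℤ) → ℝ) (i0 i1 : Fin d) (hi : i1 ≠ i0) (L : ℤ)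
    (hφ : ∀ x, mhDiv φ x ∈ (Int.castAddHom ℝ).range) (x : Fin d → ℤ) (hx0 : L ≤ x i0)
    (hx1 : L ≤ x i1) (i : Fin d) :
    φ i x + mhBd (mhFill φ i0 i1 L) i x ∈ (Int.castAddHom ℝ).range := by
  set H := (Int.castAddHom ℝ).range with hH
  have hDT : ∀ i x, L ≤ x i0 → mhT φ i0 L i x - mhT φ i0 L i (-(mhE i0) + x) = φ i x := by
    intro i x hx
    simp only [mhT, mh_sub_update, Pi.add_apply, Pi.neg_apply, mhE_same]
    rw [mh_sum_step L _ hx, Function.update_eq_self]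
  have hDP : ∀ x, L ≤ x i0 → mhP φ i0 L x - mhP φ i0 L (-(mhE i0) + x) ∈ H := by
    intro x hx
    have h1 := hφ x
    have : mhP φ i0 L x - mhP φ i0 L (-(mhE i0) + x) = mhDiv φ x := by
      simp only [mhP, mhDiv, vadd_eq_add]
      rw [← Finset.add_sum_erase Finset.univ (fun i => φ i x - φ i (-mhE i + x)) (Finset.mem_univ i0),
        ← Finset.add_sum_erase Finset.univ _ (Finset.mem_univ i0),
        ← Finset.add_sum_erase Finset.univ (fun j => if j = i0 then 0 else (mhT φ i0 L j (-(mhE i0) + x) - mhT φ i0 L j (-(mhE j) + (-(mhE i0) + x)))) (Finset.mem_univ i0)]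
      simp only [if_true]
      have h2 : ∑ i ∈ Finset.univ.erase i0, (φ i x - φ i (-mhE i + x)) =
        ∑ j ∈ Finset.univ.erase i0, (if j = i0 then 0 else (mhT φ i0 L j x - mhT φ i0 L j (-(mhE j) + x)))
        - ∑ j ∈ Finset.univ.erase i0, (if j = i0 then 0 else (mhT φ i0 L j (-(mhE i0) + x) - mhT φ i0 L j (-(mhE j) + (-(mhE i0) + x)))) := by
        rw [← Finset.sum_sub_distrib]
        apply Finset.sum_congr rfl
        intro j hj
        have hne := Finset.ne_of_mem_erase hj
        rw [if_neg hne, if_neg hne, ← hDT j x hx, ← hDT j (-mhE j + x) (by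
          simpa [mhE_ne hne.symm] using hx), add_left_comm (-mhE j)]
        ring
      rw [h2]; ring
    rw [this]; exact h1
  have hPL : ∀ n : ℕ, ∀ x : Fin d → ℤ, x i0 = L + n →
      mhP φ i0 L x - mhP φ i0 L (Function.update x i0 L) ∈ H := by
    intro n
    induction n with
    | zero =>
      intro x hx
      have : Function.update x i0 L = x := by
        rw [show L = x i0 by rw [hx]; simp, Function.update_eq_self]
      rw [this, sub_self]; exact H.zero_mem
    | succ n ih =>
      intro x hx
      have h1 := ih (-(mhE i0) + x) (by
        simp only [Pi.add_apply, Pi.neg_apply, mhE_same, hx]; push_cast; ring)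
      have h2 := hDP x (by rw [hx]; omega)
      rw [mh_sub_update] at h1
      have := H.add_mem h2 h1
      rwa [sub_add_sub_cancel] at this
  have hG0 : ∀ x, mhG φ i0 i1 L (-(mhE i0) + x) = mhG φ i0 i1 L x := by
    intro x
    simp only [mhG, mh_sub_update, Pi.add_apply, Pi.neg_apply, mhE_ne hi, neg_zero, zero_add]
  have hG1 : mhG φ i0 i1 L x - mhG φ i0 i1 L (-(mhE i1) + x) = - mhP φ i0 L (Function.update x i0 L) := by
    have hup : ∀ s, Function.update (Function.update (-(mhE i1) + x) i0 L) i1 s =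
        Function.update (Function.update x i0 L) i1 s := by
      intro s
      rw [Function.update_comm hi.symm, Function.update_comm hi.symm, mh_sub_update]
    simp only [mhG, hup, Pi.add_apply, Pi.neg_apply, mhE_same]
    have := mh_sum_step L _ hx1 (fun s => mhP φ i0 L (Function.update (Function.update x i0 L) i1 s))
    have h3 : Function.update (Function.update x i0 L) i1 (x i1) = Function.update x i0 L := by
      rw [Function.update_comm hi.symm, Function.update_eq_self]
    simp only [h3] at this
    linarith
  by_cases hii : i = i0
  · subst hii
    have : φ i x + mhBd (mhFill φ i i1 L) i x = mhP φ i L x - mhP φ i L (Function.update x i L) := by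
      rw [sub_eq_add_neg, ← hG1]
      simp only [mhP, mhBd, mhFill, vadd_eq_add]
      rw [add_assoc]
      congr 1
      have h4 : mhG φ i i1 L x - mhG φ i i1 L (-mhE i1 + x) = ∑ j, if j = i1 then
          mhG φ i i1 L x - mhG φ i i1 L (-mhE i1 + x) else 0 := by simp
      rw [h4, ← Finset.sum_add_distrib]
      apply Finset.sum_congr rfl
      intro j _
      by_cases hj : j = i
      · subst hj; simp [hi.symm]
      · by_cases hj1 : j = i1
        · subst hj1; simp [hj]; ring
        · simp [hj, hj1]
    rw [this]
    obtain ⟨n, hn⟩ := Int.eq_ofNat_of_zero_le (sub_nonneg.2 hx0)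
    exact hPL n x (by omega)
  · have : φ i x + mhBd (mhFill φ i0 i1 L) i x = 0 := by
      rw [mhBd, Finset.sum_eq_single i0]
      · simp only [mhFill, vadd_eq_add]
        have h5 := hDT i x hx0
        by_cases h1 : i = i1
        · subst h1
          simp [hii, hG0, ← h5]
        · simp [hii, h1, ← h5]
      · intro j _ hj
        simp [mhFill, hii, hj]
      · simp
    rw [this]; exact H.zero_mem

/-- Boundary zone of the box `[0,N)^d`. -/
def mhZone {d : ℕ} (N : ℕ) (x : Fin d → ℤ) : Prop :=
  (∀ i, -2 ≤ x i ∧ x i < N + 2) ∧ ¬ ∀ i, 2 ≤ x i ∧ x i < N - 2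

/-- Finite shift vector. -/
def mhShift {d : ℕ} (N : ℕ) (t : Fin d → Fin 4) : Fin d → ℤ := fun i => N * ((t i : ℤ) - 2)

theorem mh_level {d : ℕ} {Y : Type*} [MeasurableSpace Y] [AddAction (Fin d → ℤ) Y]
    (hm : ∀ v : Fin d → ℤ, Measurable (fun y : Y => v +ᵥ y))
    (hfree : ∀ v : Fin d → ℤ, v ≠ 0 → ∀ y : Y, v +ᵥ y ≠ y)
    (s : Y → ℝ) (hs : Measurable s) (hinj : Function.Injective s) (N : ℕ) (hN : 0 < N) :
    ∃ M : Set Y, MeasurableSet M ∧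
      (∀ y ∈ M, ∀ v : Fin d → ℤ, v ≠ 0 → (∀ i, |v i| < 2 * N) → v +ᵥ y ∉ M) ∧
      (∀ y, ∃ v : Fin d → ℤ, (∀ i, |v i| < 2 * N) ∧ v +ᵥ y ∈ M) := by
  classical
  set V : Finset (Fin d → ℤ) := (Fintype.piFinset fun _ => Finset.Ioo (-(2 * N : ℤ)) (2 * N)).filter
    (fun v => v ≠ 0) with hV
  have hmem : ∀ v, v ∈ V ↔ (∀ i, |v i| < 2 * N) ∧ v ≠ 0 := by
    intro v; simp [hV, abs_lt]
  obtain ⟨M, hM, h1, h2⟩ := mh_marker hm hfree s hs hinj V (fun v hv => ((hmem v).1 hv).2)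
    (fun v hv => by
      rw [hmem] at hv ⊢
      exact ⟨fun i => by simpa using hv.1 i, by simpa using hv.2⟩)
  refine ⟨M, hM, fun y hy v hv0 hv => h1 y hy v ((hmem v).2 ⟨hv, hv0⟩), fun y => ?_⟩
  rcases h2 y with h | ⟨v, hv, h⟩
  · exact ⟨0, fun i => by simp [hN], by simpa using h⟩
  · exact ⟨v, ((hmem v).1 hv).1, h⟩

theorem mh_level_cover {d : ℕ} {Y : Type*} [AddAction (Fin d → ℤ) Y] (N : ℕ) (hN : 0 < N)
    (M : Set Y) (y : Y) (v : Fin d → ℤ) (hv : ∀ i, |v i| < 2 * N) (hy : v +ᵥ y ∈ M) :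
    ∃ t : Fin d → Fin 4, ∃ x ∈ mhBox d N, -(mhShift N t) +ᵥ (-x +ᵥ y) ∈ M := by
  have hN' : (0 : ℤ) < N := by exact_mod_cast hN
  have hq : ∀ i, 0 ≤ (-v i) / N + 2 ∧ (-v i) / N + 2 < 4 := by
    intro i
    have := abs_lt.1 (hv i)
    constructor
    · have : -2 ≤ (-v i) / N := by rw [Int.le_ediv_iff_mul_le hN']; linarith
      linarith
    · have : (-v i) / N < 2 := by rw [Int.ediv_lt_iff_lt_mul hN']; linarith
      linarith
  refine ⟨fun i => ⟨((-v i) / N + 2).toNat, by have := hq i; omega⟩, fun i => (-v i) % N, ?_, ?_⟩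
  · rw [mem_mhBox]
    exact fun i => ⟨Int.emod_nonneg _ hN'.ne', Int.emod_lt_of_pos _ hN'⟩
  · rw [vadd_vadd]
    convert hy using 2
    ext i
    simp only [mhShift, Pi.add_apply, Pi.neg_apply]
    have h1 := (hq i).1
    rw [Int.toNat_of_nonneg h1]
    have h2 := Int.emod_add_mul_ediv (-v i) N
    rw [add_sub_cancel_right]
    linarith

/-- Points close to the boundary of `[0,N)^d`. -/
noncomputable def mhFat (d N S : ℕ) : Finset (Fin d → ℤ) :=
  (Fintype.piFinset fun _ => Finset.Ico (-(S : ℤ)) (N + S)) \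
    (Fintype.piFinset fun _ => Finset.Ico (S : ℤ) (N - S))

theorem mhFat_card (d N S : ℕ) (h : 2 * S ≤ N) :
    ((mhFat d N S).card : ℝ) = ((N : ℝ) + 2 * S) ^ d - ((N : ℝ) - 2 * S) ^ d := by
  rw [mhFat, Finset.card_sdiff_of_subset]
  · rw [Nat.cast_sub]
    · simp only [Fintype.card_piFinset, Int.card_Ico, Finset.prod_const, Finset.card_univ,
        Fintype.card_fin]
      rw [show (N + S - -S : ℤ).toNat = N + 2 * S by omega,
        show (N - S - S : ℤ).toNat = N - 2 * S by omega]
      push_cast [Nat.cast_sub h]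
      ring
    · apply Finset.card_le_card
      intro x; simp only [Fintype.mem_piFinset, Finset.mem_Ico]
      exact fun hx i => ⟨by have := hx i; omega, by have := hx i; omega⟩
  · intro x; simp only [Fintype.mem_piFinset, Finset.mem_Ico]
    exact fun hx i => ⟨by have := hx i; omega, by have := hx i; omega⟩

theorem mhFat_small (d R j : ℕ) : ∃ N : ℕ, R ≤ N ∧ (mhFat d N (R + 4)).card * 2 ^ j ≤ N ^ d := by
  set S := R + 4 with hS
  have h1 : Filter.Tendsto (fun N : ℕ => (1 + 2 * S * (1 / (N : ℝ))) ^ d - (1 - 2 * S * (1 / (N : ℝ))) ^ d)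
      Filter.atTop (nhds ((1 + 2 * S * 0) ^ d - (1 - 2 * S * 0) ^ d)) := by
    have h0 := tendsto_one_div_atTop_nhds_zero_nat (𝕜 := ℝ)
    exact ((tendsto_const_nhds.add (h0.const_mul _)).pow d).sub
      ((tendsto_const_nhds.sub (h0.const_mul _)).pow d)
  have h2 : ((1 + 2 * (S : ℝ) * 0) ^ d - (1 - 2 * (S : ℝ) * 0) ^ d) = 0 := by simp
  rw [h2] at h1
  have h3 := h1.eventually (gt_mem_nhds (show (0 : ℝ) < 1 / 2 ^ j by positivity))
  obtain ⟨N, hN, hN2, hlt⟩ := ((Filter.eventually_ge_atTop R).and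
    ((Filter.eventually_ge_atTop (2 * S)).and h3)).exists
  refine ⟨N, hN, ?_⟩
  have hNp : (0 : ℝ) < N := by
    have : 0 < N := by omega
    exact_mod_cast this
  have h4 : ((mhFat d N S).card : ℝ) * 2 ^ j ≤ (N : ℝ) ^ d := by
    rw [mhFat_card d N S hN2]
    have e1 : ((N : ℝ) + 2 * S) = N * (1 + 2 * S * (1 / (N : ℝ))) := by field_simp
    have e2 : ((N : ℝ) - 2 * S) = N * (1 - 2 * S * (1 / (N : ℝ))) := by field_simp
    rw [e1, e2, mul_pow, mul_pow, ← mul_sub]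
    rw [lt_div_iff₀ (by positivity)] at hlt
    calc _ = (N : ℝ) ^ d * (((1 + 2 * S * (1 / (N : ℝ))) ^ d - (1 - 2 * S * (1 / (N : ℝ))) ^ d) * 2 ^ j) := by ring
      _ ≤ (N : ℝ) ^ d * 1 := by gcongr
      _ = _ := mul_one _
  exact_mod_cast h4

theorem mh_density {d : ℕ} {Y : Type*} [MeasurableSpace Y] [AddAction (Fin d → ℤ) Y]
    (ν : Measure Y) [IsProbabilityMeasure ν]
    (hmp : ∀ v : Fin d → ℤ, MeasurePreserving (fun y : Y => v +ᵥ y) ν ν) (N : ℕ)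
    (Z : Set Y) (hZ : MeasurableSet Z)
    (hsep : ∀ y ∈ Z, ∀ v : Fin d → ℤ, v ≠ 0 → (∀ i, |v i| < 2 * N) → v +ᵥ y ∉ Z) :
    (N : ENNReal) ^ d * ν Z ≤ 1 := by
  have h1 : ν (⋃ g ∈ mhBox d N, (fun y => -g +ᵥ y) ⁻¹' Z) =
      ∑ g ∈ mhBox d N, ν ((fun y => -g +ᵥ y) ⁻¹' Z) := by
    apply measure_biUnion_finset
    · intro g hg g' hg' hne
      rw [Function.onFun, Set.disjoint_left]
      intro y hy hy'
      simp only [Set.mem_preimage] at hy hy'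
      have hg := mem_mhBox.1 (Finset.mem_coe.1 hg)
      have hg' := mem_mhBox.1 (Finset.mem_coe.1 hg')
      refine hsep _ hy (g - g') (sub_ne_zero.2 hne) (fun i => ?_) ?_
      · have h1 := hg i
        have h2 := hg' i
        rw [Pi.sub_apply, abs_lt]; constructor <;> linarith
      · rw [vadd_vadd]; convert hy' using 2; abel
    · intro g _; exact (hmp _).measurable hZ
  simp only [(hmp _).measure_preimage hZ.nullMeasurableSet] at h1
  rw [Finset.sum_const, card_mhBox, nsmul_eq_mul] at h1
  push_cast at h1
  rw [← h1]
  exact prob_le_one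

theorem mh_toast {d : ℕ} {Y : Type*} [MeasurableSpace Y] [AddAction (Fin d → ℤ) Y]
    (ν : Measure Y) [IsProbabilityMeasure ν]
    (hmp : ∀ v : Fin d → ℤ, MeasurePreserving (fun y : Y => v +ᵥ y) ν ν)
    (hfree : ∀ v : Fin d → ℤ, v ≠ 0 → ∀ y : Y, v +ᵥ y ≠ y)
    (s : Y → ℝ) (hs : Measurable s) (hinj : Function.Injective s) :
    ∃ (N : ℕ → ℕ) (Z : ℕ → Set Y), (∀ k, MeasurableSet (Z k)) ∧
      (∀ (y : Y) (k : ℕ) (x : Fin d → ℤ) (k' : ℕ) (x' : Fin d → ℤ), mhZone (N k) x → -x +ᵥ y ∈ Z k → mhZone (N k') x' → -x' +ᵥ y ∈ Z k' →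
        k = k' ∧ x = x') ∧
      (∀ (y : Y) (k : ℕ) (x x' : Fin d → ℤ), x ∈ mhBox d (N k) → -x +ᵥ y ∈ Z k → x' ∈ mhBox d (N k) → -x' +ᵥ y ∈ Z k →
        x = x') ∧
      ∀ᵐ y ∂ν, ∃ k, ∃ x ∈ mhBox d (N k), -x +ᵥ y ∈ Z k := by
  classical
  have hm : ∀ v : Fin d → ℤ, Measurable (fun y : Y => v +ᵥ y) := fun v => (hmp v).measurable
  choose nx hnx1 hnx2 using mhFat_small d
  obtain ⟨N, hN0, hNs⟩ : ∃ N : ℕ → ℕ, N 0 = 4 ∧ ∀ k, N (k + 1) = nx (N k) (k + 1) :=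
    ⟨fun k => Nat.rec 4 (fun j p => nx p (j + 1)) k, rfl, fun k => rfl⟩
  have hNmono : Monotone N := monotone_nat_of_le_succ fun k => by rw [hNs]; exact hnx1 _ _
  have hN4 : ∀ k, 4 ≤ N k := fun k => hN0 ▸ hNmono (Nat.zero_le k)
  have hNpos : ∀ k, 0 < N k := fun k => lt_of_lt_of_le (by norm_num) (hN4 k)
  choose M hMm hMsep hMcov using fun k => mh_level hm hfree s hs hinj (N k) (hNpos k)
  obtain ⟨t, ht⟩ := mh_cover ν
    (fun k (t : Fin d → Fin 4) => ⋃ x ∈ mhBox d (N k), (fun y => -(mhShift (N k) t) +ᵥ (-x +ᵥ y)) ⁻¹' M k)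
    (fun k t => Finset.measurableSet_biUnion _ fun x _ => ((hm _).comp (hm _)) (hMm k))
    (fun k y => by
      obtain ⟨v, hv, hy⟩ := hMcov k y
      obtain ⟨t, x, hx, h⟩ := mh_level_cover (N k) (hNpos k) (M k) y v hv hy
      exact ⟨t, Set.mem_biUnion hx h⟩)
  let Z0 : ℕ → Set Y := fun k => (fun y => -(mhShift (N k) (t k)) +ᵥ y) ⁻¹' M k
  have hZ0m : ∀ k, MeasurableSet (Z0 k) := fun k => hm _ (hMm k)
  have hZ0sep : ∀ k : ℕ, ∀ y ∈ Z0 k, ∀ v : Fin d → ℤ, v ≠ 0 → (∀ i, |v i| < 2 * (N k : ℤ)) → v +ᵥ y ∉ Z0 k := by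
    intro k y hy v hv hv' hvy
    refine hMsep k _ hy v hv hv' ?_
    simp only [Z0, Set.mem_preimage, vadd_vadd] at hvy
    rwa [vadd_vadd, add_comm]
  have hcl : ∀ (k : ℕ) (y : Y) (x x' : Fin d → ℤ), -x +ᵥ y ∈ Z0 k → -x' +ᵥ y ∈ Z0 k → (∀ i, |x i - x' i| < 2 * (N k : ℤ)) →
      x = x' := by
    intro k y x x' hx hx' h
    by_contra hne
    refine hZ0sep k _ hx (x - x') (sub_ne_zero.2 hne) h ?_
    rw [vadd_vadd]; convert hx' using 2; abel
  let bad : ℕ → Set Y := fun j => ⋃ p ∈ mhFat d (N (j + 1)) (N j + 4), (fun y => -p +ᵥ y) ⁻¹' Z0 (j + 1)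
  have hbad : ∀ j, ν (bad j) ≤ (2⁻¹ : ENNReal) ^ (j + 1) := by
    intro j
    have h1 : ν (bad j) ≤ (mhFat d (N (j + 1)) (N j + 4)).card * ν (Z0 (j + 1)) := by
      refine (measure_biUnion_finset_le _ _).trans ?_
      simp only [(hmp _).measure_preimage (hZ0m _).nullMeasurableSet]
      rw [Finset.sum_const, nsmul_eq_mul]
    have h2 := hnx2 (N j) (j + 1)
    rw [← hNs] at h2
    have h3 := mh_density ν hmp (N (j + 1)) _ (hZ0m (j + 1)) (hZ0sep (j + 1))
    rw [← ENNReal.inv_pow, ENNReal.le_inv_iff_mul_le]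
    calc _ ≤ ((mhFat d (N (j + 1)) (N j + 4)).card * ν (Z0 (j + 1))) * 2 ^ (j + 1) := by gcongr
      _ = (((mhFat d (N (j + 1)) (N j + 4)).card * 2 ^ (j + 1) : ℕ) : ENNReal) * ν (Z0 (j + 1)) := by
        push_cast; ring
      _ ≤ ((N (j + 1) ^ d : ℕ) : ENNReal) * ν (Z0 (j + 1)) := by gcongr
      _ ≤ 1 := by push_cast; exact h3
  have hsum : ∑' j, ν (bad j) ≠ ⊤ := by
    apply ne_top_of_le_ne_top _ (ENNReal.tsum_le_tsum hbad)
    simp only [pow_succ]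
    rw [ENNReal.tsum_mul_right, ENNReal.tsum_geometric]
    simp
  have hfin := ae_eventually_notMem hsum
  let Z : ℕ → Set Y := fun k => {z | z ∈ Z0 k ∧ ∀ j, k < j → ∀ x : Fin d → ℤ, mhZone (N k) x →
    ∀ x' : Fin d → ℤ, mhZone (N j) x' → -x' +ᵥ (x +ᵥ z) ∉ Z0 j}
  have hZZ0 : ∀ k, Z k ⊆ Z0 k := fun k z hz => hz.1
  refine ⟨N, Z, ?_, ?_, ?_, ?_⟩
  · intro k
    have : Z k = Z0 k ∩ ⋂ (j : ℕ) (_ : k < j) (x : Fin d → ℤ) (_ : mhZone (N k) x) (x' : Fin d → ℤ)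
        (_ : mhZone (N j) x'), ((fun z => -x' +ᵥ (x +ᵥ z)) ⁻¹' Z0 j)ᶜ := by
      ext z; simp [Z]
    rw [this]
    refine (hZ0m k).inter ?_
    refine MeasurableSet.iInter fun j => MeasurableSet.iInter fun _ => MeasurableSet.iInter fun x =>
      MeasurableSet.iInter fun _ => MeasurableSet.iInter fun x' => MeasurableSet.iInter fun _ => ?_
    exact (((hm _).comp (hm _)) (hZ0m j)).compl
  · intro y k x k' x' hx hy hx' hy'
    have hlt : ∀ (k : ℕ) (x : Fin d → ℤ) (k' : ℕ) (x' : Fin d → ℤ), mhZone (N k) x → -x +ᵥ y ∈ Z k → mhZone (N k') x' → -x' +ᵥ y ∈ Z k' →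
        ¬ k < k' := by
      intro k x k' x' hx hy hx' hy' hlt
      refine hy.2 k' hlt x hx x' hx' ?_
      rw [vadd_vadd x, add_neg_cancel, zero_vadd]
      exact hy'.1
    have hkk : k = k' := le_antisymm (not_lt.1 (hlt _ _ _ _ hx' hy' hx hy)) (not_lt.1 (hlt _ _ _ _ hx hy hx' hy'))
    subst hkk
    refine ⟨rfl, hcl k y x x' hy.1 hy'.1 fun i => ?_⟩
    have h1 := hx.1 i
    have h2 := hx'.1 i
    have h3 : (4 : ℤ) ≤ N k := by exact_mod_cast hN4 k
    rw [abs_lt]; constructor <;> linarith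
  · intro y k x x' hx hy hx' hy'
    refine hcl k y x x' hy.1 hy'.1 fun i => ?_
    have h1 := mem_mhBox.1 hx i
    have h2 := mem_mhBox.1 hx' i
    rw [abs_lt]; constructor <;> linarith
  · filter_upwards [ht, hfin] with y hy1 hy2
    obtain ⟨n, hn⟩ := hy2.exists_forall_of_atTop
    obtain ⟨k, hk, hyk⟩ := hy1 n
    rw [Set.mem_iUnion₂] at hyk
    obtain ⟨x, hx, hxy⟩ := hyk
    refine ⟨k, x, hx, hxy, ?_⟩
    intro j hj x1 hx1 x2 hx2 hcon
    obtain ⟨l, rfl⟩ : ∃ l, j = l + 1 := ⟨j - 1, by omega⟩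
    apply hn l (by omega)
    simp only [bad, Set.mem_iUnion, Set.mem_preimage]
    have hkl : (N k : ℤ) ≤ N l := by exact_mod_cast hNmono (by omega : k ≤ l)
    have hxb := mem_mhBox.1 hx
    refine ⟨x - x1 + x2, ?_, ?_⟩
    · rw [mhFat, Finset.mem_sdiff]
      simp only [Fintype.mem_piFinset, Finset.mem_Ico]
      constructor
      · intro i
        have h1 := hxb i
        have h2 := hx1.1 i
        have h3 := hx2.1 i
        simp only [Pi.add_apply, Pi.sub_apply]
        push_cast
        constructor <;> linarith
      · intro hcon2
        apply hx2.2
        intro i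
        have h1 := hxb i
        have h2 := hx1.1 i
        have h3 := hcon2 i
        simp only [Pi.add_apply, Pi.sub_apply] at h3
        push_cast at h3
        constructor <;> linarith
    · rw [vadd_vadd, vadd_vadd] at hcon
      convert hcon using 2
      abel

theorem mh_fract_sub (a : ℝ) : Int.fract a - a ∈ (Int.castAddHom ℝ).range :=
  ⟨-⌊a⌋, by
    have := Int.self_sub_floor a
    simp only [Int.coe_castAddHom]
    push_cast
    linarith⟩

theorem mh_theta {d : ℕ} {Y : Type*} [MeasurableSpace Y] [AddAction (Fin d → ℤ) Y]
    (hm : ∀ v : Fin d → ℤ, Measurable (fun y : Y => v +ᵥ y))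
    (φ : Fin d → Y → ℝ) (hφm : ∀ i, Measurable (φ i)) (K : ℝ) (hφK : ∀ i y, |φ i y| ≤ K)
    (hdiv : ∀ y, mhDiv φ y ∈ (Int.castAddHom ℝ).range) (i0 i1 : Fin d) (hi : i1 ≠ i0)
    (N : ℕ → ℕ) (Z : ℕ → Set Y) (hZ : ∀ k, MeasurableSet (Z k))
    (huniq : ∀ (y : Y) (k : ℕ) (x : Fin d → ℤ) (k' : ℕ) (x' : Fin d → ℤ),
      mhZone (N k) x → -x +ᵥ y ∈ Z k → mhZone (N k') x' → -x' +ᵥ y ∈ Z k' → k = k' ∧ x = x') :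
    ∃ θ : Fin d → Y → ℝ, (∀ i, Measurable (θ i)) ∧ (∀ i y, |θ i y| ≤ K + 2 * d) ∧
      (∀ y, mhDiv θ y = mhDiv φ y) ∧
      ∀ (k : ℕ) (z : Y) (x : Fin d → ℤ) (i : Fin d), z ∈ Z k →
        ¬ (x ∈ mhBox d (N k) ↔ x + mhE i ∈ mhBox d (N k)) →
        θ i (x +ᵥ z) ∈ (Int.castAddHom ℝ).range := by
  classical
  set H := (Int.castAddHom ℝ).range with hH
  let P : Option (ℕ × (Fin d → ℤ)) → Set Y := fun o => match o with
    | none => {y | ∀ (k : ℕ) (x : Fin d → ℤ), mhZone (N k) x → -x +ᵥ y ∉ Z k}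
    | some (k, x) => {y | mhZone (N k) x ∧ -x +ᵥ y ∈ Z k}
  obtain ⟨c, hcm, hc⟩ := mh_exists_choice P (by
      rintro (_ | ⟨k, x⟩)
      · have : P none = ⋂ (k : ℕ) (x : Fin d → ℤ) (_ : mhZone (N k) x), ((fun y => -x +ᵥ y) ⁻¹' Z k)ᶜ := by
          ext y; simp [P]
        rw [this]
        exact MeasurableSet.iInter fun k => MeasurableSet.iInter fun x => MeasurableSet.iInter fun _ =>
          (hm _ (hZ k)).compl
      · exact (MeasurableSet.const _).inter (hm _ (hZ k)))
    (by
      intro y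
      by_cases h : ∃ (k : ℕ) (x : Fin d → ℤ), mhZone (N k) x ∧ -x +ᵥ y ∈ Z k
      · obtain ⟨k, x, h⟩ := h
        exact ⟨some (k, x), h⟩
      · push Not at h
        exact ⟨none, h⟩)
  have hcu : ∀ (k : ℕ) (z : Y) (x : Fin d → ℤ), z ∈ Z k → mhZone (N k) x →
      c (x +ᵥ z) = some (k, x) := by
    intro k z x hz hx
    have h1 := hc (x +ᵥ z)
    have hz' : -x +ᵥ (x +ᵥ z) ∈ Z k := by rwa [neg_vadd_vadd]
    rcases h2 : c (x +ᵥ z) with _ | ⟨k', x'⟩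
    · rw [h2] at h1
      exact absurd hz' (h1 k x hx)
    · rw [h2] at h1
      obtain ⟨rfl, rfl⟩ := huniq (x +ᵥ z) k x k' x' hx hz' h1.1 h1.2
      rfl
  let F : Fin d → Fin d → Option (ℕ × (Fin d → ℤ)) → Y → ℝ := fun i j o y => match o with
    | none => 0
    | some (_, x) => Int.fract (mhFill (fun i g => φ i (g +ᵥ (-x +ᵥ y))) i0 i1 (-3) i j x)
  have hFm : ∀ i j o, Measurable (F i j o) := by
    intro i j o
    rcases o with _ | ⟨k, x⟩
    · exact measurable_const
    · exact (mhFill_measurable (fun y i g => φ i (g +ᵥ (-x +ᵥ y)))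
        (fun i g => (hφm i).comp ((hm g).comp (hm (-x)))) i0 i1 (-3) i j x).fract
  have hFb : ∀ i j o y, 0 ≤ F i j o y ∧ F i j o y ≤ 1 := by
    intro i j o y
    rcases o with _ | ⟨k, x⟩
    · simp [F]
    · exact ⟨Int.fract_nonneg _, (Int.fract_lt_one _).le⟩
  let S : Fin d → Fin d → Y → ℝ := fun i j y => F i j (c y) y
  have hSm : ∀ i j, Measurable (S i j) := fun i j => mh_measurable_glue c hcm (F i j) (hFm i j)
  have hSz : ∀ (k : ℕ) (z : Y) (x : Fin d → ℤ) i j, z ∈ Z k → mhZone (N k) x →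
      S i j (x +ᵥ z) = Int.fract (mhFill (fun i g => φ i (g +ᵥ z)) i0 i1 (-3) i j x) := by
    intro k z x i j hz hx
    simp only [S, hcu k z x hz hx, F, neg_vadd_vadd]
  refine ⟨fun i y => φ i y + mhBd S i y, fun i => ?_, fun i y => ?_, fun y => ?_, ?_⟩
  · refine (hφm i).add (Finset.measurable_sum _ fun j _ => ?_)
    exact ((hSm i j).sub (hSm j i)).sub (((hSm i j).comp (hm _)).sub ((hSm j i).comp (hm _)))
  · have h1 : |mhBd S i y| ≤ 2 * d := by
      rw [mhBd]
      calc _ ≤ ∑ j, |(S i j y - S j i y) - (S i j (-(mhE j) +ᵥ y) - S j i (-(mhE j) +ᵥ y))| :=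
            Finset.abs_sum_le_sum_abs _ _
        _ ≤ ∑ _j : Fin d, (2 : ℝ) := Finset.sum_le_sum fun j _ => by
            have h1 := hFb i j (c y) y
            have h2 := hFb j i (c y) y
            have h3 := hFb i j (c (-(mhE j) +ᵥ y)) (-(mhE j) +ᵥ y)
            have h4 := hFb j i (c (-(mhE j) +ᵥ y)) (-(mhE j) +ᵥ y)
            simp only [S]
            rw [abs_le]; constructor <;> linarith [h1.1, h1.2, h2.1, h2.2, h3.1, h3.2, h4.1, h4.2]
        _ = _ := by simp [mul_comm]
    exact (abs_add_le _ _).trans (add_le_add (hφK i y) h1)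
  · have h1 := mhDiv_mhBd S y
    have : mhDiv (fun i y => φ i y + mhBd S i y) y = mhDiv φ y + mhDiv (mhBd S) y := by
      simp only [mhDiv, ← Finset.sum_add_distrib]
      apply Finset.sum_congr rfl; intro i _; ring
    rw [this, h1, add_zero]
  · intro k z x i hz hx
    set φz : Fin d → (Fin d → ℤ) → ℝ := fun i g => φ i (g +ᵥ z) with hφz
    have hxx : (∀ l, -1 ≤ x l ∧ x l < N k + 1) ∧ (x i = N k - 1 ∨ x i = -1) := by
      have key : ∀ l, l ≠ i → (x + mhE i) l = x l := fun l hl => by simp [mhE_ne hl]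
      have keyi : (x + mhE i) i = x i + 1 := by simp [mhE_same]
      by_cases hxb : x ∈ mhBox d (N k)
      · have hxe : x + mhE i ∉ mhBox d (N k) := fun h => hx ⟨fun _ => h, fun _ => hxb⟩
        rw [mem_mhBox] at hxb hxe
        refine ⟨fun l => by have := hxb l; omega, Or.inl ?_⟩
        by_contra hne
        apply hxe
        intro l
        by_cases hl : l = i
        · subst hl; rw [keyi]; have := hxb l; omega
        · rw [key l hl]; exact hxb l
      · have hxe : x + mhE i ∈ mhBox d (N k) := by
          by_contra h; exact hx ⟨fun h' => absurd h' hxb, fun h' => absurd h' h⟩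
        rw [mem_mhBox] at hxb hxe
        constructor
        · intro l
          have := hxe l
          by_cases hl : l = i
          · subst hl; rw [keyi] at this; omega
          · rw [key l hl] at this; omega
        · right
          by_contra hne
          apply hxb
          intro l
          have := hxe l
          by_cases hl : l = i
          · subst hl; rw [keyi] at this; omega
          · rw [key l hl] at this; exact this
    obtain ⟨hx1, hx2⟩ := hxx
    have hz0 : mhZone (N k) x := by
      refine ⟨fun l => by have := hx1 l; omega, fun h => ?_⟩
      have := h i
      omega
    have hzj : ∀ j, mhZone (N k) (-mhE j + x) := by
      intro j
      have hv : ∀ l, (-mhE j + x) l = x l ∨ (-mhE j + x) l = x l - 1 := by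
        intro l
        by_cases hl : l = j
        · subst hl; right; simp [mhE_same]; ring
        · left; simp [mhE_ne hl]
      refine ⟨fun l => ?_, fun h => ?_⟩
      · have := hx1 l
        have := hv l
        omega
      · have := h i
        have := hv i
        omega
    have hfill := mhFill_integral φz i0 i1 hi (-3) (fun x => by
      have : mhDiv φz x = mhDiv φ (x +ᵥ z) := by
        simp only [mhDiv, hφz, vadd_vadd, vadd_eq_add]
      rw [this]; exact hdiv _) x (by have := hx1 i0; omega) (by have := hx1 i1; omega) i
    have hdiff : mhBd S i (x +ᵥ z) - mhBd (mhFill φz i0 i1 (-3)) i x ∈ H := by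
      simp only [mhBd, ← Finset.sum_sub_distrib, vadd_vadd, vadd_eq_add]
      refine sum_mem fun j _ => ?_
      rw [hSz k z x i j hz hz0, hSz k z x j i hz hz0, hSz k z _ i j hz (hzj j), hSz k z _ j i hz (hzj j)]
      have e1 := mh_fract_sub (mhFill φz i0 i1 (-3) i j x)
      have e2 := mh_fract_sub (mhFill φz i0 i1 (-3) j i x)
      have e3 := mh_fract_sub (mhFill φz i0 i1 (-3) i j (-mhE j + x))
      have e4 := mh_fract_sub (mhFill φz i0 i1 (-3) j i (-mhE j + x))
      have := H.sub_mem (H.sub_mem e1 e2) (H.sub_mem e3 e4)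
      convert this using 1
      ring
    have := H.add_mem hfill hdiff
    convert this using 1
    simp only [hφz]
    ring

theorem mh_assemble {d : ℕ} {Y : Type*} [MeasurableSpace Y] [AddAction (Fin d → ℤ) Y]
    (ν : Measure Y) 
    (hmp : ∀ v : Fin d → ℤ, MeasurePreserving (fun y : Y => v +ᵥ y) ν ν)
    (θ : Fin d → Y → ℝ) (hθm : ∀ i, Measurable (θ i)) (K : ℕ) (hθK : ∀ i y, |θ i y| ≤ K)
    (f : Y → ℤ) (hf : Measurable f) (hdiv : ∀ y, mhDiv θ y = f y)
    (N : ℕ → ℕ) (Z : ℕ → Set Y) (hZ : ∀ k, MeasurableSet (Z k))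
    (huniq : ∀ (y : Y) (k : ℕ) (x x' : Fin d → ℤ), x ∈ mhBox d (N k) → -x +ᵥ y ∈ Z k →
      x' ∈ mhBox d (N k) → -x' +ᵥ y ∈ Z k → x = x')
    (hcov : ∀ᵐ y ∂ν, ∃ k, ∃ x ∈ mhBox d (N k), -x +ᵥ y ∈ Z k)
    (hcross : ∀ (k : ℕ) (z : Y) (x : Fin d → ℤ) (i : Fin d), z ∈ Z k →
        ¬ (x ∈ mhBox d (N k) ↔ x + mhE i ∈ mhBox d (N k)) →
        θ i (x +ᵥ z) ∈ (Int.castAddHom ℝ).range) :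
    ∃ ψ : Fin d → Y → ℤ, (∀ i, Measurable (ψ i)) ∧ (∃ K' : ℕ, ∀ i y, |ψ i y| ≤ K') ∧
      ∀ᵐ y ∂ν, mhDiv ψ y = f y := by
  classical
  have hm : ∀ v : Fin d → ℤ, Measurable (fun y : Y => v +ᵥ y) := fun v => (hmp v).measurable
  let P : Option (ℕ × (Fin d → ℤ)) → Set Y := fun o => match o with
    | none => {y | ∀ (k : ℕ), ∀ x ∈ mhBox d (N k), -x +ᵥ y ∉ Z k}
    | some (k, x) => {y | x ∈ mhBox d (N k) ∧ -x +ᵥ y ∈ Z k ∧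
        ∀ k' < k, ∀ x' ∈ mhBox d (N k'), -x' +ᵥ y ∉ Z k'}
  obtain ⟨c, hcm, hc⟩ := mh_exists_choice P (by
      rintro (_ | ⟨k, x⟩)
      · have : P none = ⋂ (k : ℕ) (x ∈ mhBox d (N k)), ((fun y => -x +ᵥ y) ⁻¹' Z k)ᶜ := by
          ext y; simp [P]
        rw [this]
        exact MeasurableSet.iInter fun k => MeasurableSet.iInter fun x => MeasurableSet.iInter fun _ =>
          (hm _ (hZ k)).compl
      · have : P (some (k, x)) = {_y | x ∈ mhBox d (N k)} ∩ ((fun y => -x +ᵥ y) ⁻¹' Z k ∩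
            ⋂ (k' : ℕ) (_ : k' < k) (x' ∈ mhBox d (N k')), ((fun y => -x' +ᵥ y) ⁻¹' Z k')ᶜ) := by
          ext y; simp [P]
        rw [this]
        exact (MeasurableSet.const _).inter ((hm _ (hZ k)).inter (MeasurableSet.iInter fun k =>
          MeasurableSet.iInter fun _ => MeasurableSet.iInter fun x => MeasurableSet.iInter fun _ =>
          (hm _ (hZ k)).compl)))
    (by
      intro y
      by_cases h : ∃ (k : ℕ), ∃ x ∈ mhBox d (N k), -x +ᵥ y ∈ Z k
      · obtain ⟨x, hx, hxy⟩ := Nat.find_spec h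
        refine ⟨some (Nat.find h, x), hx, hxy, fun k' hk' x' hx' hc => ?_⟩
        exact Nat.find_min h hk' ⟨x', hx', hc⟩
      · push Not at h
        exact ⟨none, h⟩)
  let Q : ℕ → (((Fin d → ℤ) × Fin d) →₀ ℤ) → Set Y := fun k m =>
    {z | (∀ x i, (x ∈ mhBox d (N k) ∨ x + mhE i ∈ mhBox d (N k)) →
        ⌊θ i (x +ᵥ z)⌋ ≤ m (x, i) ∧ m (x, i) ≤ ⌈θ i (x +ᵥ z)⌉) ∧
      ∀ x ∈ mhBox d (N k), ∑ i, (m (x, i) - m (x - mhE i, i)) = f (x +ᵥ z)}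
  have hQm : ∀ k m, MeasurableSet (Q k m) := by
    intro k m
    have : Q k m = (⋂ (x : Fin d → ℤ) (i : Fin d)
        (_ : x ∈ mhBox d (N k) ∨ x + mhE i ∈ mhBox d (N k)),
        (((fun z => ⌊θ i (x +ᵥ z)⌋) ⁻¹' Set.Iic (m (x, i))) ∩
         ((fun z => ⌈θ i (x +ᵥ z)⌉) ⁻¹' Set.Ici (m (x, i))))) ∩
        ⋂ x ∈ mhBox d (N k), (fun z => f (x +ᵥ z)) ⁻¹' {∑ i, (m (x, i) - m (x - mhE i, i))} := by
      ext z; simp only [Q, Set.mem_ofPred_eq, Set.mem_inter_iff, Set.mem_iInter, Set.mem_preimage,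
        Set.mem_Iic, Set.mem_Ici, Set.mem_singleton_iff, eq_comm]
    rw [this]
    refine MeasurableSet.inter (MeasurableSet.iInter fun x => MeasurableSet.iInter fun i =>
      MeasurableSet.iInter fun _ => ?_) (Finset.measurableSet_biInter _ fun x _ =>
        (hf.comp (hm x)) (measurableSet_singleton _))
    have hθx : Measurable (fun z => θ i (x +ᵥ z)) := (hθm i).comp (hm x)
    exact (hθx.floor measurableSet_Iic).inter (hθx.ceil measurableSet_Ici)
  have hQe : ∀ k z, ∃ m, z ∈ Q k m := by
    intro k z
    have hd : ∀ x : Fin d → ℤ, ∑ i, (θ i (x +ᵥ z) - θ i ((x - mhE i) +ᵥ z)) = f (x +ᵥ z) := by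
      intro x
      rw [← hdiv, mhDiv]
      simp only [vadd_vadd, neg_add_eq_sub]
    obtain ⟨m, h1, h2⟩ := mh_round_box (mhBox d (N k)) (fun i x => θ i (x +ᵥ z))
      (fun x _ => ⟨f (x +ᵥ z), by rw [hd]; rfl⟩)
    refine ⟨m, h1, fun x hx => ?_⟩
    have := h2 x hx
    rw [hd] at this
    exact_mod_cast this
  choose cc hccm hcc using fun k => mh_exists_choice (Q k) (hQm k) (hQe k)
  let F : Fin d → Option (ℕ × (Fin d → ℤ)) → Y → ℤ := fun i o y => match o with
    | none => 0
    | some (k, x) => cc k (-x +ᵥ y) (x, i)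
  have hFm : ∀ i o, Measurable (F i o) := by
    intro i o
    rcases o with _ | ⟨k, x⟩
    · exact measurable_const
    · have h1 : Measurable (fun y => cc k y (x, i)) :=
        mh_measurable_glue (cc k) (hccm k) (fun m _ => m (x, i)) fun _ => measurable_const
      exact h1.comp (hm (-x))
  refine ⟨fun i y => F i (c y) y, fun i => mh_measurable_glue c hcm (F i) (hFm i), ⟨K + 1, ?_⟩, ?_⟩
  · intro i y
    have h1 := hc y
    rcases h2 : c y with _ | ⟨k, x⟩
    · have hFv : F i (c y) y = 0 := by simp only [h2, F]
      show |F i (c y) y| ≤ _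
      rw [hFv, abs_zero]; positivity
    · rw [h2] at h1
      have h3 := (hcc k (-x +ᵥ y)).1 x i (Or.inl h1.1)
      rw [vadd_neg_vadd] at h3
      have h4 := abs_le.1 (hθK i y)
      have h5 : (-(K : ℤ)) ≤ ⌊θ i y⌋ := Int.le_floor.2 (by push_cast; exact h4.1)
      have h6 : ⌈θ i y⌉ ≤ K := Int.ceil_le.2 (by push_cast; exact h4.2)
      have hFv : F i (c y) y = cc k (-x +ᵥ y) (x, i) := by simp only [h2, F]
      show |F i (c y) y| ≤ _
      rw [hFv, abs_le]
      push_cast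
      constructor <;> linarith [h3.1, h3.2]
  · have hcov2 : ∀ᵐ y ∂ν, ∀ i : Fin d, ∃ k, ∃ x ∈ mhBox d (N k), -x +ᵥ (-mhE i +ᵥ y) ∈ Z k :=
      ae_all_iff.2 fun i => (hmp (-mhE i)).quasiMeasurePreserving.ae hcov
    have hsome : ∀ y, (∃ k, ∃ x ∈ mhBox d (N k), -x +ᵥ y ∈ Z k) →
        ∃ k x, c y = some (k, x) ∧ y ∈ P (some (k, x)) := by
      rintro y ⟨k, x, hx, hxy⟩
      have h1 := hc y
      rcases h2 : c y with _ | ⟨k', x'⟩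
      · rw [h2] at h1; exact absurd hxy (h1 k x hx)
      · rw [h2] at h1; exact ⟨k', x', rfl, h1⟩
    filter_upwards [hcov, hcov2] with y hy hy2
    obtain ⟨k, x, hcy, hxb, hxz, hmin⟩ := hsome y hy
    have hval := (hcc k (-x +ᵥ y)).2 x hxb
    rw [vadd_neg_vadd] at hval
    rw [← hval, mhDiv]
    apply Finset.sum_congr rfl
    intro i _
    have hA : F i (c y) y = cc k (-x +ᵥ y) (x, i) := by simp only [hcy, F]
    rw [hA]
    congr 1
    obtain ⟨k', x', hcy', hxb', hxz', hmin'⟩ := hsome _ (hy2 i)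
    have hB : F i (c (-mhE i +ᵥ y)) (-mhE i +ᵥ y) = cc k' (-x' +ᵥ (-mhE i +ᵥ y)) (x', i) := by
      simp only [hcy', F]
    rw [hB]
    have hpos : -(x - mhE i) +ᵥ (-mhE i +ᵥ y) = -x +ᵥ y := by
      rw [vadd_vadd]; congr 1; abel
    have hpos2 : (x - mhE i) +ᵥ (-x +ᵥ y) = -mhE i +ᵥ y := by
      rw [vadd_vadd]; congr 1; abel
    by_cases hsame : k' = k ∧ x' = x - mhE i
    · obtain ⟨rfl, rfl⟩ := hsame
      rw [hpos]
    · have hintg : θ i (-mhE i +ᵥ y) ∈ (Int.castAddHom ℝ).range := by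
        by_cases hin : x - mhE i ∈ mhBox d (N k)
        · have hle : ¬ k < k' := fun h => hmin' k h _ hin (by rw [hpos]; exact hxz)
          have hne : k' ≠ k := by
            rintro rfl
            exact hsame ⟨rfl, huniq _ _ _ _ hxb' hxz' hin (by rw [hpos]; exact hxz)⟩
          have hlt : k' < k := by omega
          have h1 := hcross k' _ x' i hxz' (fun hiff => by
            refine hmin k' hlt _ (hiff.1 hxb') ?_
            convert hxz' using 1
            rw [vadd_vadd]; congr 1; abel)
          rwa [vadd_neg_vadd] at h1
        · have h1 := hcross k _ (x - mhE i) i hxz (fun hiff => by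
            rw [sub_add_cancel] at hiff
            exact hin (hiff.2 hxb))
          rwa [hpos2] at h1
      have b1 := (hcc k (-x +ᵥ y)).1 (x - mhE i) i (Or.inr (by rwa [sub_add_cancel]))
      have b2 := (hcc k' (-x' +ᵥ (-mhE i +ᵥ y))).1 x' i (Or.inl hxb')
      rw [hpos2] at b1
      rw [vadd_neg_vadd] at b2
      obtain ⟨n, hn⟩ := hintg
      rw [← hn] at b1 b2
      simp only [Int.coe_castAddHom, Int.floor_intCast, Int.ceil_intCast] at b1 b2
      omega

theorem mh_round {d : ℕ} {Y : Type*} [MeasurableSpace Y] [AddAction (Fin d → ℤ) Y]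
    (ν : Measure Y) [IsProbabilityMeasure ν]
    (hmp : ∀ v : Fin d → ℤ, MeasurePreserving (fun y : Y => v +ᵥ y) ν ν)
    (hfree : ∀ v : Fin d → ℤ, v ≠ 0 → ∀ y : Y, v +ᵥ y ≠ y)
    (s : Y → ℝ) (hs : Measurable s) (hinj : Function.Injective s)
    (φ : Fin d → Y → ℝ) (hφm : ∀ i, Measurable (φ i)) (K : ℕ) (hφK : ∀ i y, |φ i y| ≤ K)
    (f : Y → ℤ) (hf : Measurable f) (hdiv : ∀ y, mhDiv φ y = f y) :
    ∃ ψ : Fin d → Y → ℤ, (∀ i, Measurable (ψ i)) ∧ (∃ K' : ℕ, ∀ i y, |ψ i y| ≤ K') ∧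
      ∀ᵐ y ∂ν, mhDiv ψ y = f y := by
  by_cases hd : d ≤ 1
  · refine ⟨fun i y => ⌊φ i y⌋, fun i => (hφm i).floor, ⟨K + 1, fun i y => ?_⟩,
      Filter.Eventually.of_forall fun y => ?_⟩
    · have h4 := abs_le.1 (hφK i y)
      have h5 : (-(K : ℤ)) ≤ ⌊φ i y⌋ := Int.le_floor.2 (by push_cast; exact h4.1)
      have h6 : ⌊φ i y⌋ ≤ K := (Int.floor_le_ceil _).trans (Int.ceil_le.2 (by push_cast; exact h4.2))
      rw [abs_le]; push_cast; constructor <;> linarith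
    · have h1 := hdiv y
      rcases Nat.le_one_iff_eq_zero_or_eq_one.1 hd with rfl | rfl
      · simp only [mhDiv, Finset.univ_eq_empty, Finset.sum_empty] at h1 ⊢
        exact_mod_cast h1
      · simp only [mhDiv, Finset.univ_unique, Finset.sum_singleton] at h1 ⊢
        have h2 : φ (default : Fin 1) y = φ (default : Fin 1) (-mhE (default : Fin 1) +ᵥ y) + f y := by
          linarith
        rw [h2, Int.floor_add_intCast]; ring
  · obtain ⟨N, Z, hZ, hu1, hu2, hcov⟩ := mh_toast ν hmp hfree s hs hinj
    obtain ⟨θ, h1, h2, h3, h4⟩ := mh_theta (fun v => (hmp v).measurable) φ hφm K hφK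
      (fun y => ⟨f y, (hdiv y).symm⟩) ⟨0, by omega⟩ ⟨1, by omega⟩ (by simp) N Z hZ hu1
    exact mh_assemble ν hmp θ h1 (K + 2 * d) (by push_cast; exact h2) f hf
      (fun y => (h3 y).trans (hdiv y)) N Z hZ hu2 hcov h4

/-- the largest invariant subset of `S` is measurable and conull if `S` is. -/
theorem mh_inv_core {G X : Type*} [AddGroup G] [Countable G] [AddAction G X] [MeasurableSpace X]
    (μ : Measure X) (hmp : ∀ g : G, MeasurePreserving (fun x : X => g +ᵥ x) μ μ)
    (p : X → Prop) (hp : ∀ᵐ x ∂μ, p x) :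
    ∃ W : Set X, MeasurableSet W ∧ μ Wᶜ = 0 ∧ (∀ (g : G) (x : X), g +ᵥ x ∈ W ↔ x ∈ W) ∧
      ∀ x ∈ W, p x := by
  obtain ⟨t, ht, htm, ht0⟩ := exists_measurable_superset_of_null (ae_iff.1 hp)
  refine ⟨⋂ g : G, (fun x => g +ᵥ x) ⁻¹' tᶜ, MeasurableSet.iInter fun g =>
    (hmp g).measurable htm.compl, ?_, ?_, ?_⟩
  · rw [Set.compl_iInter]
    refine measure_iUnion_null fun g => ?_
    rw [← Set.preimage_compl, compl_compl, (hmp g).measure_preimage htm.nullMeasurableSet, ht0]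
  · intro g x
    simp only [Set.mem_iInter, Set.mem_preimage]
    constructor
    · intro h k
      have := h (k - g)
      rwa [vadd_vadd, sub_add_cancel] at this
    · intro h k
      rw [vadd_vadd]
      exact h (k + g)
  · intro x hx
    by_contra hc
    have h0 := Set.mem_iInter.1 hx 0
    simp only [Set.mem_preimage, zero_vadd] at h0
    exact h0 (ht hc)

theorem mh_flow {d : ℕ} {Y : Type*} [MeasurableSpace Y] [AddAction (Fin d → ℤ) Y]
    (ν : Measure Y) [IsProbabilityMeasure ν]
    (hmp : ∀ v : Fin d → ℤ, MeasurePreserving (fun y : Y => v +ᵥ y) ν ν)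
    (hfree : ∀ v : Fin d → ℤ, v ≠ 0 → ∀ y : Y, v +ᵥ y ≠ y)
    (s : Y → ℝ) (hs : Measurable s) (hinj : Function.Injective s)
    (f : Y → ℤ) (hf : Measurable f)
    (ψ₀ : Fin d → Y → ℤ) (K : ℕ) (hK : ∀ i y, |ψ₀ i y| ≤ K) (hdiv : ∀ y, mhDiv ψ₀ y = f y) :
    ∃ ψ : Fin d → Y → ℤ, (∀ i, Measurable (ψ i)) ∧ (∃ K' : ℕ, ∀ i y, |ψ i y| ≤ K') ∧
      ∀ᵐ y ∂ν, mhDiv ψ y = f y := by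
  classical
  have hm := fun v => (hmp v).measurable
  obtain ⟨φ, hφm, hφK, hφ⟩ := mh_real_flow ν hmp (fun y => (f y : ℝ)) K (by
    intro ε hε
    obtain ⟨n, hn⟩ := exists_nat_gt (2 * (d : ℝ) * K / ε)
    have h0 : 0 ≤ 2 * (d : ℝ) * K / ε := by positivity
    have hn0 : (0 : ℝ) < n := lt_of_le_of_lt h0 hn
    obtain ⟨φ, h1, h2, h3⟩ := mh_real_approx hm f hf ψ₀ K hK hdiv n (by exact_mod_cast hn0)
    refine ⟨φ, h1, h2, fun y => (h3 y).trans ?_⟩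
    rw [div_lt_iff₀ hε] at hn
    rw [div_le_iff₀ hn0]
    linarith)
  obtain ⟨W, hWm, hW0, hWi, hW⟩ := mh_inv_core ν hmp _ hφ
  obtain ⟨ψ, h1, h2, h3⟩ := mh_round ν hmp hfree s hs hinj (fun i => W.indicator (φ i))
    (fun i => (hφm i).indicator hWm) K (by
      intro i y
      by_cases hy : y ∈ W
      · rw [Set.indicator_of_mem hy]; exact hφK i y
      · rw [Set.indicator_of_notMem hy]; simp)
    (W.indicator f) (hf.indicator hWm) (by
      intro y
      simp only [mhDiv]
      by_cases hy : y ∈ W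
      · rw [Set.indicator_of_mem hy, ← hW y hy]
        simp only [mhDiv]
        refine Finset.sum_congr rfl fun i _ => ?_
        rw [Set.indicator_of_mem hy, Set.indicator_of_mem ((hWi _ _).2 hy)]
      · rw [Set.indicator_of_notMem hy]
        simp only [Int.cast_zero]
        refine Finset.sum_eq_zero fun i _ => ?_
        rw [Set.indicator_of_notMem hy, Set.indicator_of_notMem (fun h => hy ((hWi _ _).1 h)), sub_self])
  refine ⟨ψ, h1, h2, ?_⟩
  have hae : ∀ᵐ y ∂ν, y ∈ W := hW0
  filter_upwards [h3, hae] with y hy hyW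
  rw [hy, Set.indicator_of_mem hyW]

/-- every translation coboundary of a bounded integer function is the divergence of a bounded
integer flow. -/
theorem mh_cobound {d : ℕ} {Y : Type*} [AddAction (Fin d → ℤ) Y] (γ : Fin d → ℤ) :
    ∀ (u : Y → ℤ) (K : ℕ), (∀ y, |u y| ≤ K) → ∃ (ψ : Fin d → Y → ℤ) (K' : ℕ),
      (∀ i y, |ψ i y| ≤ K') ∧ ∀ y, mhDiv ψ y = u y - u (-γ +ᵥ y) := by
  classical
  let H : AddSubgroup (Fin d → ℤ) :=
    { carrier := {γ | ∀ (u : Y → ℤ) (K : ℕ), (∀ y, |u y| ≤ K) → ∃ (ψ : Fin d → Y → ℤ) (K' : ℕ),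
        (∀ i y, |ψ i y| ≤ K') ∧ ∀ y, mhDiv ψ y = u y - u (-γ +ᵥ y)}
      zero_mem' := by
        intro u K _
        exact ⟨0, 0, by simp, by simp [mhDiv]⟩
      add_mem' := by
        intro a b ha hb u K hu
        obtain ⟨ψ1, K1, h1, e1⟩ := ha u K hu
        obtain ⟨ψ2, K2, h2, e2⟩ := hb (fun y => u (-a +ᵥ y)) K (fun y => hu _)
        refine ⟨fun i y => ψ1 i y + ψ2 i y, K1 + K2, fun i y => ?_, fun y => ?_⟩
        · push_cast
          exact (abs_add_le _ _).trans (add_le_add (h1 i y) (h2 i y))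
        · have : mhDiv (fun i y => ψ1 i y + ψ2 i y) y = mhDiv ψ1 y + mhDiv ψ2 y := by
            simp only [mhDiv, ← Finset.sum_add_distrib]
            exact Finset.sum_congr rfl fun i _ => by ring
          rw [this, e1, e2, vadd_vadd, neg_add]
          ring
      neg_mem' := by
        intro a ha u K hu
        obtain ⟨ψ1, K1, h1, e1⟩ := ha (fun y => -u (a +ᵥ y)) K (fun y => by rw [abs_neg]; exact hu _)
        refine ⟨ψ1, K1, h1, fun y => ?_⟩
        rw [e1, vadd_neg_vadd, neg_neg]; ring }
  suffices h : γ ∈ H from h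
  have he : ∀ i, mhE i ∈ H := by
    intro i u K hu
    refine ⟨fun j y => if j = i then u y else 0, K, fun j y => ?_, fun y => ?_⟩
    · dsimp only
      split_ifs
      · exact hu y
      · simp
    · simp only [mhDiv]
      rw [Finset.sum_eq_single i]
      · simp
      · intro j _ hj; simp [hj]
      · simp
  have : γ = ∑ i, γ i • mhE i := by
    ext j
    simp [mhE, Finset.sum_apply, Pi.single_apply]
  rw [this]
  exact H.sum_mem fun i _ => H.zsmul_mem (he i) _

theorem mh_hall_inj {G X : Type*} [AddGroup G] [AddAction G X] (A B : Set X) (F : Finset G)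
    (h : ∀ x ∈ A, ∀ S : Finset X, ↑S ⊆ A ∩ AddAction.orbit G x →
      S.card ≤ (((F : Set G) +ᵥ (S : Set X)) ∩ B).ncard) :
    ∃ f : A → B, Function.Injective f ∧ ∀ x : A, ∃ g ∈ F, (f x : X) = g +ᵥ (x : X) := by
  classical
  let t : A → Finset X := fun x => (F.image (fun g => g +ᵥ (x : X))).filter (· ∈ B)
  have ht : ∀ (x : A) (z : X), z ∈ t x ↔ (∃ g ∈ F, g +ᵥ (x : X) = z) ∧ z ∈ B := by
    intro x z; simp [t]
  let o : X → Quotient (AddAction.orbitRel G X) := fun x => Quotient.mk _ x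
  have ho : ∀ (g : G) (x : X), o (g +ᵥ x) = o x := fun g x =>
    Quotient.sound (AddAction.orbitRel_apply.2 ⟨g, rfl⟩)
  have ho' : ∀ x z : X, o z = o x → z ∈ AddAction.orbit G x := fun x z hz =>
    AddAction.orbitRel_apply.1 (Quotient.exact hz)
  have key : ∀ s : Finset A, s.card ≤ (s.biUnion t).card := by
    intro s
    let I : Finset (Quotient (AddAction.orbitRel G X)) := s.image (fun x : A => o (x : X))
    rw [Finset.card_eq_sum_card_fiberwise (f := fun x : A => o (x : X)) (t := I) (s := s)
      (fun x hx => Finset.mem_image_of_mem _ hx)]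
    rw [Finset.card_eq_sum_card_fiberwise (f := o) (t := I) (s := s.biUnion t) (fun z hz => by
      obtain ⟨x, hx, hz⟩ := Finset.mem_biUnion.1 hz
      obtain ⟨⟨g, _, rfl⟩, _⟩ := (ht x z).1 hz
      rw [ho]
      exact Finset.mem_image_of_mem _ hx)]
    refine Finset.sum_le_sum fun q hq => ?_
    obtain ⟨x, hx, rfl⟩ := Finset.mem_image.1 hq
    have h1 := h x x.2 ((s.filter (fun a : A => o (a : X) = o (x : X))).map
      (Function.Embedding.subtype _)) (by
        intro z hz
        simp only [Finset.coe_map, Set.mem_image, Finset.mem_coe, Finset.mem_filter] at hz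
        obtain ⟨a, ⟨_, ha⟩, rfl⟩ := hz
        exact ⟨a.2, ho' _ _ ha⟩)
    rw [Finset.card_map] at h1
    refine h1.trans ?_
    rw [← Set.ncard_coe_finset]
    refine Set.ncard_le_ncard ?_ (Finset.finite_toSet _)
    rintro z ⟨⟨g, hg, y, hy, rfl⟩, hzB⟩
    simp only [Finset.coe_map, Set.mem_image, Finset.mem_coe, Finset.mem_filter] at hy
    obtain ⟨a, ⟨has, ha⟩, rfl⟩ := hy
    simp only [Finset.mem_coe, Finset.mem_filter, Finset.mem_biUnion]
    refine ⟨⟨a, has, (ht _ _).2 ⟨⟨g, hg, rfl⟩, hzB⟩⟩, ?_⟩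
    exact (ho _ _).trans ha
  obtain ⟨f, hf, hft⟩ := (Finset.all_card_le_biUnion_card_iff_exists_injective t).1 key
  refine ⟨fun x => ⟨f x, ((ht _ _).1 (hft x)).2⟩, fun x y hxy => hf (by simpa using hxy), fun x => ?_⟩
  obtain ⟨⟨g, hg, e⟩, _⟩ := (ht _ _).1 (hft x)
  exact ⟨g, hg, e.symm⟩

theorem mh_hall_bij {G X : Type*} [AddGroup G] [AddAction G X] (A B : Set X) (F : Finset G)
    (h1 : ∀ x ∈ A, ∀ S : Finset X, ↑S ⊆ A ∩ AddAction.orbit G x →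
      S.card ≤ (((F : Set G) +ᵥ (S : Set X)) ∩ B).ncard)
    (h2 : ∀ x ∈ B, ∀ S : Finset X, ↑S ⊆ B ∩ AddAction.orbit G x →
      S.card ≤ ((-(F : Set G) +ᵥ (S : Set X)) ∩ A).ncard) :
    ∃ h : X → X, Set.BijOn h A B ∧ ∀ x ∈ A, ∃ g ∈ F, h x = g +ᵥ x := by
  classical
  obtain ⟨f, hf, hfr⟩ := mh_hall_inj A B F h1
  obtain ⟨k, hk, hkr⟩ := mh_hall_inj B A (-F) (by simpa using h2)
  obtain ⟨e, he, her⟩ := Function.Embedding.schroeder_bernstein_of_rel hf hk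
    (fun a b => ∃ g ∈ F, (b : X) = g +ᵥ (a : X)) hfr (by
      intro b
      obtain ⟨g, hg, e⟩ := hkr b
      refine ⟨-g, by simpa using hg, ?_⟩
      rw [e, neg_vadd_vadd])
  refine ⟨fun x => if hx : x ∈ A then e ⟨x, hx⟩ else x, ⟨?_, ?_, ?_⟩, ?_⟩
  · intro x hx
    simp only [hx, dif_pos]
    exact (e ⟨x, hx⟩).2
  · intro x hx y hy hxy
    simp only [hx, hy, dif_pos] at hxy
    have := he.1 (Subtype.ext hxy)
    simpa using this
  · intro b hb
    obtain ⟨a, ha⟩ := he.2 ⟨b, hb⟩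
    refine ⟨a, a.2, ?_⟩
    simp [ha]
  · intro x hx
    simp only [hx, dif_pos]
    exact her ⟨x, hx⟩

theorem mh_flow_of_bij {d : ℕ} {Δ X Y : Type*} [AddCommGroup Δ] [AddAction ((Fin d → ℤ) × Δ) X]
    [AddAction (Fin d → ℤ) Y] (π : X → Y)
    (hπ : ∀ (g : (Fin d → ℤ) × Δ) (x : X), π (g +ᵥ x) = g.1 +ᵥ π x)
    (D : ℕ) (hfin : ∀ y, (π ⁻¹' {y}).Finite) (hD : ∀ y, (π ⁻¹' {y}).ncard ≤ D)
    (A B : Set X) (F : Finset ((Fin d → ℤ) × Δ)) (h : X → X) (hh : Set.BijOn h A B)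
    (hF : ∀ x ∈ A, ∃ g ∈ F, h x = g +ᵥ x) :
    ∃ (ψ : Fin d → Y → ℤ) (K : ℕ), (∀ i y, |ψ i y| ≤ K) ∧
      ∀ y, mhDiv ψ y = ((A ∩ π ⁻¹' {y}).ncard : ℤ) - ((B ∩ π ⁻¹' {y}).ncard : ℤ) := by
  classical
  let V : Finset (Fin d → ℤ) := F.image Prod.fst
  have hdisp : ∀ x : X, ∃ v : Fin d → ℤ, x ∈ A → v ∈ V ∧ π (h x) = v +ᵥ π x := by
    intro x
    by_cases hx : x ∈ A
    · obtain ⟨g, hg, e⟩ := hF x hx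
      exact ⟨g.1, fun _ => ⟨Finset.mem_image_of_mem _ hg, by rw [e, hπ]⟩⟩
    · exact ⟨0, fun h => absurd h hx⟩
  choose w hw using hdisp
  let u : (Fin d → ℤ) → Y → ℤ := fun v y => (({x ∈ A | π x = y ∧ w x = v} : Set X).ncard : ℤ)
  have hu : ∀ v y, |u v y| ≤ (D : ℤ) := by
    intro v y
    simp only [u, Nat.abs_cast]
    have h1 : ({x ∈ A | π x = y ∧ w x = v} : Set X) ⊆ π ⁻¹' {y} := fun x hx => hx.2.1
    exact_mod_cast (Set.ncard_le_ncard h1 (hfin y)).trans (hD y)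
  choose ψ K' hψK hψ using fun v => mh_cobound (Y := Y) v (u v) D (hu v)
  have hcount : ∀ (S : Set X), S.Finite → S ⊆ A →
      ((S.ncard : ℕ) : ℤ) = ∑ v ∈ V, (({x ∈ S | w x = v} : Set X).ncard : ℤ) := by
    intro S hS hSA
    have e1 : S.ncard = hS.toFinset.card := Set.ncard_eq_toFinset_card S hS
    rw [e1, Finset.card_eq_sum_card_fiberwise (f := w) (t := V) (fun x hx =>
      (hw x (hSA (by simpa using hx))).1)]
    push_cast
    refine Finset.sum_congr rfl fun v _ => ?_
    rw [← Set.ncard_coe_finset]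
    congr 2
    ext x; simp
  refine ⟨fun i y => ∑ v ∈ V, ψ v i y, ∑ v ∈ V, K' v, fun i y => ?_, fun y => ?_⟩
  · refine (Finset.abs_sum_le_sum_abs _ _).trans ?_
    push_cast
    exact Finset.sum_le_sum fun v _ => hψK v i y
  · have e1 : mhDiv (fun i y => ∑ v ∈ V, ψ v i y) y = ∑ v ∈ V, mhDiv (ψ v) y := by
      simp only [mhDiv]
      rw [Finset.sum_comm]
      refine Finset.sum_congr rfl fun i _ => ?_
      rw [← Finset.sum_sub_distrib]
    rw [e1, Finset.sum_congr rfl fun v _ => hψ v y, Finset.sum_sub_distrib]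
    congr 1
    · rw [hcount _ ((hfin y).subset Set.inter_subset_right) Set.inter_subset_left]
      refine Finset.sum_congr rfl fun v _ => ?_
      simp only [u]
      congr 2
      ext x; simp [and_assoc]
    · have e2 : B ∩ π ⁻¹' {y} = h '' {x ∈ A | π (h x) = y} := by
        ext z
        constructor
        · rintro ⟨hz, hy⟩
          obtain ⟨x, hx, rfl⟩ := hh.2.2 hz
          exact ⟨x, ⟨hx, hy⟩, rfl⟩
        · rintro ⟨x, ⟨hx, hy⟩, rfl⟩
          exact ⟨hh.1 hx, hy⟩
      have hinj : Set.InjOn h {x ∈ A | π (h x) = y} := hh.2.1.mono fun x hx => hx.1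
      have hfinS : ({x ∈ A | π (h x) = y} : Set X).Finite :=
        Set.Finite.of_finite_image (by rw [← e2]; exact (hfin y).subset Set.inter_subset_right) hinj
      rw [e2, hinj.ncard_image, hcount _ hfinS fun x hx => hx.1]
      refine Finset.sum_congr rfl fun v _ => ?_
      simp only [u]
      congr 2
      ext x
      simp only [Set.mem_ofPred_eq]
      constructor
      · rintro ⟨hx, hy, rfl⟩
        refine ⟨⟨hx, ?_⟩, rfl⟩
        rw [(hw x hx).2, hy, vadd_neg_vadd]
      · rintro ⟨⟨hx, hy⟩, rfl⟩
        refine ⟨hx, ?_, rfl⟩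
        rw [← hy, (hw x hx).2, neg_vadd_vadd]

theorem mh_meas_forall {ι X : Type*} [Countable ι] [MeasurableSpace X] {p : ι → X → Prop}
    (h : ∀ i, MeasurableSet {x | p i x}) : MeasurableSet {x | ∀ i, p i x} := by
  have e : {x | ∀ i, p i x} = ⋂ i, {x | p i x} := by ext x; simp
  rw [e]; exact MeasurableSet.iInter h

theorem mh_meas_exists {ι X : Type*} [Countable ι] [MeasurableSpace X] {p : ι → X → Prop}
    (h : ∀ i, MeasurableSet {x | p i x}) : MeasurableSet {x | ∃ i, p i x} := by
  have e : {x | ∃ i, p i x} = ⋃ i, {x | p i x} := by ext x; simp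
  rw [e]; exact MeasurableSet.iUnion h

/-- A measurable choice of bijections, one for each base point. -/
theorem mh_codes {G X R : Type*} [AddGroup G] [Countable G] [Countable R] [Nonempty R]
    [AddAction G X] [MeasurableSpace X] (hm : ∀ g : G, Measurable (fun x : X => g +ᵥ x))
    (hfree : ∀ g : G, g ≠ 0 → ∀ x : X, g +ᵥ x ≠ x)
    (g₀ : X → G) (hg₀ : ∀ g, MeasurableSet {p | g₀ p = g})
    (A : Set X) (hA : MeasurableSet A) (E : R → Set X) (hE : ∀ r, MeasurableSet (E r))
    (hAf : ∀ p₀, {p | p ∈ A ∧ g₀ p +ᵥ p = p₀}.Finite) (hEf : ∀ p₀, {r | p₀ ∈ E r}.Finite)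
    (hcard : ∀ p₀, {p | p ∈ A ∧ g₀ p +ᵥ p = p₀}.ncard = {r | p₀ ∈ E r}.ncard) :
    ∃ c : X → R, (∀ r, MeasurableSet {p | c p = r}) ∧
      ∀ p₀, Set.BijOn c {p | p ∈ A ∧ g₀ p +ᵥ p = p₀} {r | p₀ ∈ E r} := by
  classical
  let Q : Finset (G × R) → Set X := fun κ => {p₀ |
    (∀ g, (g +ᵥ p₀ ∈ A ∧ g₀ (g +ᵥ p₀) = -g) ↔ ∃ r, (g, r) ∈ κ) ∧
    (∀ r, p₀ ∈ E r ↔ ∃ g, (g, r) ∈ κ) ∧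
    (∀ g r r', (g, r) ∈ κ → (g, r') ∈ κ → r = r') ∧
    (∀ g g' r, (g, r) ∈ κ → (g', r) ∈ κ → g = g')}
  have hiff : ∀ {p : X → Prop} {q : Prop}, MeasurableSet {x | p x} → MeasurableSet {x | p x ↔ q} := by
    intro p q hp
    by_cases hq : q
    · simpa [hq] using hp
    · simp only [hq, iff_false]; exact hp.compl
  have hQm : ∀ κ, MeasurableSet (Q κ) := by
    intro κ
    refine MeasurableSet.inter ?_ (MeasurableSet.inter ?_ (MeasurableSet.const _))
    · exact mh_meas_forall fun g => hiff ((hm g hA).inter (hm g (hg₀ (-g))))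
    · exact mh_meas_forall fun r => hiff (hE r)
  have hact : ∀ (g g' : G) (x : X), g +ᵥ x = g' +ᵥ x → g = g' := by
    intro g g' x h
    by_contra hne
    refine hfree (-g' + g) (fun h0 => hne ?_) x ?_
    · rw [neg_add_eq_zero] at h0; exact h0.symm
    · rw [← vadd_vadd, h, neg_vadd_vadd]
  have hbase : ∀ (g : G) (p₀ : X), g₀ (g +ᵥ p₀) +ᵥ (g +ᵥ p₀) = p₀ ↔ g₀ (g +ᵥ p₀) = -g := by
    intro g p₀
    constructor
    · intro h
      rw [vadd_vadd] at h
      have := hact _ 0 p₀ (by rw [h, zero_vadd])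
      exact eq_neg_of_add_eq_zero_left this
    · intro h; rw [h, neg_vadd_vadd]
  have hQe : ∀ p₀, ∃ κ, p₀ ∈ Q κ := by
    intro p₀
    have h1 := hcard p₀
    rw [Set.ncard_eq_toFinset_card _ (hAf p₀), Set.ncard_eq_toFinset_card _ (hEf p₀)] at h1
    let e := Finset.equivOfCardEq h1
    have hmem : ∀ p, p ∈ (hAf p₀).toFinset ↔ p ∈ A ∧ g₀ p +ᵥ p = p₀ := by intro p; simp
    have hmem2 : ∀ r, r ∈ (hEf p₀).toFinset ↔ p₀ ∈ E r := by intro r; simp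
    let κ : Finset (G × R) := Finset.univ.image
      (fun p : (hAf p₀).toFinset => (-(g₀ (p : X)), ((e p : R))))
    have hκ : ∀ g r, (g, r) ∈ κ ↔ ∃ p : (hAf p₀).toFinset, -(g₀ (p : X)) = g ∧ (e p : R) = r := by
      intro g r; simp [κ]
    have hpos : ∀ p : (hAf p₀).toFinset, (p : X) = -(g₀ (p : X)) +ᵥ p₀ := by
      intro p
      rw [eq_comm, neg_vadd_eq_iff]
      exact ((hmem p).1 p.2).2.symm
    refine ⟨κ, ?_, ?_, ?_, ?_⟩
    · intro g
      constructor
      · rintro ⟨h2, h3⟩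
        refine ⟨e ⟨g +ᵥ p₀, (hmem _).2 ⟨h2, (hbase _ _).2 h3⟩⟩, (hκ _ _).2 ⟨⟨g +ᵥ p₀, _⟩, ?_, rfl⟩⟩
        simp only [h3, neg_neg]
      · rintro ⟨r, hr⟩
        obtain ⟨p, rfl, _⟩ := (hκ _ _).1 hr
        rw [← hpos p, neg_neg]
        exact ⟨((hmem p).1 p.2).1, rfl⟩
    · intro r
      constructor
      · intro h2
        refine ⟨_, (hκ _ _).2 ⟨e.symm ⟨r, (hmem2 r).2 h2⟩, rfl, ?_⟩⟩
        rw [Equiv.apply_symm_apply]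
      · rintro ⟨g, hr⟩
        obtain ⟨p, _, rfl⟩ := (hκ _ _).1 hr
        exact (hmem2 _).1 (e p).2
    · intro g r r' h2 h3
      obtain ⟨p, h4, rfl⟩ := (hκ _ _).1 h2
      obtain ⟨p', h5, rfl⟩ := (hκ _ _).1 h3
      have : p = p' := Subtype.ext (by rw [hpos p, hpos p', h4, h5])
      rw [this]
    · intro g g' r h2 h3
      obtain ⟨p, rfl, h4⟩ := (hκ _ _).1 h2
      obtain ⟨p', rfl, h5⟩ := (hκ _ _).1 h3
      have : p = p' := e.injective (Subtype.ext (h4.trans h5.symm))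
      rw [this]
  obtain ⟨κ, hκm, hκ⟩ := mh_exists_choice Q hQm hQe
  obtain ⟨c, hcm, hc⟩ := mh_exists_choice (Y := X) (fun r : R => {p | p ∈ A → (-(g₀ p), r) ∈ κ (g₀ p +ᵥ p)})
    (by
      intro r
      have : MeasurableSet (Aᶜ ∪ ⋃ (g : G) (k : Finset (G × R)) (_ : (-g, r) ∈ k),
          ({p : X | g₀ p = g} ∩ (fun p => g +ᵥ p) ⁻¹' {p | κ p = k})) :=
        hA.compl.union (MeasurableSet.iUnion fun g => MeasurableSet.iUnion fun k =>
          MeasurableSet.iUnion fun _ => (hg₀ g).inter (hm g (hκm k)))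
      convert this using 1
      ext p
      simp only [Set.mem_ofPred_eq, Set.mem_union, Set.mem_compl_iff, Set.mem_iUnion, Set.mem_inter_iff,
        Set.mem_preimage, imp_iff_not_or]
      refine or_congr Iff.rfl ⟨fun h => ⟨g₀ p, _, h, rfl, rfl⟩, ?_⟩
      rintro ⟨g, k, h, rfl, rfl⟩
      exact h)
    (by
      intro p
      by_cases hp : p ∈ A
      · have h1 := ((hκ (g₀ p +ᵥ p)).1 (-(g₀ p))).1 (by
          rw [neg_vadd_vadd, neg_neg]; exact ⟨hp, rfl⟩)
        obtain ⟨r, hr⟩ := h1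
        exact ⟨r, fun _ => hr⟩
      · exact ⟨Classical.arbitrary R, fun h => absurd h hp⟩)
  refine ⟨c, hcm, fun p₀ => ⟨?_, ?_, ?_⟩⟩
  · rintro p ⟨hp, rfl⟩
    exact ((hκ _).2.1 _).2 ⟨_, hc p hp⟩
  · rintro p ⟨hp, hp0⟩ p' ⟨hp', hp0'⟩ h
    have h1 := hc p hp
    have h2 := hc p' hp'
    rw [hp0] at h1
    rw [hp0', ← h] at h2
    have h3 := (hκ p₀).2.2.2 _ _ _ h1 h2
    have h4 : p = -(g₀ p) +ᵥ p₀ := by conv_rhs => rw [← hp0, neg_vadd_vadd]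
    have h5 : p' = -(g₀ p') +ᵥ p₀ := by conv_rhs => rw [← hp0', neg_vadd_vadd]
    rw [h4, h5, h3]
  · intro r hr
    obtain ⟨g, hg⟩ := ((hκ p₀).2.1 r).1 hr
    obtain ⟨h1, h2⟩ := ((hκ p₀).1 g).2 ⟨r, hg⟩
    have h3 := (hbase g p₀).2 h2
    refine ⟨g +ᵥ p₀, ⟨h1, h3⟩, ?_⟩
    have h4 := hc _ h1
    rw [h3, h2, neg_neg] at h4
    exact (hκ p₀).2.2.1 _ _ _ h4 hg

theorem mh_fiber_finite {d : ℕ} {Δ X Y : Type*} [AddCommGroup Δ] [Fintype Δ]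
    [AddAction ((Fin d → ℤ) × Δ) X] (π : X → Y)
    (hfib : ∀ p q, π p = π q → ∃ δ : Δ, q = ((0 : Fin d → ℤ), δ) +ᵥ p) (y : Y) :
    (π ⁻¹' {y}).Finite ∧ (π ⁻¹' {y}).ncard ≤ Fintype.card Δ := by
  classical
  by_cases h : (π ⁻¹' {y}).Nonempty
  · obtain ⟨p, hp⟩ := h
    have h1 : π ⁻¹' {y} ⊆ ↑(Finset.univ.image (fun δ : Δ => ((0 : Fin d → ℤ), δ) +ᵥ p)) := by
      intro q hq
      obtain ⟨δ, hδ⟩ := hfib p q (hp.trans hq.symm)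
      simp only [Finset.coe_image, Finset.coe_univ, Set.image_univ, Set.mem_range]
      exact ⟨δ, hδ.symm⟩
    refine ⟨(Finset.finite_toSet _).subset h1, ?_⟩
    refine (Set.ncard_le_ncard h1 (Finset.finite_toSet _)).trans ?_
    rw [Set.ncard_coe_finset]
    exact Finset.card_image_le
  · rw [Set.not_nonempty_iff_eq_empty] at h
    rw [h]; simp

theorem mh_token_card {V J : Type*} [Fintype J] (L : Finset V) (m : V → J → ℕ) :
    {r : V × J × ℕ | r.1 ∈ L ∧ r.2.2 < m r.1 r.2.1}.Finite ∧
    {r : V × J × ℕ | r.1 ∈ L ∧ r.2.2 < m r.1 r.2.1}.ncard = ∑ x ∈ L, ∑ j, m x j := by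
  classical
  let T : Finset (Σ _ : V × J, ℕ) := (L ×ˢ Finset.univ).sigma (fun q => Finset.range (m q.1 q.2))
  let e : (Σ _ : V × J, ℕ) → V × J × ℕ := fun q => (q.1.1, q.1.2, q.2)
  have he : Function.Injective e := by
    rintro ⟨⟨a, b⟩, c⟩ ⟨⟨a', b'⟩, c'⟩ h
    simp only [e, Prod.mk.injEq] at h
    obtain ⟨rfl, rfl, rfl⟩ := h
    rfl
  have h1 : {r : V × J × ℕ | r.1 ∈ L ∧ r.2.2 < m r.1 r.2.1} = ↑(T.image e) := by
    ext ⟨a, b, c⟩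
    simp only [Set.mem_ofPred_eq, Finset.coe_image, Set.mem_image, Finset.mem_coe]
    constructor
    · rintro ⟨h1, h2⟩
      exact ⟨⟨(a, b), c⟩, by simp [T, h1, h2], rfl⟩
    · rintro ⟨⟨⟨a', b'⟩, c'⟩, h, h'⟩
      simp only [e, Prod.mk.injEq] at h'
      obtain ⟨rfl, rfl, rfl⟩ := h'
      simpa [T] using h
  rw [h1]
  refine ⟨Finset.finite_toSet _, ?_⟩
  rw [Set.ncard_coe_finset, Finset.card_image_of_injective _ he, Finset.card_sigma,
    Finset.sum_product]
  simp

/-- The (negated) cell of base point `z`, for the tiling sending `y` to `t y +ᵥ y`. -/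
noncomputable def mhCell {d : ℕ} {Y : Type*} [AddAction (Fin d → ℤ) Y] (t : Y → (Fin d → ℤ))
    (L : Finset (Fin d → ℤ)) (z : Y) : Finset (Fin d → ℤ) := by
  classical exact L.filter (fun x : Fin d → ℤ => t (-x +ᵥ z) = x)

theorem mem_mhCell {d : ℕ} {Y : Type*} [AddAction (Fin d → ℤ) Y] (t : Y → (Fin d → ℤ))
    (L : Finset (Fin d → ℤ)) (hL : ∀ y, t y ∈ L) (z : Y) (x : Fin d → ℤ) :
    x ∈ mhCell t L z ↔ t (-x +ᵥ z) = x := by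
  simp only [mhCell, Finset.mem_filter]
  exact ⟨fun h => h.2, fun h => ⟨h ▸ hL _, h⟩⟩

theorem mh_tokens {d : ℕ} {Δ X Y J : Type*} [AddCommGroup Δ] [Fintype Δ] [Fintype J] [Nonempty J]
    [MeasurableSpace X] [MeasurableSpace Y]
    [AddAction ((Fin d → ℤ) × Δ) X] [AddAction (Fin d → ℤ) Y]
    (hm : ∀ g : (Fin d → ℤ) × Δ, Measurable (fun x : X => g +ᵥ x))
    (hmY : ∀ v : Fin d → ℤ, Measurable (fun y : Y => v +ᵥ y))
    (hfree : ∀ g : (Fin d → ℤ) × Δ, g ≠ 0 → ∀ x : X, g +ᵥ x ≠ x)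
    (π : X → Y) (hπm : Measurable π) (hπs : Function.Surjective π)
    (hπ : ∀ (g : (Fin d → ℤ) × Δ) (x : X), π (g +ᵥ x) = g.1 +ᵥ π x)
    (hfib : ∀ p q, π p = π q → ∃ δ : Δ, q = ((0 : Fin d → ℤ), δ) +ᵥ p)
    (s : X → ℝ) (hs : Measurable s) (hinj : Function.Injective s)
    (t : Y → (Fin d → ℤ)) (ht : ∀ v, MeasurableSet {y | t y = v})
    (L : Finset (Fin d → ℤ)) (hL : ∀ y, t y ∈ L)
    (o : Y → J → ℕ) (ho : ∀ j, Measurable (fun y => o y j))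
    (A : Set X) (hA : MeasurableSet A)
    (hsum : ∀ z : Y, ∑ x ∈ mhCell t L z, (A ∩ π ⁻¹' {-x +ᵥ z}).ncard =
      ∑ x ∈ mhCell t L z, ∑ j, o (-x +ᵥ z) j) :
    ∃ u : X → (Fin d → ℤ) × J × ℕ, (∀ r, MeasurableSet {p | u p = r}) ∧
      (∃ U : Finset (Fin d → ℤ), ∀ p ∈ A, (u p).1 ∈ U) ∧
      Set.BijOn (fun p => ((u p).1 +ᵥ π p, (u p).2)) A
        {q : Y × J × ℕ | q.2.2 < o q.1 q.2.1} := by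
  classical
  let D : Set X := {p | ∀ δ : Δ, s p ≤ s (((0 : Fin d → ℤ), δ) +ᵥ p)}
  have hD : MeasurableSet D := mh_meas_forall fun δ => measurableSet_le hs (hs.comp (hm _))
  have hDu : ∀ p ∈ D, ∀ q ∈ D, π p = π q → p = q := by
    intro p hp q hq h
    obtain ⟨δ, hδ⟩ := hfib p q h
    obtain ⟨δ', hδ'⟩ := hfib q p h.symm
    refine hinj (le_antisymm ?_ ?_)
    · rw [hδ]; exact hp δ
    · rw [hδ']; exact hq δ'
  obtain ⟨dd, hddm, hdd⟩ := mh_exists_choice (Y := X)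
    (fun δ : Δ => {p | ((0 : Fin d → ℤ), δ) +ᵥ p ∈ D}) (fun δ => hm _ hD) (by
      intro p
      obtain ⟨δ, _, hδ⟩ := Finset.exists_min_image (Finset.univ : Finset Δ)
        (fun δ => s (((0 : Fin d → ℤ), δ) +ᵥ p)) Finset.univ_nonempty
      refine ⟨δ, fun δ' => ?_⟩
      rw [vadd_vadd]
      have := hδ (δ' + δ) (Finset.mem_univ _)
      simpa using this)
  let g₀ : X → (Fin d → ℤ) × Δ := fun p => (t (π p), dd ((t (π p), (0 : Δ)) +ᵥ p))
  have hg₀ : ∀ g, MeasurableSet {p | g₀ p = g} := by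
    intro g
    have : {p | g₀ p = g} = π ⁻¹' {y | t y = g.1} ∩
        (fun p : X => (g.1, (0 : Δ)) +ᵥ p) ⁻¹' {p | dd p = g.2} := by
      ext p
      simp only [g₀, Set.mem_ofPred_eq, Prod.ext_iff, Set.mem_inter_iff, Set.mem_preimage]
      constructor
      · rintro ⟨h1, h2⟩; refine ⟨h1, ?_⟩; rw [← h1]; exact h2
      · rintro ⟨h1, h2⟩; refine ⟨h1, ?_⟩; rw [h1]; exact h2
    rw [this]
    exact (hπm (ht _)).inter (hm _ (hddm _))
  have hbD : ∀ p, g₀ p +ᵥ p ∈ D := by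
    intro p
    have h1 := hdd ((t (π p), (0 : Δ)) +ᵥ p)
    have h2 : g₀ p +ᵥ p = ((0 : Fin d → ℤ), dd ((t (π p), (0 : Δ)) +ᵥ p)) +ᵥ
        ((t (π p), (0 : Δ)) +ᵥ p) := by
      rw [vadd_vadd]; simp [g₀]
    rw [h2]; exact h1
  have hπb : ∀ p, π (g₀ p +ᵥ p) = t (π p) +ᵥ π p := fun p => hπ _ _
  have hfin := fun y => (mh_fiber_finite π hfib y).1
  let E : (Fin d → ℤ) × J × ℕ → Set X := fun r =>
    {p₀ | p₀ ∈ D ∧ t (-r.1 +ᵥ π p₀) = r.1 ∧ r.2.2 < o (-r.1 +ᵥ π p₀) r.2.1}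
  have hE : ∀ r, MeasurableSet (E r) := by
    intro r
    have h1 : Measurable (fun p₀ : X => -r.1 +ᵥ π p₀) := (hmY _).comp hπm
    exact hD.inter ((h1 (ht r.1)).inter (measurableSet_lt measurable_const ((ho r.2.1).comp h1)))
  have hC := mem_mhCell t L hL
  have hAset : ∀ p₀ ∈ D, {p | p ∈ A ∧ g₀ p +ᵥ p = p₀} =
      ↑((mhCell t L (π p₀)).biUnion fun x => ((hfin (-x +ᵥ π p₀)).subset
        (Set.inter_subset_right : A ∩ π ⁻¹' {-x +ᵥ π p₀} ⊆ _)).toFinset) := by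
    intro p₀ hp₀
    ext p
    simp only [Set.mem_ofPred_eq, Finset.coe_biUnion, Set.mem_iUnion, Finset.mem_coe, hC,
      Set.Finite.coe_toFinset, Set.mem_inter_iff, Set.mem_preimage, Set.mem_singleton_iff,
      exists_prop]
    constructor
    · rintro ⟨h1, rfl⟩
      have h2 : -t (π p) +ᵥ π (g₀ p +ᵥ p) = π p := by rw [hπb, neg_vadd_vadd]
      exact ⟨t (π p), by rw [h2], h1, h2.symm⟩
    · rintro ⟨x, h1, h2, h3⟩
      refine ⟨h2, hDu _ (hbD p) _ hp₀ ?_⟩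
      rw [hπb, h3, h1, vadd_neg_vadd]
  have hEset : ∀ p₀ ∈ D, {r | p₀ ∈ E r} = {r : (Fin d → ℤ) × J × ℕ | r.1 ∈ mhCell t L (π p₀) ∧
      r.2.2 < (fun (x : Fin d → ℤ) (j : J) => o (-x +ᵥ π p₀) j) r.1 r.2.1} := by
    intro p₀ hp₀
    ext r
    simp only [Set.mem_ofPred_eq, hC, E, hp₀, true_and]
  have hA0 : ∀ p₀ ∉ D, {p | p ∈ A ∧ g₀ p +ᵥ p = p₀} = ∅ := by
    intro p₀ hp₀
    ext p
    simp only [Set.mem_ofPred_eq, Set.mem_empty_iff_false, iff_false, not_and]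
    rintro _ rfl
    exact hp₀ (hbD p)
  have hE0 : ∀ p₀ ∉ D, {r | p₀ ∈ E r} = ∅ := by
    intro p₀ hp₀
    ext r
    simp [E, hp₀]
  obtain ⟨c, hcm, hc⟩ := mh_codes hm hfree g₀ hg₀ A hA E hE
    (by
      intro p₀
      by_cases hp₀ : p₀ ∈ D
      · rw [hAset p₀ hp₀]; exact Finset.finite_toSet _
      · rw [hA0 p₀ hp₀]; exact Set.finite_empty)
    (by
      intro p₀
      by_cases hp₀ : p₀ ∈ D
      · rw [hEset p₀ hp₀]; exact (mh_token_card (mhCell t L (π p₀)) (fun x j => o (-x +ᵥ π p₀) j)).1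
      · rw [hE0 p₀ hp₀]; exact Set.finite_empty)
    (by
      intro p₀
      by_cases hp₀ : p₀ ∈ D
      · rw [hAset p₀ hp₀, hEset p₀ hp₀, (mh_token_card (mhCell t L (π p₀)) (fun x j => o (-x +ᵥ π p₀) j)).2, Set.ncard_coe_finset,
          Finset.card_biUnion]
        · have h1 := hsum (π p₀)
          refine Eq.trans (Finset.sum_congr rfl fun x _ => ?_) h1
          exact (Set.ncard_eq_toFinset_card _ _).symm
        · intro x hx x' hx' hne
          rw [Function.onFun, Finset.disjoint_left]
          intro p h1 h2
          simp only [Set.Finite.mem_toFinset, Set.mem_inter_iff, Set.mem_preimage,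
            Set.mem_singleton_iff] at h1 h2
          apply hne
          rw [← (hC _ _).1 hx, ← (hC _ _).1 hx', ← h1.2, ← h2.2]
      · rw [hA0 p₀ hp₀, hE0 p₀ hp₀]; simp)
  refine ⟨fun p => (-(c p).1 + t (π p), (c p).2), ?_, ⟨-L + L, ?_⟩, ?_, ?_, ?_⟩
  · intro r
    have : {p : X | (-(c p).1 + t (π p), (c p).2) = r} =
        ⋃ (q : (Fin d → ℤ) × J × ℕ) (v : Fin d → ℤ) (_ : (-q.1 + v, q.2) = r),
          ({p | c p = q} ∩ π ⁻¹' {y | t y = v}) := by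
      ext p
      simp only [Set.mem_ofPred_eq, Set.mem_iUnion, Set.mem_inter_iff, Set.mem_preimage]
      constructor
      · intro h; exact ⟨_, _, h, rfl, rfl⟩
      · rintro ⟨q, v, h, rfl, rfl⟩; exact h
    rw [this]
    exact MeasurableSet.iUnion fun q => MeasurableSet.iUnion fun v => MeasurableSet.iUnion fun _ =>
      (hcm q).inter (hπm (ht v))
  · intro p hp
    have h1 : g₀ p +ᵥ p ∈ E (c p) := (hc (g₀ p +ᵥ p)).1 ⟨hp, rfl⟩
    exact Finset.add_mem_add (Finset.neg_mem_neg (h1.2.1 ▸ hL _)) (hL _)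
  · intro p hp
    have h1 : g₀ p +ᵥ p ∈ E (c p) := (hc (g₀ p +ᵥ p)).1 ⟨hp, rfl⟩
    have h2 := h1.2.2
    rw [hπb, vadd_vadd] at h2
    exact h2
  · intro p hp p' hp' h
    have h1 : g₀ p +ᵥ p ∈ E (c p) := (hc (g₀ p +ᵥ p)).1 ⟨hp, rfl⟩
    have h1' : g₀ p' +ᵥ p' ∈ E (c p') := (hc (g₀ p' +ᵥ p')).1 ⟨hp', rfl⟩
    simp only [Prod.mk.injEq] at h
    obtain ⟨h2, h3⟩ := h
    rw [← vadd_vadd, ← vadd_vadd, ← hπb, ← hπb] at h2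
    have h4 : (c p).1 = (c p').1 := by rw [← h1.2.1, ← h1'.2.1, h2]
    rw [h4] at h2
    have h5 := hDu _ (hbD p) _ (hbD p') (vadd_left_cancel _ h2)
    exact (hc (g₀ p +ᵥ p)).2.1 ⟨hp, rfl⟩ ⟨hp', h5.symm⟩ (Prod.ext h4 h3)
  · rintro ⟨y, j, ρ⟩ hq
    obtain ⟨p₁, rfl⟩ := hπs y
    have h1 : g₀ p₁ +ᵥ p₁ ∈ E (t (π p₁), j, ρ) := by
      refine ⟨hbD _, ?_, ?_⟩
      · simp only [hπb, neg_vadd_vadd]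
      · simp only [hπb, neg_vadd_vadd]; exact hq
    obtain ⟨p, ⟨hp, hb⟩, hcp⟩ := (hc (g₀ p₁ +ᵥ p₁)).2.2 h1
    refine ⟨p, hp, ?_⟩
    have h2 : π (g₀ p +ᵥ p) = π (g₀ p₁ +ᵥ p₁) := by rw [hb]
    rw [hπb, hπb] at h2
    simp only [hcp, ← vadd_vadd, h2, neg_vadd_vadd]

theorem mh_match {d : ℕ} {Δ X Y J : Type*} [AddCommGroup Δ] [Fintype Δ] [Fintype J] [Nonempty J]
    [MeasurableSpace X] [MeasurableSpace Y]
    [AddAction ((Fin d → ℤ) × Δ) X] [AddAction (Fin d → ℤ) Y]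
    (hm : ∀ g : (Fin d → ℤ) × Δ, Measurable (fun x : X => g +ᵥ x))
    (hmY : ∀ v : Fin d → ℤ, Measurable (fun y : Y => v +ᵥ y))
    (hfree : ∀ g : (Fin d → ℤ) × Δ, g ≠ 0 → ∀ x : X, g +ᵥ x ≠ x)
    (π : X → Y) (hπm : Measurable π) (hπs : Function.Surjective π)
    (hπ : ∀ (g : (Fin d → ℤ) × Δ) (x : X), π (g +ᵥ x) = g.1 +ᵥ π x)
    (hfib : ∀ p q, π p = π q → ∃ δ : Δ, q = ((0 : Fin d → ℤ), δ) +ᵥ p)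
    (s : X → ℝ) (hs : Measurable s) (hinj : Function.Injective s)
    (t : Y → (Fin d → ℤ)) (ht : ∀ v, MeasurableSet {y | t y = v})
    (L : Finset (Fin d → ℤ)) (hL : ∀ y, t y ∈ L)
    (o : Y → J → ℕ) (ho : ∀ j, Measurable (fun y => o y j)) (ε : J → (Fin d → ℤ))
    (A B : Set X) (hA : MeasurableSet A) (hB : MeasurableSet B)
    (hsumA : ∀ z : Y, ∑ x ∈ mhCell t L z, (A ∩ π ⁻¹' {-x +ᵥ z}).ncard =
      ∑ x ∈ mhCell t L z, ∑ j, o (-x +ᵥ z) j)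
    (hsumB : ∀ z : Y, ∑ x ∈ mhCell t L z, (B ∩ π ⁻¹' {-x +ᵥ z}).ncard =
      ∑ x ∈ mhCell t L z, ∑ j, o (-ε j +ᵥ (-x +ᵥ z)) j) :
    ∃ (γ : X → (Fin d → ℤ) × Δ) (F : Finset ((Fin d → ℤ) × Δ)),
      (∀ g, MeasurableSet {p | γ p = g}) ∧ (∀ p ∈ A, γ p ∈ F) ∧
      Set.BijOn (fun p => γ p +ᵥ p) A B := by
  classical
  obtain ⟨u, hum, ⟨U, hU⟩, hub⟩ := mh_tokens hm hmY hfree π hπm hπs hπ hfib s hs hinj t ht L hL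
    o ho A hA hsumA
  obtain ⟨w, hwm, ⟨U', hU'⟩, hwb⟩ := mh_tokens hm hmY hfree π hπm hπs hπ hfib s hs hinj t ht L hL
    (fun y j => o (-ε j +ᵥ y) j) (fun j => (ho j).comp (hmY _)) B hB hsumB
  let T : Set (Y × J × ℕ) := {q | q.2.2 < o q.1 q.2.1}
  let α : X → Y × J × ℕ := fun p => ((u p).1 +ᵥ π p, (u p).2)
  let β : X → Y × J × ℕ := fun p => (-ε (w p).2.1 +ᵥ ((w p).1 +ᵥ π p), (w p).2)
  have hα : Set.BijOn α A T := hub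
  have hβ : Set.BijOn β B T := by
    refine ⟨fun q hq => hwb.1 hq, ?_, ?_⟩
    · intro q hq q' hq' h
      refine hwb.2.1 hq hq' ?_
      simp only [β, Prod.mk.injEq] at h
      obtain ⟨h1, h2⟩ := h
      rw [h2] at h1
      exact Prod.ext (vadd_left_cancel _ h1) h2
    · rintro ⟨y, j, ρ⟩ hq
      obtain ⟨p, hp, h⟩ := hwb.2.2 (show ((ε j +ᵥ y, j, ρ) : Y × J × ℕ) ∈ _ by
        simp only [Set.mem_ofPred_eq, neg_vadd_vadd]; exact hq)
      simp only [Prod.mk.injEq] at h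
      refine ⟨p, hp, ?_⟩
      simp only [β, h.1, h.2, neg_vadd_vadd]
  let F : Finset ((Fin d → ℤ) × Δ) := (U ×ˢ U' ×ˢ (Finset.univ : Finset J) ×ˢ (Finset.univ : Finset Δ)).image
    (fun q => (-q.2.1 + ε q.2.2.1 + q.1, q.2.2.2))
  let Pg : (Fin d → ℤ) × Δ → Set X := fun g => {p | p ∈ A → g ∈ F ∧ g +ᵥ p ∈ B ∧
    (u p).2 = (w (g +ᵥ p)).2 ∧ (u p).1 = -ε (w (g +ᵥ p)).2.1 + (w (g +ᵥ p)).1 + g.1}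
  obtain ⟨γ, hγm, hγ⟩ := mh_exists_choice Pg (by
      intro g
      have : Pg g = Aᶜ ∪ ({p | g ∈ F} ∩ ((fun p => g +ᵥ p) ⁻¹' B ∩
          ⋃ (q : (Fin d → ℤ) × J × ℕ) (r : (Fin d → ℤ) × J × ℕ)
            (_ : q.2 = r.2 ∧ q.1 = -ε r.2.1 + r.1 + g.1),
            ({p | u p = q} ∩ (fun p => g +ᵥ p) ⁻¹' {p | w p = r}))) := by
        ext p
        simp only [Pg, Set.mem_ofPred_eq, Set.mem_union, Set.mem_compl_iff, Set.mem_iUnion,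
          Set.mem_inter_iff, Set.mem_preimage, imp_iff_not_or]
        refine or_congr Iff.rfl (and_congr Iff.rfl (and_congr Iff.rfl ⟨fun h => ⟨_, _, h, rfl, rfl⟩, ?_⟩))
        rintro ⟨q, r, h, rfl, rfl⟩
        exact h
      rw [this]
      exact hA.compl.union ((MeasurableSet.const _).inter ((hm g hB).inter
        (MeasurableSet.iUnion fun q => MeasurableSet.iUnion fun r => MeasurableSet.iUnion fun _ =>
          (hum q).inter (hm g (hwm r))))))
    (by
      intro p
      by_cases hp : p ∈ A
      · obtain ⟨q, hq, e⟩ := hβ.2.2 (hα.1 hp)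
        simp only [α, β, Prod.mk.injEq] at e
        obtain ⟨e1, e2⟩ := e
        have e3 : π q = (-(w q).1 + ε (w q).2.1 + (u p).1) +ᵥ π p := by
          rw [← vadd_vadd, ← e1, vadd_vadd, vadd_vadd]
          have : -(w q).1 + ε (w q).2.1 + -ε (w q).2.1 + (w q).1 = 0 := by abel
          rw [this, zero_vadd]
        obtain ⟨δ, hδ⟩ := hfib ((-(w q).1 + ε (w q).2.1 + (u p).1, (0 : Δ)) +ᵥ p) q (by
          rw [hπ, e3])
        rw [vadd_vadd] at hδ
        have hg : ((0 : Fin d → ℤ), δ) + (-(w q).1 + ε (w q).2.1 + (u p).1, (0 : Δ)) =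
          (-(w q).1 + ε (w q).2.1 + (u p).1, δ) := by simp
        rw [hg] at hδ
        refine ⟨(-(w q).1 + ε (w q).2.1 + (u p).1, δ), fun _ => ⟨?_, ?_, ?_, ?_⟩⟩
        · refine Finset.mem_image.2 ⟨((u p).1, (w q).1, (w q).2.1, δ), ?_, rfl⟩
          simp only [Finset.mem_product, Finset.mem_univ, and_true]
          exact ⟨hU p hp, hU' q hq⟩
        · rw [← hδ]; exact hq
        · rw [← hδ]; exact e2.symm
        · rw [← hδ]; simp only; abel
      · exact ⟨0, fun h => absurd h hp⟩)
  have hαβ : ∀ p ∈ A, α p = β (γ p +ᵥ p) := by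
    intro p hp
    obtain ⟨_, _, h1, h2⟩ := hγ p hp
    simp only [α, β, Prod.mk.injEq]
    refine ⟨?_, h1⟩
    rw [h2, hπ, vadd_vadd, vadd_vadd]
  refine ⟨γ, F, hγm, fun p hp => (hγ p hp).1, fun p hp => (hγ p hp).2.1, ?_, ?_⟩
  · intro p hp p' hp' h
    refine hα.2.1 hp hp' ?_
    rw [hαβ p hp, hαβ p' hp']
    exact congrArg β h
  · intro q hq
    obtain ⟨p, hp, e⟩ := hα.2.2 (hβ.1 hq)
    refine ⟨p, hp, hβ.2.1 (hγ p hp).2.1 hq ?_⟩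
    rw [← e, hαβ p hp]

/-- squared Euclidean length of an integer vector -/
def mhQ {d : ℕ} (v : Fin d → ℤ) : ℤ := ∑ i, v i ^ 2

/-- scalar product of integer vectors -/
def mhDot {d : ℕ} (x v : Fin d → ℤ) : ℤ := ∑ i, x i * v i

theorem mhQ_nonneg {d : ℕ} (v : Fin d → ℤ) : 0 ≤ mhQ v := Finset.sum_nonneg fun _ _ => sq_nonneg _

theorem mhQ_coord {d : ℕ} (v : Fin d → ℤ) (i : Fin d) : v i ^ 2 ≤ mhQ v :=
  Finset.single_le_sum (f := fun i => v i ^ 2) (fun _ _ => sq_nonneg _) (Finset.mem_univ i)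

theorem mhQ_sub {d : ℕ} (v x : Fin d → ℤ) : mhQ (v - x) = mhQ v - 2 * mhDot x v + mhQ x := by
  simp only [mhQ, mhDot, Finset.mul_sum, ← Finset.sum_sub_distrib, ← Finset.sum_add_distrib]
  exact Finset.sum_congr rfl fun i _ => by simp only [Pi.sub_apply]; ring

theorem mhQ_neg {d : ℕ} (v : Fin d → ℤ) : mhQ (-v) = mhQ v := by simp [mhQ]

theorem mhDot_step {d : ℕ} (v x : Fin d → ℤ) (i : Fin d) (k : ℤ) :
    mhDot (x + k • mhE i) v = mhDot x v + k * v i := by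
  simp only [mhDot, Pi.add_apply, add_mul, Finset.sum_add_distrib]
  congr 1
  rw [Finset.sum_eq_single i]
  · simp [mhE_same]
  · intro j _ hj; simp [mhE, Pi.single_apply, hj]
  · simp

theorem mhQ_le {d : ℕ} (v : Fin d → ℤ) (b : ℤ) (h : ∀ i, |v i| ≤ b) : mhQ v ≤ d * b ^ 2 := by
  have : mhQ v ≤ ∑ _i : Fin d, b ^ 2 := Finset.sum_le_sum fun i _ => sq_le_sq' (abs_le.1 (h i)).1 (abs_le.1 (h i)).2
  simpa using this

theorem mh_voronoi {d : ℕ} {Y : Type*} [MeasurableSpace Y] [AddAction (Fin d → ℤ) Y]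
    (hm : ∀ v : Fin d → ℤ, Measurable (fun y : Y => v +ᵥ y))
    (hfree : ∀ v : Fin d → ℤ, v ≠ 0 → ∀ y : Y, v +ᵥ y ≠ y)
    (s : Y → ℝ) (hs : Measurable s) (hinj : Function.Injective s) (n : ℕ) (hn : 0 < n) :
    ∃ t : Y → (Fin d → ℤ), (∀ v, MeasurableSet {y | t y = v}) ∧
      (∀ y i, |t y i| ≤ 2 * d * (d + 1) * n) ∧
      (∀ (y : Y) (x : Fin d → ℤ), x ∈ mhBox d n → t (x +ᵥ (t y +ᵥ y)) = -x) ∧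
      (∀ (z : Y) (x : Fin d → ℤ) (i : Fin d) (k : ℤ), 1 ≤ k → t (x +ᵥ z) = -x →
        t ((x + k • mhE i) +ᵥ z) = -(x + k • mhE i) → t ((x + mhE i) +ᵥ z) = -(x + mhE i)) := by
  classical
  set N : ℕ := (d + 1) * n with hN
  have hN0 : 0 < N := by positivity
  obtain ⟨M, hM, hsep, hcov⟩ := mh_level hm hfree s hs hinj N hN0
  have hact : ∀ (g g' : Fin d → ℤ) (y : Y), g +ᵥ y = g' +ᵥ y → g = g' := by
    intro g g' x h
    by_contra hne
    refine hfree (-g' + g) (fun h0 => hne ?_) x ?_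
    · rw [neg_add_eq_zero] at h0; exact h0.symm
    · rw [← vadd_vadd, h, neg_vadd_vadd]
  let Q : (Fin d → ℤ) → Set Y := fun v => {y | v +ᵥ y ∈ M ∧ ∀ v' : Fin d → ℤ, v' +ᵥ y ∈ M →
    (mhQ v < mhQ v' ∨ (mhQ v = mhQ v' ∧ s (v +ᵥ y) ≤ s (v' +ᵥ y)))}
  have hQm : ∀ v, MeasurableSet (Q v) := by
    intro v
    refine (hm v hM).inter (mh_meas_forall fun v' => ?_)
    have h1 : MeasurableSet ({y : Y | v' +ᵥ y ∈ M}ᶜ ∪ ({y : Y | mhQ v < mhQ v'} ∪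
        ({y : Y | mhQ v = mhQ v'} ∩ {y : Y | s (v +ᵥ y) ≤ s (v' +ᵥ y)}))) :=
      (hm v' hM).compl.union ((MeasurableSet.const _).union ((MeasurableSet.const _).inter
        (measurableSet_le (hs.comp (hm v)) (hs.comp (hm v')))))
    have h2 : {y : Y | v' +ᵥ y ∈ M →
      (mhQ v < mhQ v' ∨ (mhQ v = mhQ v' ∧ s (v +ᵥ y) ≤ s (v' +ᵥ y)))} = {y : Y | v' +ᵥ y ∈ M}ᶜ ∪ ({y : Y | mhQ v < mhQ v'} ∪
        ({y : Y | mhQ v = mhQ v'} ∩ {y : Y | s (v +ᵥ y) ≤ s (v' +ᵥ y)})) := by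
      ext y
      simp only [Set.mem_ofPred_eq, Set.mem_union, Set.mem_compl_iff, Set.mem_inter_iff, imp_iff_not_or]
    rw [h2]; exact h1
  have hQe : ∀ y, ∃ v, y ∈ Q v := by
    intro y
    obtain ⟨v₁, _, hv₁⟩ := hcov y
    obtain ⟨v₀, hv₀, hmin⟩ := (measure (fun v : Fin d → ℤ => (mhQ v).toNat)).wf.has_min
      {v : Fin d → ℤ | v +ᵥ y ∈ M} ⟨v₁, hv₁⟩
    have hmin' : ∀ v : Fin d → ℤ, v +ᵥ y ∈ M → mhQ v₀ ≤ mhQ v := by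
      intro v hv
      have h1 : ¬ ((mhQ v).toNat < (mhQ v₀).toNat) := hmin v hv
      have h2 := mhQ_nonneg v
      have h3 := mhQ_nonneg v₀
      omega
    have hfin : {v : Fin d → ℤ | v +ᵥ y ∈ M ∧ mhQ v = mhQ v₀}.Finite := by
      refine (Set.finite_Icc (fun _ : Fin d => -mhQ v₀) (fun _ => mhQ v₀)).subset ?_
      rintro v ⟨_, hv⟩
      have h1 : ∀ i, |v i| ≤ mhQ v₀ := by
        intro i
        have h2 := mhQ_coord v i
        rw [hv] at h2
        have h3 : |v i| ≤ v i ^ 2 := by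
          rw [← sq_abs]
          by_cases h : v i = 0
          · simp [h]
          · have := Int.one_le_abs h
            nlinarith
        linarith
      exact ⟨fun i => (abs_le.1 (h1 i)).1, fun i => (abs_le.1 (h1 i)).2⟩
    obtain ⟨v, ⟨hv1, hv2⟩, hv3⟩ := Set.exists_min_image _ (fun v => s (v +ᵥ y)) hfin ⟨v₀, hv₀, rfl⟩
    refine ⟨v, hv1, fun v' hv' => ?_⟩
    rw [hv2]
    rcases (hmin' v' hv').lt_or_eq with h | h
    · exact Or.inl h
    · exact Or.inr ⟨h, hv3 v' ⟨hv', h.symm⟩⟩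
  obtain ⟨t, htm, ht⟩ := mh_exists_choice Q hQm hQe
  have huniq : ∀ y v, y ∈ Q v → t y = v := by
    intro y v hv
    have h1 := (ht y).2 v hv.1
    have h2 := hv.2 (t y) (ht y).1
    rcases h1 with h1 | ⟨h1, h1'⟩
    · rcases h2 with h2 | ⟨h2, _⟩ <;> omega
    · rcases h2 with h2 | ⟨h2, h2'⟩
      · omega
      · exact hact _ _ y (hinj (le_antisymm h1' h2'))
  refine ⟨t, htm, ?_, ?_, ?_⟩
  · intro y i
    obtain ⟨v, hv, hvM⟩ := hcov y
    have h1 : mhQ (t y) ≤ mhQ v := by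
      rcases (ht y).2 v hvM with h | h
      · exact h.le
      · exact h.1.le
    have h2 := mhQ_le v (2 * N) fun i => (hv i).le
    have h3 := mhQ_coord (t y) i
    have hd : (1 : ℤ) ≤ d := by have := i.pos; omega
    have h4 : (t y i) ^ 2 ≤ (2 * (d : ℤ) * (d + 1) * n) ^ 2 := by
      have h5 : (2 * (d : ℤ) * (d + 1) * n) ^ 2 = d * (d * (2 * N) ^ 2) := by
        rw [hN]; push_cast; ring
      rw [h5]
      have h6 : (0 : ℤ) ≤ d * (2 * N) ^ 2 := by positivity
      nlinarith
    exact abs_le_of_sq_le_sq h4 (by positivity)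
  · intro y x hx
    apply huniq
    set z := t y +ᵥ y with hz
    have hzM : z ∈ M := (ht y).1
    refine ⟨by rw [neg_vadd_vadd]; exact hzM, fun v' hv' => ?_⟩
    rw [neg_vadd_vadd]
    rw [vadd_vadd] at hv' ⊢
    by_cases h0 : v' + x = 0
    · right
      rw [h0, zero_vadd, eq_neg_of_add_eq_zero_left h0]
      exact ⟨rfl, le_rfl⟩
    · left
      have h1 : ∃ i, 2 * (N : ℤ) ≤ |(v' + x) i| := by
        by_contra hc
        push Not at hc
        exact hsep z hzM _ h0 hc hv'
      obtain ⟨i, hi⟩ := h1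
      set v := v' + x with hv
      have e1 : v' = v - x := by rw [hv]; abel
      rw [e1, mhQ_sub, mhQ_neg]
      have h2 : 4 * (N : ℤ) ^ 2 ≤ mhQ v := by
        have := mhQ_coord v i
        rw [← sq_abs] at this
        nlinarith
      have h3 : mhQ x ≤ d * (n : ℤ) ^ 2 := mhQ_le x n fun i => by
        have := mem_mhBox.1 hx i
        rw [abs_of_nonneg this.1]; exact this.2.le
      have h4 : 4 * mhQ x < mhQ v := by
        have hn' : (0 : ℤ) < n := by exact_mod_cast hn
        have h5 : (N : ℤ) ^ 2 = (d + 1) ^ 2 * n ^ 2 := by rw [hN]; push_cast; ring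
        have h6 : (0 : ℤ) ≤ d := by positivity
        have h7 : (0 : ℤ) < (n : ℤ) ^ 2 := by positivity
        have h8 : (d : ℤ) < (d + 1) ^ 2 := by nlinarith
        have h9 := mul_lt_mul_of_pos_right h8 h7
        linarith
      have h5 : mhDot x v ^ 2 ≤ mhQ x * mhQ v := Finset.sum_mul_sq_le_sq_mul_sq _ _ _
      have h6 := mhQ_nonneg x
      have h7 : 2 * mhDot x v < mhQ v := by
        by_contra hc
        push Not at hc
        have h8 : 0 < mhQ v := by linarith
        nlinarith [mul_lt_mul_of_pos_right h4 h8, mul_le_mul hc hc h8.le (by linarith)]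
      linarith
  · intro z x i k hk h1 h2
    have q1 := ht (x +ᵥ z)
    have q2 := ht ((x + k • mhE i) +ᵥ z)
    rw [h1] at q1
    rw [h2] at q2
    have hzM : z ∈ M := by have := q1.1; rwa [neg_vadd_vadd] at this
    apply huniq
    refine ⟨by rw [neg_vadd_vadd]; exact hzM, fun v' hv' => ?_⟩
    rw [vadd_vadd] at hv'
    set v := v' + (x + mhE i) with hv
    have c1 := q1.2 (v - x) (by rw [vadd_vadd, sub_add_cancel]; exact hv')
    have c2 := q2.2 (v - (x + k • mhE i)) (by rw [vadd_vadd, sub_add_cancel]; exact hv')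
    have e1 : v' = v - (x + (1 : ℤ) • mhE i) := by rw [hv, one_smul]; abel
    rw [neg_vadd_vadd, vadd_vadd, sub_add_cancel, mhQ_neg, mhQ_sub] at c1
    rw [neg_vadd_vadd, vadd_vadd, sub_add_cancel, mhQ_neg, mhQ_sub, mhDot_step] at c2
    rw [neg_vadd_vadd, vadd_vadd, mhQ_neg]
    have e2 : mhQ v' = mhQ v - 2 * (mhDot x v + 1 * v i) + mhQ (x + mhE i) := by
      rw [e1, mhQ_sub, mhDot_step, one_smul]
    rw [e2]
    by_cases hvi : v i ≤ 0
    · rcases c1 with c1 | ⟨c1, c1'⟩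
      · left; linarith
      · rcases hvi.lt_or_eq with h | h
        · left; linarith
        · right; exact ⟨by linarith, c1'⟩
    · push Not at hvi
      have h3 : v i ≤ k * v i := by nlinarith
      rcases c2 with c2 | ⟨c2, c2'⟩
      · left; linarith
      · rcases h3.lt_or_eq with h | h
        · left; linarith
        · right; exact ⟨by linarith, c2'⟩

theorem mh_exit_card_aux {d : ℕ} (C E : Finset (Fin d → ℤ)) (R : ℕ) (i : Fin d)
    (hE : E ⊆ C) (hR : ∀ x ∈ C, ∀ j, |x j| ≤ R)
    (h : ∀ x ∈ E, ∀ y ∈ E, ∀ k : ℤ, 1 ≤ k → y ≠ x + k • mhE i) :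
    E.card * (2 * R + 1) ≤ (2 * R + 1) ^ d := by
  classical
  have h1 : E.card ≤ (Fintype.piFinset (fun j : Fin d => if j = i then {(0 : ℤ)} else
      Finset.Icc (-(R : ℤ)) R)).card := by
    refine Finset.card_le_card_of_injOn (fun x => Function.update x i 0) ?_ ?_
    · intro x hx
      simp only [Finset.mem_coe, Fintype.mem_piFinset]
      intro j
      by_cases hj : j = i
      · subst hj; simp
      · simp only [Function.update_of_ne hj, if_neg hj, Finset.mem_Icc]
        exact abs_le.1 (hR x (hE hx) j)
    · intro x hx y hy hxy
      simp only at hxy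
      have key : ∀ x y : Fin d → ℤ, Function.update x i 0 = Function.update y i 0 →
          y = x + (y i - x i) • mhE i := by
        intro x y hxy
        ext j
        by_cases hj : j = i
        · subst hj; simp [mhE_same]
        · have := congrFun hxy j
          simp only [Function.update_of_ne hj] at this
          simp [mhE_ne hj, this]
      rcases lt_trichotomy (x i) (y i) with hlt | heq | hgt
      · exact absurd (key x y hxy) (h x hx y hy _ (by omega))
      · have := key x y hxy
        rw [heq, sub_self, zero_smul, add_zero] at this
        exact this.symm
      · exact absurd (key y x hxy.symm) (h y hy x hx _ (by omega))
  calc _ ≤ _ := Nat.mul_le_mul_right _ h1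
    _ = (2 * R + 1) ^ d := by
      rw [Fintype.card_piFinset, ← Finset.mul_prod_erase Finset.univ _ (Finset.mem_univ i)]
      have : ∏ x ∈ Finset.univ.erase i, (if x = i then {(0 : ℤ)} else
          Finset.Icc (-(R : ℤ)) R).card
          = ∏ x ∈ Finset.univ.erase i, (2 * R + 1) := by
        apply Finset.prod_congr rfl
        intro x hx
        rw [if_neg (Finset.ne_of_mem_erase hx), Int.card_Icc]
        omega
      rw [this]
      simp only [if_true, Finset.card_singleton, one_mul, Finset.prod_const, Finset.card_erase_of_mem (Finset.mem_univ i), Finset.card_univ, Fintype.card_fin]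
      rw [← pow_succ]
      congr 1
      have := i.pos
      omega

theorem mh_exit_card {d : ℕ} (C : Finset (Fin d → ℤ)) (R : ℕ) (i : Fin d)
    (hR : ∀ x ∈ C, ∀ j, |x j| ≤ R)
    (hconv : ∀ x ∈ C, ∀ k : ℤ, 1 ≤ k → x - k • mhE i ∈ C → x - mhE i ∈ C) :
    (C.filter (fun x => x - mhE i ∉ C)).card * (2 * R + 1) ≤ (2 * R + 1) ^ d ∧
    (C.filter (fun x => x + mhE i ∉ C)).card * (2 * R + 1) ≤ (2 * R + 1) ^ d := by
  classical
  have hconv' : ∀ k : ℕ, ∀ x ∈ C, x + (k + 1) • mhE i ∈ C → x + mhE i ∈ C := by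
    intro k
    induction k with
    | zero => intro x _ hx; simpa using hx
    | succ k ih =>
      intro x hx hx'
      refine ih x hx ?_
      have := hconv _ hx' ((k + 1 + 1 : ℕ) : ℤ) (by omega) (by
        rw [natCast_zsmul]; simpa using hx)
      convert this using 1
      rw [succ_nsmul (mhE i) (k + 1)]
      abel
  constructor
  · refine mh_exit_card_aux C _ R i (Finset.filter_subset _ _) hR ?_
    rintro x hx y hy k hk rfl
    rw [Finset.mem_filter] at hx hy
    exact hy.2 (hconv _ hy.1 k hk (by simpa using hx.1))
  · refine mh_exit_card_aux C _ R i (Finset.filter_subset _ _) hR ?_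
    rintro x hx y hy k hk rfl
    rw [Finset.mem_filter] at hx hy
    refine hx.2 (hconv' (k - 1).toNat x hx.1 ?_)
    have h1 : (((k - 1).toNat + 1 : ℕ) : ℤ) = k := by omega
    rw [← natCast_zsmul, h1]
    exact hy.1

/-- Telescoping over a finite set. -/
theorem mh_tele {d : ℕ} (C : Finset (Fin d → ℤ)) (i : Fin d) (Ψ : (Fin d → ℤ) → ℤ) :
    ∑ x ∈ C, (if x - mhE i ∈ C then 0 else Ψ x) - ∑ x ∈ C, (if x + mhE i ∈ C then 0 else Ψ (x + mhE i))
      = ∑ x ∈ C, (Ψ x - Ψ (x + mhE i)) := by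
  classical
  have h1 : ∀ x, (if x - mhE i ∈ C then 0 else Ψ x) = Ψ x - (if x - mhE i ∈ C then Ψ x else 0) := by
    intro x; split_ifs <;> simp
  have h2 : ∀ x, (if x + mhE i ∈ C then 0 else Ψ (x + mhE i))
      = Ψ (x + mhE i) - (if x + mhE i ∈ C then Ψ (x + mhE i) else 0) := by
    intro x; split_ifs <;> simp
  have h3 : ∑ x ∈ C, (if x - mhE i ∈ C then Ψ x else 0)
      = ∑ x ∈ C, (if x + mhE i ∈ C then Ψ (x + mhE i) else 0) := by
    rw [← Finset.sum_filter, ← Finset.sum_filter]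
    refine Finset.sum_bij' (fun x _ => x - mhE i) (fun x _ => x + mhE i) ?_ ?_ ?_ ?_ ?_
    · intro x hx; rw [Finset.mem_filter] at hx ⊢; simpa using hx.symm
    · intro x hx; rw [Finset.mem_filter] at hx ⊢; simpa using hx.symm
    · intro x _; simp
    · intro x _; simp
    · intro x _; simp
  simp only [h1, h2, Finset.sum_sub_distrib, h3]
  ring

/-- Bounding the exit sums. -/
theorem mh_exit_sum {d : ℕ} (C : Finset (Fin d → ℤ)) (R K : ℕ)
    (hR : ∀ x ∈ C, ∀ j, |x j| ≤ R)
    (hconv : ∀ i, ∀ x ∈ C, ∀ k : ℤ, 1 ≤ k → x - k • mhE i ∈ C → x - mhE i ∈ C)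
    (p q : Fin d → (Fin d → ℤ) → ℕ) (hp : ∀ i x, p i x ≤ K) (hq : ∀ i x, q i x ≤ K) :
    (∑ i, (∑ x ∈ C, (if x - mhE i ∈ C then 0 else p i x) +
      ∑ x ∈ C, (if x + mhE i ∈ C then 0 else q i x))) * (2 * R + 1) ≤
      2 * d * K * (2 * R + 1) ^ d := by
  classical
  have h1 : ∀ i, (∑ x ∈ C, (if x - mhE i ∈ C then 0 else p i x) +
      ∑ x ∈ C, (if x + mhE i ∈ C then 0 else q i x)) * (2 * R + 1) ≤ 2 * K * (2 * R + 1) ^ d := by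
    intro i
    obtain ⟨c1, c2⟩ := mh_exit_card C R i hR (hconv i)
    have e1 : ∑ x ∈ C, (if x - mhE i ∈ C then 0 else p i x) ≤
        (C.filter (fun x => x - mhE i ∉ C)).card * K := by
      rw [← smul_eq_mul, ← Finset.sum_const, Finset.sum_filter]
      refine Finset.sum_le_sum fun x _ => ?_
      have := hp i x
      split_ifs <;> simp_all
    have e2 : ∑ x ∈ C, (if x + mhE i ∈ C then 0 else q i x) ≤
        (C.filter (fun x => x + mhE i ∉ C)).card * K := by
      rw [← smul_eq_mul, ← Finset.sum_const, Finset.sum_filter]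
      refine Finset.sum_le_sum fun x _ => ?_
      have := hq i x
      split_ifs <;> simp_all
    nlinarith [Nat.mul_le_mul_right (2 * R + 1) e1, Nat.mul_le_mul_right (2 * R + 1) e2,
      Nat.mul_le_mul_left K c1, Nat.mul_le_mul_left K c2]
  rw [Finset.sum_mul]
  calc _ ≤ ∑ _i : Fin d, 2 * K * (2 * R + 1) ^ d := Finset.sum_le_sum fun i _ => h1 i
    _ = _ := by simp; ring

theorem mh_tiles {d : ℕ} {Y : Type*} [MeasurableSpace Y] [AddAction (Fin d → ℤ) Y]
    (hm : ∀ v : Fin d → ℤ, Measurable (fun y : Y => v +ᵥ y))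
    (hfree : ∀ v : Fin d → ℤ, v ≠ 0 → ∀ y : Y, v +ᵥ y ≠ y)
    (s : Y → ℝ) (hs : Measurable s) (hinj : Function.Injective s)
    (ψ : Fin d → Y → ℤ) (hψ : ∀ i, Measurable (ψ i)) (K : ℕ) (hK : ∀ i y, |ψ i y| ≤ K)
    (a b : Y → ℕ) (ha : Measurable a) (hb : Measurable b)
    (hdiv : ∀ y, mhDiv ψ y = (a y : ℤ) - b y)
    (W : Set Y) (hW : ∀ (v : Fin d → ℤ) (y : Y), v +ᵥ y ∈ W ↔ y ∈ W)
    (h0 : ∀ y ∉ W, ∀ i, ψ i y = 0)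
    (c : ℝ) (hc : 0 < c) (n₀ : ℕ)
    (hau : ∀ y ∈ W, ∀ n : ℕ, n₀ < n → c * (n : ℝ) ^ d ≤ ((∑ x ∈ mhBox d n, a (x +ᵥ y) : ℕ) : ℝ))
    (hbu : ∀ y ∈ W, ∀ n : ℕ, n₀ < n → c * (n : ℝ) ^ d ≤ ((∑ x ∈ mhBox d n, b (x +ᵥ y) : ℕ) : ℝ)) :
    ∃ (t : Y → (Fin d → ℤ)) (L : Finset (Fin d → ℤ)) (o : Y → Option (Fin d × Bool) → ℕ)
      (ε : Option (Fin d × Bool) → (Fin d → ℤ)),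
      (∀ v, MeasurableSet {y | t y = v}) ∧ (∀ y, t y ∈ L) ∧ (∀ j, Measurable (fun y => o y j)) ∧
      (∀ z : Y, ∑ x ∈ mhCell t L z, a (-x +ᵥ z) = ∑ x ∈ mhCell t L z, ∑ j, o (-x +ᵥ z) j) ∧
      (∀ z : Y, ∑ x ∈ mhCell t L z, b (-x +ᵥ z) =
        ∑ x ∈ mhCell t L z, ∑ j, o (-ε j +ᵥ (-x +ᵥ z)) j) := by
  classical
  set κ : ℕ := 4 * d * (d + 1) + 1 with hκ
  obtain ⟨m, hmm⟩ := exists_nat_ge ((2 * d * K * κ ^ d : ℕ) / c : ℝ)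
  set n : ℕ := max m (n₀ + 1) with hn
  have hn0 : 0 < n := lt_of_lt_of_le (Nat.succ_pos n₀) (le_max_right _ _)
  have hnn : n₀ < n := lt_of_lt_of_le (Nat.lt_succ_self n₀) (le_max_right _ _)
  have hnc : ((2 * d * K * κ ^ d : ℕ) : ℝ) ≤ c * n := by
    rw [div_le_iff₀ hc] at hmm
    have : (m : ℝ) ≤ n := by exact_mod_cast le_max_left _ _
    nlinarith
  obtain ⟨t, ht, htb, htbox, htconv⟩ := mh_voronoi hm hfree s hs hinj n hn0
  set R : ℕ := 2 * d * (d + 1) * n with hR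
  set L : Finset (Fin d → ℤ) := Fintype.piFinset (fun _ => Finset.Icc (-(R : ℤ)) R) with hLdef
  have hL : ∀ y, t y ∈ L := by
    intro y
    rw [hLdef, Fintype.mem_piFinset]
    intro i
    rw [Finset.mem_Icc, ← abs_le]
    have := htb y i
    rw [hR]; push_cast; exact this
  have htm : Measurable t := measurable_to_countable' ht
  let P : Fin d → Y → ℕ := fun i y => if t (mhE i +ᵥ y) = t y - mhE i then 0 else (ψ i y).toNat
  let N : Fin d → Y → ℕ := fun i y => if t (-(mhE i) +ᵥ y) = t y + mhE i then 0 else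
    (-ψ i (-(mhE i) +ᵥ y)).toNat
  let out : Y → ℕ := fun z => ∑ x ∈ mhCell t L z, ∑ i, (P i (-x +ᵥ z) + N i (-x +ᵥ z))
  let inn : Y → ℕ := fun z => ∑ x ∈ mhCell t L z, ∑ i,
    (P i (-(mhE i) +ᵥ (-x +ᵥ z)) + N i (mhE i +ᵥ (-x +ᵥ z)))
  have hPm : ∀ i, Measurable (P i) := by
    intro i
    refine Measurable.ite (measurableSet_eq_fun (htm.comp (hm _)) (htm.sub_const _))
      measurable_const ?_
    exact (measurable_of_countable Int.toNat).comp (hψ i)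
  have hNm : ∀ i, Measurable (N i) := by
    intro i
    refine Measurable.ite (measurableSet_eq_fun (htm.comp (hm _)) (htm.add_const _))
      measurable_const ?_
    exact (measurable_of_countable (fun k : ℤ => (-k).toNat)).comp ((hψ i).comp (hm _))
  have hcm : ∀ f : Y → ℕ, Measurable f →
      Measurable (fun z => ∑ x ∈ mhCell t L z, f (-x +ᵥ z)) := by
    intro f hf
    have : (fun z => ∑ x ∈ mhCell t L z, f (-x +ᵥ z)) =
        fun z => ∑ x ∈ L, if t (-x +ᵥ z) = x then f (-x +ᵥ z) else 0 := by
      funext z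
      rw [← Finset.sum_filter]
      refine Finset.sum_congr ?_ fun _ _ => rfl
      ext x
      rw [mem_mhCell t L hL, Finset.mem_filter]
      exact ⟨fun h => ⟨h ▸ hL _, h⟩, fun h => h.2⟩
    rw [this]
    refine Finset.measurable_fun_sum _ fun x _ => ?_
    exact Measurable.ite (hm (-x) (ht x)) (hf.comp (hm _)) measurable_const
  have hCi := mem_mhCell t L hL
  -- rewriting of `P`, `N` on cells
  have hP1 : ∀ z, ∀ x ∈ mhCell t L z, ∀ i, P i (-x +ᵥ z) =
      if x - mhE i ∈ mhCell t L z then 0 else (ψ i (-x +ᵥ z)).toNat := by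
    intro z x hx i
    rw [hCi] at hx
    simp only [P, hCi, hx, vadd_vadd]
    have : mhE i + -x = -(x - mhE i) := by abel
    rw [this]
  have hN1 : ∀ z, ∀ x ∈ mhCell t L z, ∀ i, N i (-x +ᵥ z) =
      if x + mhE i ∈ mhCell t L z then 0 else (-ψ i (-(x + mhE i) +ᵥ z)).toNat := by
    intro z x hx i
    rw [hCi] at hx
    simp only [N, hCi, hx, vadd_vadd]
    have : -mhE i + -x = -(x + mhE i) := by abel
    rw [this]
  have hP2 : ∀ z, ∀ x ∈ mhCell t L z, ∀ i, P i (-(mhE i) +ᵥ (-x +ᵥ z)) =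
      if x + mhE i ∈ mhCell t L z then 0 else (ψ i (-(x + mhE i) +ᵥ z)).toNat := by
    intro z x hx i
    rw [hCi] at hx
    simp only [P, hCi, vadd_neg_vadd, hx]
    simp only [vadd_vadd]
    have : -mhE i + -x = -(x + mhE i) := by abel
    rw [this]
    refine if_congr ?_ rfl rfl
    rw [eq_sub_iff_add_eq]; exact eq_comm
  have hN2 : ∀ z, ∀ x ∈ mhCell t L z, ∀ i, N i (mhE i +ᵥ (-x +ᵥ z)) =
      if x - mhE i ∈ mhCell t L z then 0 else (-ψ i (-x +ᵥ z)).toNat := by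
    intro z x hx i
    rw [hCi] at hx
    simp only [N, hCi, neg_vadd_vadd, hx]
    simp only [vadd_vadd]
    have : mhE i + -x = -(x - mhE i) := by abel
    rw [this]
    refine if_congr ?_ rfl rfl
    rw [← sub_eq_iff_eq_add]; exact eq_comm
  have hout : ∀ z, out z = ∑ i, (∑ x ∈ mhCell t L z, (if x - mhE i ∈ mhCell t L z then 0 else
      (ψ i (-x +ᵥ z)).toNat) + ∑ x ∈ mhCell t L z, (if x + mhE i ∈ mhCell t L z then 0 else
      (-ψ i (-(x + mhE i) +ᵥ z)).toNat)) := by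
    intro z
    simp only [out]
    rw [Finset.sum_comm]
    refine Finset.sum_congr rfl fun i _ => ?_
    rw [← Finset.sum_add_distrib]
    refine Finset.sum_congr rfl fun x hx => ?_
    rw [hP1 z x hx, hN1 z x hx]
  have hinn : ∀ z, inn z = ∑ i, (∑ x ∈ mhCell t L z, (if x - mhE i ∈ mhCell t L z then 0 else
      (-ψ i (-x +ᵥ z)).toNat) + ∑ x ∈ mhCell t L z, (if x + mhE i ∈ mhCell t L z then 0 else
      (ψ i (-(x + mhE i) +ᵥ z)).toNat)) := by
    intro z
    simp only [inn]
    rw [Finset.sum_comm]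
    refine Finset.sum_congr rfl fun i _ => ?_
    rw [← Finset.sum_add_distrib]
    refine Finset.sum_congr rfl fun x hx => ?_
    rw [hP2 z x hx, hN2 z x hx, add_comm]
  -- balance
  have hbal : ∀ z, (out z : ℤ) - inn z =
      ((∑ x ∈ mhCell t L z, a (-x +ᵥ z) : ℕ) : ℤ) - ((∑ x ∈ mhCell t L z, b (-x +ᵥ z) : ℕ) : ℤ) := by
    intro z
    rw [hout, hinn]
    push_cast
    rw [← Finset.sum_sub_distrib, ← Finset.sum_sub_distrib]
    have h1 : ∀ x ∈ mhCell t L z, (a (-x +ᵥ z) : ℤ) - b (-x +ᵥ z) =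
        ∑ i, (ψ i (-x +ᵥ z) - ψ i (-(x + mhE i) +ᵥ z)) := by
      intro x _
      rw [← hdiv]
      simp only [mhDiv, vadd_vadd]
      refine Finset.sum_congr rfl fun i _ => ?_
      have : -mhE i + -x = -(x + mhE i) := by abel
      rw [this]
    rw [Finset.sum_congr rfl h1, Finset.sum_comm]
    refine Finset.sum_congr rfl fun i _ => ?_
    rw [← mh_tele (mhCell t L z) i (fun x => ψ i (-x +ᵥ z))]
    have e : ∀ p q r u : ℤ, p + q - (r + u) = (p - r) - (u - q) := by intros; ring
    rw [e, ← Finset.sum_sub_distrib, ← Finset.sum_sub_distrib]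
    congr 1
    · refine Finset.sum_congr rfl fun x _ => ?_
      split_ifs
      · simp
      · omega
    · refine Finset.sum_congr rfl fun x _ => ?_
      split_ifs
      · simp
      · omega
  -- base points
  have hbase : ∀ z, (mhCell t L z).Nonempty → t z = 0 := by
    rintro z ⟨x, hx⟩
    rw [hCi] at hx
    have := htbox (-x +ᵥ z) 0 (by rw [mem_mhBox]; intro i; simp [hn0])
    rw [hx, vadd_neg_vadd, zero_vadd, neg_zero] at this
    exact this
  have hsumbox : ∀ (f : Y → ℕ) (z : Y), t z = 0 →
      ∑ x ∈ mhBox d n, f (x +ᵥ z) ≤ ∑ x ∈ mhCell t L z, f (-x +ᵥ z) := by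
    intro f z hz
    have h1 : ∑ x ∈ mhBox d n, f (x +ᵥ z) = ∑ x ∈ (mhBox d n).image (fun x => -x), f (-x +ᵥ z) := by
      rw [Finset.sum_image (fun x _ y _ h => neg_injective h)]
      simp
    rw [h1]
    refine Finset.sum_le_sum_of_subset fun x hx => ?_
    rw [Finset.mem_image] at hx
    obtain ⟨y, hy, rfl⟩ := hx
    rw [hCi, neg_neg]
    have := htbox z y hy
    rwa [hz, zero_vadd] at this
  have hbound : ∀ z (p q : Fin d → (Fin d → ℤ) → ℕ), (∀ i x, p i x ≤ K) → (∀ i x, q i x ≤ K) →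
      (((∑ i, (∑ x ∈ mhCell t L z, (if x - mhE i ∈ mhCell t L z then 0 else p i x) +
      ∑ x ∈ mhCell t L z, (if x + mhE i ∈ mhCell t L z then 0 else q i x)) : ℕ)) : ℝ) ≤ c * n ^ d := by
    intro z p q hp hq
    have := mh_exit_sum (mhCell t L z) R K (by
      intro x hx j
      rw [hCi] at hx
      have := htb (-x +ᵥ z) j
      rw [hx] at this
      rw [hR]; push_cast; exact this) (by
      intro i x hx k hk hx'
      rw [hCi] at hx hx' ⊢
      have := htconv z (-x) i k hk (by rw [hx, neg_neg]) (by
        have e : -x + k • mhE i = -(x - k • mhE i) := by abel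
        rw [e, hx', neg_neg])
      have e : -x + mhE i = -(x - mhE i) := by abel
      rw [e, neg_neg] at this
      exact this) p q hp hq
    set S := ∑ i, (∑ x ∈ mhCell t L z, (if x - mhE i ∈ mhCell t L z then 0 else p i x) +
      ∑ x ∈ mhCell t L z, (if x + mhE i ∈ mhCell t L z then 0 else q i x)) with hS
    rcases Nat.eq_zero_or_pos d with hd | hd
    · subst hd
      have : S = 0 := by rw [hS]; simp
      rw [this]; simp; exact hc.le
    -- size of the ambient box
    have hle : 2 * R + 1 ≤ κ * n := by rw [hR, hκ]; nlinarith
    have hS2 : S ≤ 2 * d * K * (2 * R + 1) ^ (d - 1) := by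
      have e : (2 * R + 1) ^ d = (2 * R + 1) ^ (d - 1) * (2 * R + 1) := by
        rw [← pow_succ]; congr 1; omega
      refine Nat.le_of_mul_le_mul_right (c := 2 * R + 1) ?_ (by omega)
      calc S * (2 * R + 1) ≤ _ := this
        _ = 2 * d * K * ((2 * R + 1) ^ (d - 1) * (2 * R + 1)) := by rw [← e]
        _ = _ := by ring
    have hS3 : S * n ≤ (2 * d * K * κ ^ d) * n ^ d := by
      have e1 : (2 * R + 1) ^ (d - 1) ≤ (κ * n) ^ (d - 1) := Nat.pow_le_pow_left hle _
      have e2 : n ≤ κ * n := Nat.le_mul_of_pos_left _ (by omega)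
      calc S * n ≤ (2 * d * K * (κ * n) ^ (d - 1)) * (κ * n) :=
            Nat.mul_le_mul (hS2.trans (Nat.mul_le_mul_left _ e1)) e2
        _ = 2 * d * K * ((κ * n) ^ (d - 1) * (κ * n)) := by ring
        _ = 2 * d * K * (κ * n) ^ d := by
          rw [← pow_succ]; congr 2; omega
        _ = _ := by rw [mul_pow]; ring
    have hS4 : (S : ℝ) * n ≤ ((2 * d * K * κ ^ d : ℕ) : ℝ) * (n : ℝ) ^ d := by exact_mod_cast hS3
    have hnpos : (0 : ℝ) < n := by exact_mod_cast hn0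
    have hS5 : (S : ℝ) * n ≤ c * (n : ℝ) ^ d * n := by
      have : (0 : ℝ) ≤ (n : ℝ) ^ d := by positivity
      nlinarith [mul_le_mul_of_nonneg_right hnc this]
    exact le_of_mul_le_mul_right hS5 hnpos
  have hKp : ∀ i y, (ψ i y).toNat ≤ K := by
    intro i y; have := abs_le.1 (hK i y); omega
  have hKn : ∀ i y, (-ψ i y).toNat ≤ K := by
    intro i y; have := abs_le.1 (hK i y); omega
  have hle_a : ∀ z, t z = 0 → out z ≤ ∑ x ∈ mhCell t L z, a (-x +ᵥ z) := by
    intro z hz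
    by_cases hzW : z ∈ W
    · refine le_trans ?_ (hsumbox a z hz)
      have h1 := hau z hzW n hnn
      have h2 := hbound z (fun i x => (ψ i (-x +ᵥ z)).toNat)
        (fun i x => (-ψ i (-(x + mhE i) +ᵥ z)).toNat) (fun _ _ => hKp _ _) (fun _ _ => hKn _ _)
      rw [← hout] at h2
      exact_mod_cast h2.trans h1
    · have : out z = 0 := by
        rw [hout]
        have h3 : ∀ i (v : Fin d → ℤ), ψ i (v +ᵥ z) = 0 := fun i v => h0 _ (by rwa [hW]) i
        simp [h3]
      rw [this]; exact Nat.zero_le _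
  have hle_b : ∀ z, t z = 0 → inn z ≤ ∑ x ∈ mhCell t L z, b (-x +ᵥ z) := by
    intro z hz
    by_cases hzW : z ∈ W
    · refine le_trans ?_ (hsumbox b z hz)
      have h1 := hbu z hzW n hnn
      have h2 := hbound z (fun i x => (-ψ i (-x +ᵥ z)).toNat)
        (fun i x => (ψ i (-(x + mhE i) +ᵥ z)).toNat) (fun _ _ => hKn _ _) (fun _ _ => hKp _ _)
      rw [← hinn] at h2
      exact_mod_cast h2.trans h1
    · have : inn z = 0 := by
        rw [hinn]
        have h3 : ∀ i (v : Fin d → ℤ), ψ i (v +ᵥ z) = 0 := fun i v => h0 _ (by rwa [hW]) i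
        simp [h3]
      rw [this]; exact Nat.zero_le _
  -- token counts
  let o0 : Y → ℕ := fun y => if t y = 0 then ∑ x ∈ mhCell t L y, a (-x +ᵥ y) - out y else 0
  let o : Y → Option (Fin d × Bool) → ℕ := fun y j =>
    match j with
    | none => o0 y
    | some (i, true) => P i y
    | some (i, false) => N i y
  let ε : Option (Fin d × Bool) → (Fin d → ℤ) := fun j =>
    match j with
    | none => 0
    | some (i, true) => mhE i
    | some (i, false) => -mhE i
  have hnone : ∀ z, t z = 0 → ∑ x ∈ mhCell t L z, o0 (-x +ᵥ z) =
      ∑ x ∈ mhCell t L z, a (-x +ᵥ z) - out z := by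
    intro z hz
    rw [Finset.sum_eq_single 0]
    · simp [o0, hz]
    · intro x hx hx0
      rw [hCi] at hx
      simp only [o0, hx, if_neg hx0]
    · intro h
      exact absurd (by rw [hCi]; simpa using hz) h
  refine ⟨t, L, o, ε, ht, hL, ?_, ?_, ?_⟩
  · rintro (_ | ⟨i, _ | _⟩)
    · refine Measurable.ite (ht 0) ?_ measurable_const
      refine (hcm a ha).sub ?_
      exact hcm (fun y => ∑ i, (P i y + N i y))
        (Finset.measurable_fun_sum _ fun i _ => (hPm i).add (hNm i))
    · exact hNm i
    · exact hPm i
  · intro z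
    by_cases hne : (mhCell t L z).Nonempty
    · have hz := hbase z hne
      have : ∑ x ∈ mhCell t L z, ∑ j, o (-x +ᵥ z) j =
          ∑ x ∈ mhCell t L z, o0 (-x +ᵥ z) + out z := by
        simp only [out]
        rw [← Finset.sum_add_distrib]
        refine Finset.sum_congr rfl fun x _ => ?_
        simp only [Fintype.sum_option, Fintype.sum_prod_type, Fintype.sum_bool]
        simp only [o]
      rw [this, hnone z hz, Nat.sub_add_cancel (hle_a z hz)]
    · rw [Finset.not_nonempty_iff_eq_empty] at hne
      rw [hne]; simp
  · intro z
    by_cases hne : (mhCell t L z).Nonempty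
    · have hz := hbase z hne
      have : ∑ x ∈ mhCell t L z, ∑ j, o (-ε j +ᵥ (-x +ᵥ z)) j =
          ∑ x ∈ mhCell t L z, o0 (-x +ᵥ z) + inn z := by
        simp only [inn]
        rw [← Finset.sum_add_distrib]
        refine Finset.sum_congr rfl fun x _ => ?_
        simp only [Fintype.sum_option, Fintype.sum_prod_type, Fintype.sum_bool]
        simp only [o, ε, neg_zero, zero_vadd, neg_neg]
      rw [this, hnone z hz]
      have h1 := hle_a z hz
      have h2 := hle_b z hz
      have h3 := hbal z
      omega
    · rw [Finset.not_nonempty_iff_eq_empty] at hne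
      rw [hne]; simp

theorem mh_fib_count {d : ℕ} {Δ X Y : Type*} [AddCommGroup Δ] [Fintype Δ]
    [AddAction ((Fin d → ℤ) × Δ) X] [AddAction (Fin d → ℤ) Y]
    (hfree : ∀ g : (Fin d → ℤ) × Δ, g ≠ 0 → ∀ x : X, g +ᵥ x ≠ x)
    (π : X → Y)
    (hπ : ∀ (g : (Fin d → ℤ) × Δ) (x : X), π (g +ᵥ x) = g.1 +ᵥ π x)
    (hfib : ∀ p q, π p = π q → ∃ δ : Δ, q = ((0 : Fin d → ℤ), δ) +ᵥ p)
    (A : Set X) (T : Finset (Fin d → ℤ)) (x : X) :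
    (∑ v ∈ T, (A ∩ π ⁻¹' {v +ᵥ π x}).ncard =
      (A ∩ ((fun g : (Fin d → ℤ) × Δ => g +ᵥ x) '' {g | g.1 ∈ T})).ncard) ∧
    ∀ [DecidablePred (· ∈ A)], (A ∩ π ⁻¹' {π x}).ncard =
      ∑ δ : Δ, if ((0 : Fin d → ℤ), δ) +ᵥ x ∈ A then 1 else 0 := by
  classical
  have hact : ∀ (g g' : (Fin d → ℤ) × Δ) (y : X), g +ᵥ y = g' +ᵥ y → g = g' := by
    intro g g' x h
    by_contra hne
    refine hfree (-g' + g) (fun h0 => hne ?_) x ?_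
    · rw [neg_add_eq_zero] at h0; exact h0.symm
    · rw [← vadd_vadd, h, neg_vadd_vadd]
  have h1 : ∀ x : X, (A ∩ π ⁻¹' {π x}).ncard =
      ∑ δ : Δ, if ((0 : Fin d → ℤ), δ) +ᵥ x ∈ A then 1 else 0 := by
    intro x
    have : A ∩ π ⁻¹' {π x} = ↑((Finset.univ.filter
        (fun δ : Δ => ((0 : Fin d → ℤ), δ) +ᵥ x ∈ A)).image
        (fun δ : Δ => ((0 : Fin d → ℤ), δ) +ᵥ x)) := by
      ext q
      simp only [Set.mem_inter_iff, Set.mem_preimage, Set.mem_singleton_iff, Finset.coe_image,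
        Set.mem_image, Finset.mem_coe, Finset.mem_filter, Finset.mem_univ, true_and]
      constructor
      · rintro ⟨hq, hq'⟩
        obtain ⟨δ, rfl⟩ := hfib x q hq'.symm
        exact ⟨δ, hq, rfl⟩
      · rintro ⟨δ, hδ, rfl⟩
        exact ⟨hδ, by rw [hπ]; simp⟩
    rw [this, Set.ncard_coe_finset, Finset.card_image_of_injective, Finset.card_filter]
    intro δ δ' h
    exact congrArg Prod.snd (hact _ _ _ h)
  refine ⟨?_, fun {_} => by convert h1 x⟩
  have h2 : A ∩ ((fun g : (Fin d → ℤ) × Δ => g +ᵥ x) '' {g | g.1 ∈ T}) =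
      ↑(((T ×ˢ (Finset.univ : Finset Δ)).filter (fun g => g +ᵥ x ∈ A)).image
        (fun g : (Fin d → ℤ) × Δ => g +ᵥ x)) := by
    ext q
    simp only [Set.mem_inter_iff, Set.mem_image, Set.mem_ofPred_eq, Finset.coe_image,
      Finset.mem_coe, Finset.mem_filter, Finset.mem_product, Finset.mem_univ, and_true]
    constructor
    · rintro ⟨hq, g, hg, rfl⟩
      exact ⟨g, ⟨hg, hq⟩, rfl⟩
    · rintro ⟨g, ⟨hg, hq⟩, rfl⟩
      exact ⟨hq, g, hg, rfl⟩
  rw [h2, Set.ncard_coe_finset, Finset.card_image_of_injective, Finset.card_filter,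
    Finset.sum_product]
  · refine Finset.sum_congr rfl fun v _ => ?_
    have e : v +ᵥ π x = π ((v, (0 : Δ)) +ᵥ x) := by rw [hπ]
    rw [e, h1]
    refine Finset.sum_congr rfl fun δ _ => ?_
    rw [vadd_vadd]
    simp
  · intro g g' h
    exact hact _ _ _ h

theorem mh_abs {d : ℕ} {Δ X Y : Type*} [AddCommGroup Δ] [Fintype Δ]
    [MeasurableSpace X] [MeasurableSpace Y]
    [AddAction ((Fin d → ℤ) × Δ) X] [AddAction (Fin d → ℤ) Y]
    (μ : Measure X) [IsProbabilityMeasure μ]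
    (hmp : ∀ g : (Fin d → ℤ) × Δ, MeasurePreserving (fun x : X => g +ᵥ x) μ μ)
    (hfree : ∀ g : (Fin d → ℤ) × Δ, g ≠ 0 → ∀ x : X, g +ᵥ x ≠ x)
    (π : X → Y) (hπm : Measurable π) (hπs : Function.Surjective π)
    (hπ : ∀ (g : (Fin d → ℤ) × Δ) (x : X), π (g +ᵥ x) = g.1 +ᵥ π x)
    (hfib : ∀ p q, π p = π q → ∃ δ : Δ, q = ((0 : Fin d → ℤ), δ) +ᵥ p)
    (hq : ∀ S : Set Y, MeasurableSet (π ⁻¹' S) → MeasurableSet S)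
    (s : X → ℝ) (hs : Measurable s) (hinj : Function.Injective s)
    (sY : Y → ℝ) (hsY : Measurable sY) (hinjY : Function.Injective sY)
    (A B : Set X) (hA : MeasurableSet A) (hB : MeasurableSet B)
    (W₁ : Set X) (hW₁m : MeasurableSet W₁) (hW₁0 : μ W₁ᶜ = 0)
    (hW₁ : ∀ (g : (Fin d → ℤ) × Δ) (x : X), g +ᵥ x ∈ W₁ ↔ x ∈ W₁)
    (F₀ : Finset ((Fin d → ℤ) × Δ))
    (hall1 : ∀ x ∈ W₁, ∀ S : Finset X, ↑S ⊆ A ∩ AddAction.orbit ((Fin d → ℤ) × Δ) x →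
      S.card ≤ (((F₀ : Set ((Fin d → ℤ) × Δ)) +ᵥ (S : Set X)) ∩ B).ncard)
    (hall2 : ∀ x ∈ W₁, ∀ S : Finset X, ↑S ⊆ B ∩ AddAction.orbit ((Fin d → ℤ) × Δ) x →
      S.card ≤ ((-(F₀ : Set ((Fin d → ℤ) × Δ)) +ᵥ (S : Set X)) ∩ A).ncard)
    (c : ℝ) (hc : 0 < c) (n₀ : ℕ)
    (hAu : ∀ x ∈ W₁, ∀ n : ℕ, n₀ < n → c * (n : ℝ) ^ d ≤
      ((A ∩ ((fun g : (Fin d → ℤ) × Δ => g +ᵥ x) '' {g | g.1 ∈ mhBox d n})).ncard : ℝ))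
    (hBu : ∀ x ∈ W₁, ∀ n : ℕ, n₀ < n → c * (n : ℝ) ^ d ≤
      ((B ∩ ((fun g : (Fin d → ℤ) × Δ => g +ᵥ x) '' {g | g.1 ∈ mhBox d n})).ncard : ℝ)) :
    ∃ W : Set X, MeasurableSet W ∧ μ Wᶜ = 0 ∧
      (∀ (g : (Fin d → ℤ) × Δ) (x : X), g +ᵥ x ∈ W ↔ x ∈ W) ∧
      ∃ (γ : X → (Fin d → ℤ) × Δ) (F : Finset ((Fin d → ℤ) × Δ)),
      (∀ g, MeasurableSet {p | γ p = g}) ∧ (∀ p ∈ A ∩ W, γ p ∈ F) ∧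
      Set.BijOn (fun p => γ p +ᵥ p) (A ∩ W) (B ∩ W) := by
  classical
  have hm := fun g => (hmp g).measurable
  -- structure of `Y`
  have hmY : ∀ v : Fin d → ℤ, Measurable (fun y : Y => v +ᵥ y) := by
    intro v S hS
    refine hq _ ?_
    have e : π ⁻¹' ((fun y : Y => v +ᵥ y) ⁻¹' S) =
        (fun x : X => (v, (0 : Δ)) +ᵥ x) ⁻¹' (π ⁻¹' S) := by
      ext x; simp only [Set.mem_preimage, hπ]
    rw [e]
    exact hm _ (hπm hS)
  set ν : Measure Y := μ.map π with hν
  have hνp : IsProbabilityMeasure ν := Measure.isProbabilityMeasure_map hπm.aemeasurable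
  have hmpY : ∀ v : Fin d → ℤ, MeasurePreserving (fun y : Y => v +ᵥ y) ν ν := by
    intro v
    refine ⟨hmY v, ?_⟩
    rw [hν, Measure.map_map (hmY v) hπm]
    have e : (fun y : Y => v +ᵥ y) ∘ π = π ∘ (fun x : X => (v, (0 : Δ)) +ᵥ x) := by
      funext x; simp only [Function.comp, hπ]
    rw [e, ← Measure.map_map hπm (hm _), (hmp _).map_eq]
  have hfreeY : ∀ v : Fin d → ℤ, v ≠ 0 → ∀ y : Y, v +ᵥ y ≠ y := by
    intro v hv y h
    obtain ⟨x, rfl⟩ := hπs y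
    have e : π ((v, (0 : Δ)) +ᵥ x) = π x := by rw [hπ]; exact h
    obtain ⟨δ, hδ⟩ := hfib _ _ e
    rw [vadd_vadd] at hδ
    refine hfree _ ?_ x hδ.symm
    intro h0
    apply hv
    have := congrArg Prod.fst h0
    simpa using this
  have hcount : ∀ S : Set X, MeasurableSet S → Measurable (fun y => (S ∩ π ⁻¹' {y}).ncard) := by
    intro S hS
    have h1 : Measurable ((fun y => (S ∩ π ⁻¹' {y}).ncard) ∘ π) := by
      have e : (fun y => (S ∩ π ⁻¹' {y}).ncard) ∘ π =
          fun x => ∑ δ : Δ, if ((0 : Fin d → ℤ), δ) +ᵥ x ∈ S then 1 else 0 := by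
        funext x
        exact (mh_fib_count hfree π hπ hfib S ∅ x).2
      rw [e]
      refine Finset.measurable_fun_sum _ fun δ _ => ?_
      exact Measurable.ite (hm _ hS) measurable_const measurable_const
    intro T hT
    exact hq _ (h1 hT)
  -- the non-measurable bijection and flow
  have horb : ∀ x y : X, x ∈ W₁ → y ∈ AddAction.orbit ((Fin d → ℤ) × Δ) x → y ∈ W₁ := by
    rintro x y hx ⟨g, rfl⟩
    exact (hW₁ g x).2 hx
  have hset : ∀ (F : Set ((Fin d → ℤ) × Δ)) (S : Set X) (C : Set X), S ⊆ W₁ →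
      (F +ᵥ S) ∩ C = (F +ᵥ S) ∩ (C ∩ W₁) := by
    intro F S C hS
    ext y
    constructor
    · rintro ⟨h1, h2⟩
      refine ⟨h1, h2, ?_⟩
      obtain ⟨g, _, z, hz, rfl⟩ := Set.mem_vadd.1 h1
      exact (hW₁ g z).2 (hS hz)
    · rintro ⟨h1, h2, _⟩
      exact ⟨h1, h2⟩
  obtain ⟨h, hbij, hdisp⟩ := mh_hall_bij (A ∩ W₁) (B ∩ W₁) F₀
    (by
      intro x hx S hS
      rw [← hset _ _ _ (fun y hy => (hS hy).1.2)]
      exact hall1 x hx.2 S (fun y hy => ⟨(hS hy).1.1, (hS hy).2⟩))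
    (by
      intro x hx S hS
      rw [← hset _ _ _ (fun y hy => (hS hy).1.2)]
      exact hall2 x hx.2 S (fun y hy => ⟨(hS hy).1.1, (hS hy).2⟩))
  obtain ⟨ψ₀, K₀, hK₀, hdiv₀⟩ := mh_flow_of_bij π hπ (Fintype.card Δ)
    (fun y => (mh_fiber_finite π hfib y).1) (fun y => (mh_fiber_finite π hfib y).2)
    (A ∩ W₁) (B ∩ W₁) F₀ h hbij hdisp
  have hAm := hA.inter hW₁m
  have hBm := hB.inter hW₁m
  obtain ⟨ψ, hψm, ⟨K, hK⟩, hψ⟩ := mh_flow ν hmpY hfreeY sY hsY hinjY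
    (fun y => (((A ∩ W₁) ∩ π ⁻¹' {y}).ncard : ℤ) - (((B ∩ W₁) ∩ π ⁻¹' {y}).ncard : ℤ))
    (((measurable_of_countable (fun k : ℕ => (k : ℤ))).comp (hcount _ hAm)).sub
      ((measurable_of_countable (fun k : ℕ => (k : ℤ))).comp (hcount _ hBm))) ψ₀ K₀ hK₀ hdiv₀
  have hsat : π ⁻¹' (π '' W₁) = W₁ := by
    ext x
    constructor
    · rintro ⟨z, hz, e⟩
      obtain ⟨δ, rfl⟩ := hfib z x e
      exact (hW₁ _ _).2 hz
    · intro hx; exact ⟨x, hx, rfl⟩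
  have himm : MeasurableSet (π '' W₁) := hq _ (by rw [hsat]; exact hW₁m)
  have him : ∀ᵐ y ∂ν, y ∈ π '' W₁ := by
    rw [ae_iff]
    change ν (π '' W₁)ᶜ = 0
    rw [hν, Measure.map_apply hπm himm.compl, Set.preimage_compl, hsat, hW₁0]
  obtain ⟨V, hVm, hV0, hVi, hV⟩ := mh_inv_core ν hmpY _ (hψ.and him)
  have hVW : π ⁻¹' V ⊆ W₁ := by
    intro x hx
    rw [← hsat]
    exact (hV _ hx).2
  have hfibV : ∀ (S : Set X) (y : Y), y ∈ V → (S ∩ π ⁻¹' V) ∩ π ⁻¹' {y} = (S ∩ W₁) ∩ π ⁻¹' {y} := by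
    intro S y hy
    ext x
    constructor
    · rintro ⟨⟨h1, h2⟩, h3⟩
      exact ⟨⟨h1, hVW h2⟩, h3⟩
    · rintro ⟨⟨h1, h2⟩, h3⟩
      refine ⟨⟨h1, ?_⟩, h3⟩
      have : π x = y := h3
      rw [Set.mem_preimage, this]; exact hy
  have hfibV' : ∀ (S : Set X) (y : Y), y ∈ V → (S ∩ π ⁻¹' V) ∩ π ⁻¹' {y} = S ∩ π ⁻¹' {y} := by
    intro S y hy
    ext x
    constructor
    · rintro ⟨⟨h1, h2⟩, h3⟩
      exact ⟨h1, h3⟩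
    · rintro ⟨h1, h3⟩
      refine ⟨⟨h1, ?_⟩, h3⟩
      have : π x = y := h3
      rw [Set.mem_preimage, this]; exact hy
  have hfib0 : ∀ (S : Set X) (y : Y), y ∉ V → (S ∩ π ⁻¹' V) ∩ π ⁻¹' {y} = ∅ := by
    intro S y hy
    ext x
    simp only [Set.mem_inter_iff, Set.mem_preimage, Set.mem_singleton_iff, Set.mem_empty_iff_false,
      iff_false]
    rintro ⟨⟨_, h2⟩, rfl⟩
    exact hy h2
  have hWm : MeasurableSet (π ⁻¹' V) := hπm hVm
  have hu : ∀ S : Set X, (∀ x ∈ W₁, ∀ n : ℕ, n₀ < n → c * (n : ℝ) ^ d ≤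
      ((S ∩ ((fun g : (Fin d → ℤ) × Δ => g +ᵥ x) '' {g | g.1 ∈ mhBox d n})).ncard : ℝ)) →
      ∀ y ∈ V, ∀ n : ℕ, n₀ < n → c * (n : ℝ) ^ d ≤
        ((∑ v ∈ mhBox d n, ((S ∩ π ⁻¹' V) ∩ π ⁻¹' {v +ᵥ y}).ncard : ℕ) : ℝ) := by
    intro S hS y hy n hn
    obtain ⟨x, rfl⟩ := hπs y
    have e : ∑ v ∈ mhBox d n, ((S ∩ π ⁻¹' V) ∩ π ⁻¹' {v +ᵥ π x}).ncard =
        ∑ v ∈ mhBox d n, (S ∩ π ⁻¹' {v +ᵥ π x}).ncard :=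
      Finset.sum_congr rfl fun v _ => by rw [hfibV' S _ ((hVi v _).2 hy)]
    rw [e, (mh_fib_count hfree π hπ hfib S (mhBox d n) x).1]
    exact hS x (hVW hy) n hn
  obtain ⟨t, L, o, ε, ht, hL, ho, hsa, hsb⟩ := mh_tiles hmY hfreeY sY hsY hinjY
    (fun i => V.indicator (ψ i)) (fun i => (hψm i).indicator hVm) K
    (by
      intro i y
      by_cases hy : y ∈ V
      · simp only [Set.indicator_of_mem hy]; exact hK i y
      · simp [Set.indicator_of_notMem hy])
    (fun y => ((A ∩ π ⁻¹' V) ∩ π ⁻¹' {y}).ncard) (fun y => ((B ∩ π ⁻¹' V) ∩ π ⁻¹' {y}).ncard)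
    (hcount _ (hA.inter hWm)) (hcount _ (hB.inter hWm))
    (by
      intro y
      by_cases hy : y ∈ V
      · rw [hfibV A y hy, hfibV B y hy, ← (hV y hy).1]
        simp only [mhDiv]
        refine Finset.sum_congr rfl fun i _ => ?_
        rw [Set.indicator_of_mem hy, Set.indicator_of_mem ((hVi _ _).2 hy)]
      · rw [hfib0 A y hy, hfib0 B y hy]
        simp only [mhDiv, Set.ncard_empty, sub_self]
        refine Finset.sum_eq_zero fun i _ => ?_
        rw [Set.indicator_of_notMem hy, Set.indicator_of_notMem (fun h => hy ((hVi _ _).1 h)),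
          sub_zero])
    V hVi (fun y hy i => Set.indicator_of_notMem hy _) c hc n₀ (hu A hAu) (hu B hBu)
  obtain ⟨γ, F, h1, h2, h3⟩ := mh_match hm hmY hfree π hπm hπs hπ hfib s hs hinj t ht L hL o ho ε
    (A ∩ π ⁻¹' V) (B ∩ π ⁻¹' V) (hA.inter hWm) (hB.inter hWm) hsa hsb
  refine ⟨π ⁻¹' V, hWm, ?_, ?_, γ, F, h1, h2, h3⟩
  · rw [← Set.preimage_compl, ← Measure.map_apply hπm hVm.compl]
    exact hV0
  · intro g x
    rw [Set.mem_preimage, hπ, hVi]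
    rfl

theorem mh_b_to_a {G X : Type*} [AddGroup G] [Countable G] [AddAction G X] [MeasurableSpace X]
    (μ : Measure X) (hmp : ∀ g : G, MeasurePreserving (fun x : X => g +ᵥ x) μ μ) (A B : Set X)
    (h : EquidecompUpToNull (G := G) μ A B) : HallConditionAE (G := G) μ A B := by
  classical
  obtain ⟨n, P, g, X', h0, ⟨hA, hAd⟩, ⟨hB, hBd⟩⟩ := h
  obtain ⟨W, _, hW0, hWi, hWX⟩ := mh_inv_core μ hmp (fun x => x ∈ X') (by rw [ae_iff]; exact h0)
  refine ⟨Finset.univ.image g, W, hW0, fun x hx => ⟨fun S hS => ?_, fun T hT => ?_⟩⟩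
  · have hSW : ∀ y ∈ S, y ∈ W := by
      intro y hy
      obtain ⟨k, rfl⟩ := (hS hy).2
      exact (hWi _ _).2 hx
    have hex : ∀ y : S, ∃ i, (y : X) ∈ P i ∩ X' := by
      intro y
      have : (y : X) ∈ A ∩ X' := ⟨(hS y.2).1, hWX _ (hSW y y.2)⟩
      rw [← hA] at this
      exact Set.mem_iUnion.1 this
    choose i hi using hex
    have him : ∀ y : S, g (i y) +ᵥ (y : X) ∈ (g (i y) +ᵥ P (i y)) ∩ X' := fun y =>
      ⟨Set.vadd_mem_vadd_set (hi y).1, hWX _ ((hWi _ _).2 (hSW y y.2))⟩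
    have hinj : Function.Injective (fun y : S => g (i y) +ᵥ (y : X)) := by
      intro y z hyz
      simp only at hyz
      have hij : i y = i z := by
        by_contra hne
        have h2 := him z
        rw [← hyz] at h2
        exact Set.disjoint_left.1 (hBd hne) (him y) h2
      rw [hij] at hyz
      exact Subtype.ext (vadd_left_cancel _ hyz)
    have hfin : (((Finset.univ.image g : Finset G) : Set G) +ᵥ (S : Set X)).Finite :=
      Set.Finite.vadd (Finset.finite_toSet _) (Finset.finite_toSet _)
    have hsub : Set.range (fun y : S => g (i y) +ᵥ (y : X)) ⊆
        (((Finset.univ.image g : Finset G) : Set G) +ᵥ (S : Set X)) ∩ B := by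
      rintro _ ⟨y, rfl⟩
      refine ⟨Set.vadd_mem_vadd (by simp) y.2, ?_⟩
      have : g (i y) +ᵥ (y : X) ∈ B ∩ X' := by rw [← hB]; exact Set.mem_iUnion.2 ⟨i y, him y⟩
      exact this.1
    calc S.card = (Set.range (fun y : S => g (i y) +ᵥ (y : X))).ncard := by
          rw [← Set.image_univ, Set.ncard_image_of_injective _ hinj, Set.ncard_univ]; simp
      _ ≤ _ := Set.ncard_le_ncard hsub (hfin.subset Set.inter_subset_left)
  · have hTW : ∀ y ∈ T, y ∈ W := by
      intro y hy
      obtain ⟨k, rfl⟩ := (hT hy).2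
      exact (hWi _ _).2 hx
    have hex : ∀ y : T, ∃ i, (y : X) ∈ (g i +ᵥ P i) ∩ X' := by
      intro y
      have : (y : X) ∈ B ∩ X' := ⟨(hT y.2).1, hWX _ (hTW y y.2)⟩
      rw [← hB] at this
      exact Set.mem_iUnion.1 this
    choose i hi using hex
    have him : ∀ y : T, -g (i y) +ᵥ (y : X) ∈ P (i y) ∩ X' := fun y =>
      ⟨Set.mem_vadd_set_iff_neg_vadd_mem.1 (hi y).1, hWX _ ((hWi _ _).2 (hTW y y.2))⟩
    have hinj : Function.Injective (fun y : T => -g (i y) +ᵥ (y : X)) := by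
      intro y z hyz
      simp only at hyz
      have hij : i y = i z := by
        by_contra hne
        have h2 := him z
        rw [← hyz] at h2
        exact Set.disjoint_left.1 (hAd hne) (him y) h2
      rw [hij] at hyz
      exact Subtype.ext (vadd_left_cancel _ hyz)
    have hfin : ((-((Finset.univ.image g : Finset G) : Set G)) +ᵥ (T : Set X)).Finite :=
      Set.Finite.vadd (Finset.finite_toSet _).neg (Finset.finite_toSet _)
    have hsub : Set.range (fun y : T => -g (i y) +ᵥ (y : X)) ⊆
        ((-((Finset.univ.image g : Finset G) : Set G)) +ᵥ (T : Set X)) ∩ A := by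
      rintro _ ⟨y, rfl⟩
      refine ⟨Set.vadd_mem_vadd (by simp) y.2, ?_⟩
      have : -g (i y) +ᵥ (y : X) ∈ A ∩ X' := by rw [← hA]; exact Set.mem_iUnion.2 ⟨i y, him y⟩
      exact this.1
    calc T.card = (Set.range (fun y : T => -g (i y) +ᵥ (y : X))).ncard := by
          rw [← Set.image_univ, Set.ncard_image_of_injective _ hinj, Set.ncard_univ]; simp
      _ ≤ _ := Set.ncard_le_ncard hsub (hfin.subset Set.inter_subset_left)

/-- From a measurable piecewise translation to measurable pieces. -/
theorem mh_pieces {G X : Type*} [AddGroup G] [AddAction G X] [MeasurableSpace X]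
    (μ : Measure X) (A B W : Set X) (hA : MeasurableSet A) (hW : MeasurableSet W)
    (hW0 : μ Wᶜ = 0) (γ : X → G) (F : Finset G) (hγ : ∀ g, MeasurableSet {p | γ p = g})
    (hF : ∀ p ∈ A ∩ W, γ p ∈ F) (hbij : Set.BijOn (fun p => γ p +ᵥ p) (A ∩ W) (B ∩ W)) :
    EquidecompUpToNullMeasurable (G := G) μ A B := by
  classical
  let e := F.equivFin
  let g : Fin F.card → G := fun i => (e.symm i : G)
  have hg : Function.Injective g := fun i j h => e.symm.injective (Subtype.ext h)
  have hgs : ∀ k ∈ F, ∃ i, g i = k := fun k hk => ⟨e ⟨k, hk⟩, by simp [g]⟩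
  have hmem : ∀ i x, x ∈ (g i +ᵥ ((A ∩ W) ∩ {p | γ p = g i})) ↔
      ∃ p ∈ A ∩ W, γ p = g i ∧ γ p +ᵥ p = x := by
    intro i x
    constructor
    · rintro ⟨p, ⟨hp, hp'⟩, rfl⟩
      have : γ p = g i := hp'
      exact ⟨p, hp, this, by rw [this]⟩
    · rintro ⟨p, hp, hp', rfl⟩
      rw [hp']
      exact ⟨p, ⟨hp, hp'⟩, rfl⟩
  refine ⟨F.card, fun i => (A ∩ W) ∩ {p | γ p = g i}, g, W,
    fun i => (hA.inter hW).inter (hγ _), hW0, ⟨?_, ?_⟩, ⟨?_, ?_⟩⟩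
  · ext x
    rw [Set.mem_iUnion]
    constructor
    · rintro ⟨i, h1, h2⟩
      exact h1.1
    · intro hx
      obtain ⟨i, hi⟩ := hgs _ (hF x hx)
      exact ⟨i, ⟨hx, hi.symm⟩, hx.2⟩
  · intro i j hij
    refine Set.disjoint_left.2 ?_
    rintro x ⟨⟨_, h1⟩, _⟩ ⟨⟨_, h2⟩, _⟩
    have h1' : γ x = g i := h1
    have h2' : γ x = g j := h2
    exact hij (hg (h1'.symm.trans h2'))
  · ext x
    rw [Set.mem_iUnion]
    constructor
    · rintro ⟨i, h1, h2⟩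
      rw [hmem] at h1
      obtain ⟨p, hp, _, rfl⟩ := h1
      exact hbij.mapsTo hp
    · intro hx
      obtain ⟨p, hp, rfl⟩ := hbij.surjOn hx
      obtain ⟨i, hi⟩ := hgs _ (hF p hp)
      exact ⟨i, (hmem i _).2 ⟨p, hp, hi.symm, rfl⟩, hx.2⟩
  · intro i j hij
    refine Set.disjoint_left.2 ?_
    rintro x ⟨h1, _⟩ ⟨h2, _⟩
    rw [hmem] at h1 h2
    obtain ⟨p, hp, hp1, hp2⟩ := h1
    obtain ⟨q, hq, hq1, hq2⟩ := h2
    have : p = q := hbij.injOn hp hq (hp2.trans hq2.symm)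
    subst this
    exact hij (hg (hp1.symm.trans hq1))

/-- The equivalence relation of lying in the same orbit of the finite factor. -/
def mhSetoid (d : ℕ) (Δ X : Type*) [AddCommGroup Δ] [AddAction ((Fin d → ℤ) × Δ) X] : Setoid X where
  r x y := ∃ δ : Δ, y = ((0 : Fin d → ℤ), δ) +ᵥ x
  iseqv := by
    refine ⟨fun x => ⟨0, ?_⟩, ?_, ?_⟩
    · exact (zero_vadd _ x).symm
    · rintro x y ⟨δ, rfl⟩
      refine ⟨-δ, ?_⟩
      rw [vadd_vadd]
      simp only [Prod.mk_add_mk, add_zero, neg_add_cancel]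
      exact (zero_vadd _ x).symm
    · rintro x y z ⟨δ, rfl⟩ ⟨δ', rfl⟩
      refine ⟨δ' + δ, ?_⟩
      rw [vadd_vadd]
      simp

/-- The induced action on the quotient. -/
noncomputable def mhQuotAction (d : ℕ) (Δ X : Type*) [AddCommGroup Δ] [AddAction ((Fin d → ℤ) × Δ) X] :
    AddAction (Fin d → ℤ) (Quotient (mhSetoid d Δ X)) where
  vadd v := Quotient.map (fun x => (v, (0 : Δ)) +ᵥ x) (by
    rintro x y ⟨δ, rfl⟩
    refine ⟨δ, ?_⟩
    rw [vadd_vadd, vadd_vadd, add_comm])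
  zero_vadd := by
    rintro ⟨x⟩
    exact congrArg (Quotient.mk _) (zero_vadd ((Fin d → ℤ) × Δ) x)
  add_vadd := by
    rintro v w ⟨x⟩
    refine congrArg (Quotient.mk _) ?_
    simp only [vadd_vadd, Prod.mk_add_mk, add_zero]

theorem mh_a_to_c {X : Type*} {d : ℕ} {Δ : Type*} [AddCommGroup Δ] [Fintype Δ]
    [MeasurableSpace X] [StandardBorelSpace X] (μ : Measure X) [IsProbabilityMeasure μ]
    [AddAction ((Fin d → ℤ) × Δ) X]
    (hfree : ∀ g : (Fin d → ℤ) × Δ, g ≠ 0 → ∀ x : X, g +ᵥ x ≠ x)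
    (hmp : ∀ g : (Fin d → ℤ) × Δ, MeasurePreserving (fun x : X => g +ᵥ x) μ μ)
    (A B : Set X) (hA : MeasurableSet A) (hB : MeasurableSet B)
    (hAu : GUniform (d := d) (Δ := Δ) μ A) (hBu : GUniform (d := d) (Δ := Δ) μ B)
    (hall : HallConditionAE (G := (Fin d → ℤ) × Δ) μ A B) :
    EquidecompUpToNullMeasurable (G := (Fin d → ℤ) × Δ) μ A B := by
  classical
  obtain ⟨F₀, X', hX'0, hX'⟩ := hall
  obtain ⟨c₁, n₁, hc₁, h₁⟩ := hAu
  obtain ⟨c₂, n₂, hc₂, h₂⟩ := hBu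
  have hXae : ∀ᵐ x ∂μ, x ∈ X' := by rw [ae_iff]; exact hX'0
  obtain ⟨W₁, hW₁m, hW₁0, hW₁i, hW₁⟩ := mh_inv_core μ hmp _ ((h₁.and h₂).and hXae)
  obtain ⟨s, hsE⟩ := exists_measurableEmbedding_real X
  letI := mhQuotAction d Δ X
  let π : X → Quotient (mhSetoid d Δ X) := Quotient.mk _
  have hfib : ∀ p q, π p = π q → ∃ δ : Δ, q = ((0 : Fin d → ℤ), δ) +ᵥ p := fun p q h =>
    Quotient.exact h
  have hπ0 : ∀ (δ : Δ) (x : X), π (((0 : Fin d → ℤ), δ) +ᵥ x) = π x := fun δ x =>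
    (Quotient.sound ⟨δ, rfl⟩ : π x = π _).symm
  have hπ : ∀ (g : (Fin d → ℤ) × Δ) (x : X), π (g +ᵥ x) = g.1 +ᵥ π x := by
    rintro ⟨v, δ⟩ x
    have h1 : ((v, δ) : (Fin d → ℤ) × Δ) +ᵥ x = ((0 : Fin d → ℤ), δ) +ᵥ ((v, (0 : Δ)) +ᵥ x) := by
      rw [vadd_vadd]; simp
    rw [h1, hπ0]
    rfl
  let m : X → ℝ := fun x => ⨅ δ : Δ, s (((0 : Fin d → ℤ), δ) +ᵥ x)
  have hmm : Measurable m := Measurable.iInf fun δ => hsE.measurable.comp (hmp _).measurable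
  have hmr : ∀ x y : X, (mhSetoid d Δ X).r x y → m x = m y := by
    rintro x y ⟨δ, rfl⟩
    refine (Equiv.iInf_congr (Equiv.addRight δ) fun δ' => ?_).symm
    rw [vadd_vadd]
    simp
  let sY : Quotient (mhSetoid d Δ X) → ℝ := Quotient.lift m hmr
  have hsY : Measurable sY := by
    intro S hS
    exact measurableSet_quotient.2 (hmm hS)
  have hinjY : Function.Injective sY := by
    rintro ⟨x⟩ ⟨y⟩ hxy
    have hxy' : m x = m y := hxy
    obtain ⟨δ, hδ⟩ := exists_eq_ciInf_of_finite (f := fun δ : Δ => s (((0 : Fin d → ℤ), δ) +ᵥ x))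
    obtain ⟨δ', hδ'⟩ := exists_eq_ciInf_of_finite (f := fun δ : Δ => s (((0 : Fin d → ℤ), δ) +ᵥ y))
    have h3 : s (((0 : Fin d → ℤ), δ) +ᵥ x) = s (((0 : Fin d → ℤ), δ') +ᵥ y) :=
      hδ.trans (hxy'.trans hδ'.symm)
    have h4 := congrArg π (hsE.injective h3)
    rw [hπ0, hπ0] at h4
    exact h4
  have hbox : ∀ n : ℕ, Fbox d Δ n = {g : (Fin d → ℤ) × Δ | g.1 ∈ mhBox d n} := by
    intro n
    ext g
    simp only [Fbox, Set.mem_ofPred_eq, mem_mhBox, Set.mem_Ico]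
  obtain ⟨W, hWm, hW0, _, γ, F, hγ, hF, hbij⟩ := mh_abs μ hmp hfree π (fun S hS => measurableSet_quotient.1 hS)
    Quotient.mk_surjective hπ hfib (fun S hS => measurableSet_quotient.2 hS) s hsE.measurable
    hsE.injective sY hsY hinjY A B hA hB W₁ hW₁m hW₁0 hW₁i F₀
    (fun x hx => (hX' x (hW₁ x hx).2).1) (fun x hx => (hX' x (hW₁ x hx).2).2)
    (min c₁ c₂) (lt_min hc₁ hc₂) (max n₁ n₂)
    (by
      intro x hx n hn
      have := (hW₁ x hx).1.1 n (lt_of_le_of_lt (le_max_left _ _) hn)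
      rw [hbox] at this
      exact (mul_le_mul_of_nonneg_right (min_le_left _ _) (by positivity)).trans this)
    (by
      intro x hx n hn
      have := (hW₁ x hx).1.2 n (lt_of_le_of_lt (le_max_right _ _) hn)
      rw [hbox] at this
      exact (mul_le_mul_of_nonneg_right (min_le_right _ _) (by positivity)).trans this)
  exact mh_pieces μ A B W hA hWm hW0 γ F hγ hF hbij

/-- Measurable Hall's theorem (Cieśla–Sabok): for a standard Borel probability space `(X, μ)`
with a free pmp action of `G = ℤ^d × Δ` (`Δ` a finite abelian group), and measurable
`G`-uniform sets `A, B ⊆ X`, the conditions (a) Hall's condition a.e., (b) equidecomposability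
up to measure zero, and (c) equidecomposability up to measure zero with measurable pieces,
are all equivalent. -/
theorem measurable_hall {X : Type*} {d : ℕ} {Δ : Type*} [AddCommGroup Δ] [Fintype Δ]
    [MeasurableSpace X] [StandardBorelSpace X] (μ : Measure X) [IsProbabilityMeasure μ]
    [AddAction ((Fin d → ℤ) × Δ) X]
    (hfree : ∀ g : (Fin d → ℤ) × Δ, g ≠ 0 → ∀ x : X, g +ᵥ x ≠ x)
    (hmp : ∀ g : (Fin d → ℤ) × Δ, MeasurePreserving (fun x : X => g +ᵥ x) μ μ)
    (A B : Set X) (hA : MeasurableSet A) (hB : MeasurableSet B)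
    (hAu : GUniform (d := d) (Δ := Δ) μ A) (hBu : GUniform (d := d) (Δ := Δ) μ B) :
    (HallConditionAE (G := (Fin d → ℤ) × Δ) μ A B ↔
        EquidecompUpToNull (G := (Fin d → ℤ) × Δ) μ A B) ∧
      (EquidecompUpToNull (G := (Fin d → ℤ) × Δ) μ A B ↔
        EquidecompUpToNullMeasurable (G := (Fin d → ℤ) × Δ) μ A B) := by

  have hba := mh_b_to_a (G := (Fin d → ℤ) × Δ) μ hmp A B
  have hac := mh_a_to_c μ hfree hmp A B hA hB hAu hBu
  have hcb : EquidecompUpToNullMeasurable (G := (Fin d → ℤ) × Δ) μ A B →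
      EquidecompUpToNull (G := (Fin d → ℤ) × Δ) μ A B := by
    rintro ⟨n, P, g, X', _, h⟩
    exact ⟨n, P, g, X', h⟩
  exact ⟨⟨fun h => hcb (hac h), hba⟩, ⟨fun h => hac (hba h), hcb⟩⟩
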